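/- Let X be an (M,p̄)-cookie random walk and suppose α = 1. Then there exists a constant c > 0 such that (log n / n) · X_n converges in probability to c as n → ∞. -/

import Mathlib

open MeasureTheory ProbabilityTheory Filter Set Asymptotics
open scoped ENNReal NNReal Topology

noncomputable section

/-- The strength of the `j`-th cookie: `p j` for `j ≤ M`, and `1/2` afterwards. -/
def cookieP (M : ℕ) (p : ℕ → ℝ) (j : ℕ) : ℝ :=
  if j ≤ M then p j else 1 / 2

/-- The parameter `α = (∑_{i=1}^M (2 p_i - 1)) - 1`. -/
def cookieAlpha (M : ℕ) (p : ℕ → ℝ) : ℝ :=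
  (∑ i ∈ Finset.Icc 1 M, (2 * p i - 1)) - 1

/-- `X` is an `(M, p̄)`-cookie random walk under the probability measure `P`:
`X 0 = 0` a.s., nearest-neighbour steps, and upon the `j`-th visit of the current
site the walk steps to the right with probability `p j` if `j ≤ M` and `1/2` otherwise. -/
structure IsCookieRW (M : ℕ) (p : ℕ → ℝ) {Ω : Type*} [MeasurableSpace Ω]
    (P : Measure Ω) (X : ℕ → Ω → ℤ) : Prop where
  isProb : IsProbabilityMeasure P
  meas : ∀ n, Measurable (X n)
  init : P {ω | X 0 ω = 0} = 1
  steps : ∀ n, P {ω | |X (n + 1) ω - X n ω| = 1} = 1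
  cond : ∀ (n : ℕ) (x : ℕ → ℤ), x 0 = 0 →
    0 < P {ω | ∀ i ≤ n, X i ω = x i} →
    P ({ω | X (n + 1) ω = x n + 1} ∩ {ω | ∀ i ≤ n, X i ω = x i})
      = ENNReal.ofReal
          (cookieP M p (((Finset.range (n + 1)).filter (fun i => x i = x n)).card))
        * P {ω | ∀ i ≤ n, X i ω = x i}

/-- First hitting time of level `n` by the walk `X`. -/
def hitT {Ω : Type*} (X : ℕ → Ω → ℤ) (n : ℕ) (ω : Ω) : ℕ :=
  sInf {k | X k ω = (n : ℤ)}

namespace CookieWalk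

variable {M : ℕ} {r : ℕ → ℝ}

/-- The probability that exactly `d` failures precede the `u`-th success, when the coins with
indices `i, i + 1, …` are tossed and coin `j` succeeds with probability `r j`. -/
def negBin (r : ℕ → ℝ) : ℕ → ℕ → ℕ → ℝ
  | _, 0, d => if d = 0 then 1 else 0
  | i, u + 1, 0 => r i * negBin r (i + 1) u 0
  | i, u + 1, d + 1 => r i * negBin r (i + 1) u (d + 1) + (1 - r i) * negBin r (i + 1) (u + 1) d
termination_by _ u d => u + d

/-- Success probabilities of the coins at a site: biased to the right, eventually fair, and
with total drift `2`. -/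
structure IsCoins (M : ℕ) (r : ℕ → ℝ) : Prop where
  half_le : ∀ i, 1 / 2 ≤ r i
  lt_one : ∀ i, r i < 1
  fair : ∀ i, M ≤ i → r i = 1 / 2
  drift : ∑ i ∈ Finset.range M, (2 * r i - 1) = 2


lemma negBin_zero (r : ℕ → ℝ) (i d : ℕ) : negBin r i 0 d = if d = 0 then 1 else 0 := by
  rw [negBin]

lemma negBin_succ_zero (r : ℕ → ℝ) (i u : ℕ) :
    negBin r i (u + 1) 0 = r i * negBin r (i + 1) u 0 := by
  rw [negBin]

lemma negBin_succ_succ (r : ℕ → ℝ) (i u d : ℕ) :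
    negBin r i (u + 1) (d + 1) =
      r i * negBin r (i + 1) u (d + 1) + (1 - r i) * negBin r (i + 1) (u + 1) d := by
  rw [negBin]

lemma IsCoins.pos (h : IsCoins M r) (i : ℕ) : 0 < r i := by
  have := h.half_le i; linarith

lemma IsCoins.one_sub_pos (h : IsCoins M r) (i : ℕ) : 0 < 1 - r i := by
  have := h.lt_one i; linarith

lemma negBin_nonneg (h : IsCoins M r) (i u d : ℕ) : 0 ≤ negBin r i u d := by
  induction hn : u + d using Nat.strong_induction_on generalizing i u d with
  | _ n ih =>
    rcases u with _ | u
    · rw [negBin_zero]; split_ifs <;> norm_num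
    · have h1 := (h.pos i).le
      have h2 := (h.one_sub_pos i).le
      rcases d with _ | d
      · rw [negBin_succ_zero]
        exact mul_nonneg h1 (ih _ (by omega) (i + 1) u 0 rfl)
      · rw [negBin_succ_succ]
        exact add_nonneg (mul_nonneg h1 (ih _ (by omega) (i + 1) u (d + 1) rfl))
          (mul_nonneg h2 (ih _ (by omega) (i + 1) (u + 1) d rfl))

lemma negBin_fair (h : IsCoins M r) (i u d : ℕ) (hi : M ≤ i) :
    negBin r (i + 1) u d = negBin r i u d := by
  induction hn : u + d using Nat.strong_induction_on generalizing i u d with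
  | _ n ih =>
    rcases u with _ | u
    · simp [negBin_zero]
    · rcases d with _ | d
      · rw [negBin_succ_zero, negBin_succ_zero, h.fair i hi, h.fair (i + 1) (by omega),
          ih _ (by omega) (i + 1) u 0 (by omega) rfl]
      · rw [negBin_succ_succ, negBin_succ_succ, h.fair i hi, h.fair (i + 1) (by omega),
          ih _ (by omega) (i + 1) u (d + 1) (by omega) rfl,
          ih _ (by omega) (i + 1) (u + 1) d (by omega) rfl]

lemma negBin_zero_right_pos (h : IsCoins M r) (i u : ℕ) : 0 < negBin r i u 0 := by
  induction u generalizing i with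
  | zero => simp [negBin_zero]
  | succ u ih => rw [negBin_succ_zero]; exact mul_pos (h.pos i) (ih _)

lemma negBin_one_pos (h : IsCoins M r) (i d : ℕ) : 0 < negBin r i 1 d := by
  induction d generalizing i with
  | zero => exact negBin_zero_right_pos h i 1
  | succ d ih =>
    rw [negBin_succ_succ]
    exact add_pos_of_nonneg_of_pos (mul_nonneg (h.pos i).le (negBin_nonneg h _ _ _))
      (mul_pos (h.one_sub_pos i) (ih _))

/-- If coins fall back to a summable tail, one more coin keeps weighted summability. -/
lemma summable_negBin_step {i : ℕ} {s : ℝ}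
    (hs : ∀ u, Summable fun d => negBin r (i + 1) u d * s ^ d) (u : ℕ) :
    Summable fun d => negBin r i u d * s ^ d := by
  rcases u with _ | u
  · refine summable_of_ne_finset_zero (s := {0}) ?_
    intro d hd
    simp at hd
    simp [negBin_zero, hd]
  · rw [← summable_nat_add_iff 1]
    have h1 := ((summable_nat_add_iff 1).2 (hs u)).mul_left (r i)
    have h2 := (hs (u + 1)).mul_left ((1 - r i) * s)
    refine (h1.add h2).congr fun d => ?_
    rw [negBin_succ_succ]
    ring

lemma sum_negBin_fair_le (h : IsCoins M r) (u N : ℕ) :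
    ∑ d ∈ Finset.range N, negBin r M u d * (3 / 2 : ℝ) ^ d ≤ 2 ^ u := by
  induction u generalizing N with
  | zero =>
    rcases N with _ | N
    · simp
    · rw [Finset.sum_range_succ']
      simp [negBin_zero]
  | succ u ih =>
    have hnn : ∀ v d, 0 ≤ negBin r M v d * (3 / 2 : ℝ) ^ d := fun v d =>
      mul_nonneg (negBin_nonneg h _ _ _) (by positivity)
    have key : ∑ d ∈ Finset.range (N + 1), negBin r M (u + 1) d * (3 / 2 : ℝ) ^ d =
        1 / 2 * ∑ d ∈ Finset.range (N + 1), negBin r M u d * (3 / 2 : ℝ) ^ d +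
          3 / 4 * ∑ d ∈ Finset.range N, negBin r M (u + 1) d * (3 / 2 : ℝ) ^ d := by
      rw [Finset.sum_range_succ', Finset.sum_range_succ' _ N, negBin_succ_zero,
        negBin_fair h _ _ _ le_rfl, h.fair M le_rfl, mul_add, Finset.mul_sum, Finset.mul_sum,
        add_right_comm, ← Finset.sum_add_distrib]
      congr 1
      · refine Finset.sum_congr rfl fun d _ => ?_
        rw [negBin_succ_succ, negBin_fair h _ _ _ le_rfl, negBin_fair h _ _ _ le_rfl,
          h.fair M le_rfl]
        ring
      · ring
    have hmono : ∑ d ∈ Finset.range N, negBin r M (u + 1) d * (3 / 2 : ℝ) ^ d ≤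
        ∑ d ∈ Finset.range (N + 1), negBin r M (u + 1) d * (3 / 2 : ℝ) ^ d := by
      rw [Finset.sum_range_succ]
      linarith [hnn (u + 1) N]
    have := ih (N + 1)
    rw [pow_succ]
    linarith

lemma summable_negBin (h : IsCoins M r) (i u : ℕ) :
    Summable fun d => negBin r i u d * (3 / 2 : ℝ) ^ d := by
  have base : ∀ u, Summable fun d => negBin r M u d * (3 / 2 : ℝ) ^ d := fun u =>
    summable_of_sum_range_le
      (fun d => mul_nonneg (negBin_nonneg h _ _ _) (by positivity))
      (sum_negBin_fair_le h u)
  rcases le_total M i with hi | hi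
  · have : ∀ u, Summable fun d => negBin r i u d * (3 / 2 : ℝ) ^ d := by
      induction i, hi using Nat.le_induction with
      | base => exact base
      | succ i hi ih =>
        intro u
        refine (ih u).congr fun d => ?_
        rw [negBin_fair h _ _ _ hi]
    exact this u
  · have : ∀ u, Summable fun d => negBin r i u d * (3 / 2 : ℝ) ^ d := by
      exact Nat.decreasingInduction
        (motive := fun i _ => ∀ u, Summable fun d => negBin r i u d * (3 / 2 : ℝ) ^ d)
        (fun i _ ih => summable_negBin_step ih) base hi
    exact this u

/-- Functions growing at most like `(3 / 2) ^ d`. -/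
def ExpBdd (φ : ℕ → ℝ) : Prop := ∃ C : ℝ, ∀ d, |φ d| ≤ C * (3 / 2 : ℝ) ^ d

/-- Expectation of `φ` under the law `negBin r i u`. -/
def ev (r : ℕ → ℝ) (i u : ℕ) (φ : ℕ → ℝ) : ℝ := ∑' d, negBin r i u d * φ d

lemma ExpBdd.summable {φ : ℕ → ℝ} (hφ : ExpBdd φ) (h : IsCoins M r) (i u : ℕ) :
    Summable fun d => negBin r i u d * φ d := by
  obtain ⟨C, hC⟩ := hφ
  refine Summable.of_norm_bounded ((summable_negBin h i u).mul_left C) fun d => ?_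
  rw [norm_mul, Real.norm_eq_abs, Real.norm_eq_abs, abs_of_nonneg (negBin_nonneg h _ _ _)]
  calc negBin r i u d * |φ d| ≤ negBin r i u d * (C * (3 / 2 : ℝ) ^ d) :=
        mul_le_mul_of_nonneg_left (hC d) (negBin_nonneg h _ _ _)
    _ = C * (negBin r i u d * (3 / 2 : ℝ) ^ d) := by ring

lemma ExpBdd.add {φ ψ : ℕ → ℝ} (hφ : ExpBdd φ) (hψ : ExpBdd ψ) :
    ExpBdd fun d => φ d + ψ d := by
  obtain ⟨C, hC⟩ := hφ
  obtain ⟨D, hD⟩ := hψ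
  exact ⟨C + D, fun d => (abs_add_le _ _).trans (by linarith [hC d, hD d])⟩

lemma ExpBdd.const_mul {φ : ℕ → ℝ} (hφ : ExpBdd φ) (a : ℝ) : ExpBdd fun d => a * φ d := by
  obtain ⟨C, hC⟩ := hφ
  refine ⟨|a| * C, fun d => ?_⟩
  rw [abs_mul, mul_assoc]
  exact mul_le_mul_of_nonneg_left (hC d) (abs_nonneg a)

lemma ExpBdd.shift {φ : ℕ → ℝ} (hφ : ExpBdd φ) : ExpBdd fun d => φ (d + 1) := by
  obtain ⟨C, hC⟩ := hφ
  refine ⟨C * (3 / 2), fun d => (hC (d + 1)).trans (le_of_eq ?_)⟩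
  rw [pow_succ]; ring

lemma ExpBdd.mono {φ ψ : ℕ → ℝ} (hψ : ExpBdd ψ) {C : ℝ} (hC : ∀ d, |φ d| ≤ C * |ψ d|) :
    ExpBdd φ := by
  obtain ⟨D, hD⟩ := hψ
  refine ⟨|C| * D, fun d => (hC d).trans ?_⟩
  calc C * |ψ d| ≤ |C| * |ψ d| := mul_le_mul_of_nonneg_right (le_abs_self C) (abs_nonneg _)
    _ ≤ |C| * (D * (3 / 2 : ℝ) ^ d) := mul_le_mul_of_nonneg_left (hD d) (abs_nonneg C)
    _ = _ := by ring

lemma expBdd_pow (k : ℕ) : ExpBdd fun d => ((1 : ℝ) + d) ^ k := by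
  have h1 : Tendsto (fun n : ℕ => (n : ℝ) ^ k * (2 / 3 : ℝ) ^ n) atTop (𝓝 0) :=
    tendsto_pow_const_mul_const_pow_of_lt_one k (by norm_num) (by norm_num)
  obtain ⟨B, hB⟩ := h1.bddAbove_range
  refine ⟨B * (3 / 2), fun d => ?_⟩
  have h2 := hB (Set.mem_range_self (d + 1))
  have h3 : (2 / 3 : ℝ) ^ (d + 1) * (3 / 2 : ℝ) ^ (d + 1) = 1 := by
    rw [← mul_pow]; norm_num
  rw [abs_of_nonneg (by positivity)]
  calc ((1 : ℝ) + d) ^ k = (((d + 1 : ℕ) : ℝ) ^ k * (2 / 3 : ℝ) ^ (d + 1)) *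
        (3 / 2 : ℝ) ^ (d + 1) := by rw [mul_assoc, h3]; push_cast; ring
    _ ≤ B * (3 / 2 : ℝ) ^ (d + 1) := by gcongr
    _ = _ := by rw [pow_succ]; ring

lemma ExpBdd.of_poly {φ : ℕ → ℝ} {C : ℝ} {k : ℕ} (hC : ∀ d : ℕ, |φ d| ≤ C * ((1 : ℝ) + d) ^ k) :
    ExpBdd φ :=
  (expBdd_pow k).mono (C := C) fun d => by
    rw [abs_of_nonneg (show (0 : ℝ) ≤ ((1 : ℝ) + d) ^ k by positivity)]; exact hC d

lemma expBdd_const (a : ℝ) : ExpBdd fun _ => a :=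
  ExpBdd.of_poly (C := |a|) (k := 0) fun d => by simp

lemma ev_zero (φ : ℕ → ℝ) (i : ℕ) : ev r i 0 φ = φ 0 := by
  rw [ev, tsum_eq_single 0]
  · simp [negBin_zero]
  · intro d hd; simp [negBin_zero, hd]

lemma ev_add (h : IsCoins M r) {φ ψ : ℕ → ℝ} (hφ : ExpBdd φ) (hψ : ExpBdd ψ) (i u : ℕ) :
    ev r i u (fun d => φ d + ψ d) = ev r i u φ + ev r i u ψ := by
  rw [ev, ev, ev, ← (hφ.summable h i u).tsum_add (hψ.summable h i u)]
  exact tsum_congr fun d => by ring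

lemma ev_const_mul (a : ℝ) (φ : ℕ → ℝ) (i u : ℕ) :
    ev r i u (fun d => a * φ d) = a * ev r i u φ := by
  rw [ev, ev, ← tsum_mul_left]
  exact tsum_congr fun d => by ring

lemma ev_mono (h : IsCoins M r) {φ ψ : ℕ → ℝ} (hφ : ExpBdd φ) (hψ : ExpBdd ψ) (i u : ℕ)
    (hle : ∀ d, φ d ≤ ψ d) : ev r i u φ ≤ ev r i u ψ :=
  (hφ.summable h i u).tsum_le_tsum
    (fun d => mul_le_mul_of_nonneg_left (hle d) (negBin_nonneg h _ _ _)) (hψ.summable h i u)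

lemma ev_succ (h : IsCoins M r) {φ : ℕ → ℝ} (hφ : ExpBdd φ) (i u : ℕ) :
    ev r i (u + 1) φ =
      r i * ev r (i + 1) u φ + (1 - r i) * ev r (i + 1) (u + 1) (fun d => φ (d + 1)) := by
  have s0 := hφ.summable h i (u + 1)
  have s1 := hφ.summable h (i + 1) u
  have s2 := hφ.shift.summable h (i + 1) (u + 1)
  have s1' := (summable_nat_add_iff 1).2 s1
  rw [ev, s0.tsum_eq_zero_add, ev, s1.tsum_eq_zero_add, ev, negBin_succ_zero, mul_add,
    ← tsum_mul_left, ← tsum_mul_left, add_assoc, ← (s1'.mul_left _).tsum_add (s2.mul_left _)]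
  congr 1
  · ring
  · refine tsum_congr fun d => ?_
    rw [negBin_succ_succ]; ring

lemma ev_fair (h : IsCoins M r) (φ : ℕ → ℝ) {i : ℕ} (hi : M ≤ i) (u : ℕ) :
    ev r (i + 1) u φ = ev r i u φ := by
  simp only [ev, negBin_fair h _ _ _ hi]

lemma ev_fair_succ (h : IsCoins M r) {φ : ℕ → ℝ} (hφ : ExpBdd φ) (u : ℕ) :
    ev r M (u + 1) φ = 1 / 2 * ev r M u φ + 1 / 2 * ev r M (u + 1) (fun d => φ (d + 1)) := by
  rw [ev_succ h hφ, ev_fair h _ le_rfl, ev_fair h _ le_rfl, h.fair M le_rfl]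
  norm_num

/-- Induction over the coins, starting from the fair ones. -/
lemma coin_induction {motive : ℕ → Prop} (fair : motive M)
    (step : ∀ i, i < M → motive (i + 1) → motive i) : motive 0 :=
  Nat.decreasingInduction (motive := fun i _ => motive i) (fun i hi h => step i hi h) fair
    (Nat.zero_le M)

lemma ev_const (h : IsCoins M r) (a : ℝ) (u : ℕ) : ev r 0 u (fun _ => a) = a := by
  refine coin_induction (M := M) (motive := fun i => ∀ u, ev r i u (fun _ => a) = a) ?_ ?_ u
  · intro u
    induction u with
    | zero => exact ev_zero _ _
    | succ u ih =>
      have := ev_fair_succ h (expBdd_const a) u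
      linarith
  · intro i _ hi u
    rcases u with _ | u
    · exact ev_zero _ _
    · rw [ev_succ h (expBdd_const a), hi, hi]; ring

lemma ev_le_ev_succ (h : IsCoins M r) {φ : ℕ → ℝ} (hφ : ExpBdd φ) (hm : Monotone φ) (u : ℕ) :
    ev r 0 u φ ≤ ev r 0 (u + 1) φ := by
  refine coin_induction (M := M) (motive := fun i => ∀ (φ : ℕ → ℝ), ExpBdd φ → Monotone φ →
    ∀ u, ev r i u φ ≤ ev r i (u + 1) φ) ?_ ?_ φ hφ hm u
  · intro φ hφ hm u
    have h1 := ev_fair_succ h hφ u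
    have h2 : ev r M (u + 1) φ ≤ ev r M (u + 1) fun d => φ (d + 1) :=
      ev_mono h hφ hφ.shift _ _ fun d => hm (Nat.le_succ d)
    linarith
  · intro i _ ih φ hφ hm u
    have hs : Monotone fun d => φ (d + 1) := fun a b hab => hm (by omega)
    have a1 := (h.pos i).le
    have a2 := (h.one_sub_pos i).le
    rcases u with _ | u
    · have h1 : ∀ v, φ 0 ≤ ev r (i + 1) v φ := fun v => by
        induction v with
        | zero => rw [ev_zero]
        | succ v ihv => exact ihv.trans (ih φ hφ hm v)
      have h2 : ev r (i + 1) 1 φ ≤ ev r (i + 1) 1 fun d => φ (d + 1) :=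
        ev_mono h hφ hφ.shift _ _ fun d => hm (Nat.le_succ d)
      rw [ev_zero, ev_succ h hφ, zero_add]
      nlinarith [h1 0, h1 1]
    · rw [ev_succ h hφ, ev_succ h hφ]
      exact add_le_add (mul_le_mul_of_nonneg_left (ih φ hφ hm u) a1)
        (mul_le_mul_of_nonneg_left (ih _ hφ.shift hs (u + 1)) a2)

/-- The `k`-th moment of the law `negBin r i u` centered at `u`. -/
def centralMoment (r : ℕ → ℝ) (i u k : ℕ) : ℝ := ev r i u fun d => ((d : ℝ) - u) ^ k

lemma expBdd_sub_pow (a : ℝ) (k : ℕ) : ExpBdd fun d => ((d : ℝ) - a) ^ k := by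
  refine ExpBdd.of_poly (C := (1 + |a|) ^ k) (k := k) fun d => ?_
  rw [abs_pow, ← mul_pow]
  refine pow_le_pow_left₀ (abs_nonneg _) ?_ k
  have h1 : |(d : ℝ) - a| ≤ |(d : ℝ)| + |a| := abs_sub _ _
  have h2 : |(d : ℝ)| = d := abs_of_nonneg (by positivity)
  nlinarith [abs_nonneg a, mul_nonneg (abs_nonneg a) (Nat.cast_nonneg (α := ℝ) d)]

lemma expBdd_sum {ι : Type*} (s : Finset ι) (φ : ι → ℕ → ℝ) (hφ : ∀ j ∈ s, ExpBdd (φ j)) :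
    ExpBdd fun d => ∑ j ∈ s, φ j d := by
  classical
  induction s using Finset.induction_on with
  | empty => simpa using expBdd_const 0
  | insert a s ha ih =>
    simp only [Finset.sum_insert ha]
    exact (hφ a (Finset.mem_insert_self a s)).add
      (ih fun j hj => hφ j (Finset.mem_insert_of_mem hj))

lemma ev_sum (h : IsCoins M r) {ι : Type*} (s : Finset ι) (φ : ι → ℕ → ℝ)
    (hφ : ∀ j ∈ s, ExpBdd (φ j)) (i u : ℕ) :
    ev r i u (fun d => ∑ j ∈ s, φ j d) = ∑ j ∈ s, ev r i u (φ j) := by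
  classical
  induction s using Finset.induction_on with
  | empty => simp [ev]
  | insert a s ha ih =>
    simp only [Finset.sum_insert ha]
    rw [ev_add h (hφ a (Finset.mem_insert_self a s))
      (expBdd_sum s φ fun j hj => hφ j (Finset.mem_insert_of_mem hj)),
      ih fun j hj => hφ j (Finset.mem_insert_of_mem hj)]

lemma ev_sub_add_pow (h : IsCoins M r) (i u k : ℕ) (a : ℝ) :
    ev r i u (fun d => ((d : ℝ) - u + a) ^ k) =
      ∑ j ∈ Finset.range (k + 1), a ^ (k - j) * (k.choose j) * centralMoment r i u j := by
  simp only [add_pow, centralMoment]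
  rw [ev_sum h]
  · refine Finset.sum_congr rfl fun j _ => ?_
    rw [← ev_const_mul]
    congr 1; ext d; ring
  · intro j _
    refine ((expBdd_sub_pow u j).const_mul (a ^ (k - j) * (k.choose j))).mono (C := 1) fun d => ?_
    rw [one_mul]; apply le_of_eq; congr 1; ring

lemma centralMoment_succ (h : IsCoins M r) (i u k : ℕ) :
    centralMoment r i (u + 1) k =
      r i * ∑ j ∈ Finset.range (k + 1),
          (-1) ^ (k - j) * (k.choose j) * centralMoment r (i + 1) u j +
        (1 - r i) * ∑ j ∈ Finset.range (k + 1),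
          1 ^ (k - j) * (k.choose j) * centralMoment r (i + 1) (u + 1) j := by
  rw [← ev_sub_add_pow h, ← ev_sub_add_pow h, centralMoment, ev_succ h (expBdd_sub_pow _ _)]
  congr 3 <;>
  · ext d; push_cast; ring

lemma centralMoment_fair (h : IsCoins M r) (u k : ℕ) :
    centralMoment r (M + 1) u k = centralMoment r M u k := ev_fair h _ le_rfl _

lemma centralMoment_fair_succ (h : IsCoins M r) (u k : ℕ) :
    centralMoment r M (u + 1) k =
      1 / 2 * ∑ j ∈ Finset.range (k + 1),
          (-1) ^ (k - j) * (k.choose j) * centralMoment r M u j +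
        1 / 2 * ∑ j ∈ Finset.range (k + 1), (k.choose j) * centralMoment r M (u + 1) j := by
  rw [centralMoment_succ h, h.fair M le_rfl]
  simp only [centralMoment_fair h, one_pow, one_mul]
  norm_num

lemma centralMoment_zero_left (r : ℕ → ℝ) (i k : ℕ) : centralMoment r i 0 k = 0 ^ k := by
  simp [centralMoment, ev_zero]

lemma centralMoment_fair_eq (h : IsCoins M r) (u : ℕ) :
    centralMoment r M u 0 = 1 ∧ centralMoment r M u 1 = 0 ∧ centralMoment r M u 2 = 2 * u ∧
    centralMoment r M u 3 = 6 * u ∧ centralMoment r M u 4 = 12 * u ^ 2 + 26 * u ∧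
    centralMoment r M u 5 = 120 * u ^ 2 + 150 * u ∧
    centralMoment r M u 6 = 120 * u ^ 3 + 1140 * u ^ 2 + 1082 * u := by
  induction u with
  | zero => simp [centralMoment_zero_left]
  | succ u ih =>
    obtain ⟨a0, a1, a2, a3, a4, a5, a6⟩ := ih
    have e0 := centralMoment_fair_succ h u 0
    have e1 := centralMoment_fair_succ h u 1
    have e2 := centralMoment_fair_succ h u 2
    have e3 := centralMoment_fair_succ h u 3
    have e4 := centralMoment_fair_succ h u 4
    have e5 := centralMoment_fair_succ h u 5
    have e6 := centralMoment_fair_succ h u 6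
    simp only [Finset.sum_range_succ, Finset.sum_range_zero, Nat.choose, a0, a1, a2, a3, a4, a5,
      a6] at e0 e1 e2 e3 e4 e5 e6
    norm_num at e0 e1 e2 e3 e4 e5 e6
    have b0 : centralMoment r M (u + 1) 0 = 1 := by linarith
    simp only [b0] at e1 e2 e3 e4 e5 e6
    have b1 : centralMoment r M (u + 1) 1 = 0 := by linarith
    simp only [b1] at e2 e3 e4 e5 e6
    have b2 : centralMoment r M (u + 1) 2 = 2 * (u + 1) := by linarith
    simp only [b2] at e3 e4 e5 e6
    have b3 : centralMoment r M (u + 1) 3 = 6 * (u + 1) := by linarith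
    simp only [b3] at e4 e5 e6
    have b4 : centralMoment r M (u + 1) 4 = 12 * (u + 1) ^ 2 + 26 * (u + 1) := by linarith
    simp only [b4] at e5 e6
    have b5 : centralMoment r M (u + 1) 5 = 120 * (u + 1) ^ 2 + 150 * (u + 1) := by linarith
    simp only [b5] at e6
    push_cast
    exact ⟨b0, b1, b2, b3, b4, b5, by linarith⟩

lemma ev_one (h : IsCoins M r) (i u : ℕ) : ev r i u (fun _ => 1) = 1 := by
  have base : ∀ u, ev r M u (fun _ => 1) = 1 := fun u => by
    simpa [centralMoment] using (centralMoment_fair_eq h u).1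
  rcases le_total M i with hi | hi
  · induction i, hi using Nat.le_induction with
    | base => exact base u
    | succ i hi ih => rw [ev_fair h _ hi, ih]
  · exact Nat.decreasingInduction (motive := fun i _ => ∀ u, ev r i u (fun _ => 1) = 1)
      (fun i _ ih u => by
        rcases u with _ | u
        · exact ev_zero _ _
        · rw [ev_succ h (expBdd_const 1), ih, ih]; ring) base hi u

lemma centralMoment_k_zero (h : IsCoins M r) (i u : ℕ) : centralMoment r i u 0 = 1 := by
  simpa [centralMoment] using ev_one h i u

lemma centralMoment_one_succ (h : IsCoins M r) (i u : ℕ) :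
    centralMoment r i (u + 1) 1 = r i * (centralMoment r (i + 1) u 1 - 1) +
      (1 - r i) * (centralMoment r (i + 1) (u + 1) 1 + 1) := by
  rw [centralMoment_succ h]
  simp [Finset.sum_range_succ, centralMoment_k_zero h]
  ring

lemma centralMoment_two_succ (h : IsCoins M r) (i u : ℕ) :
    centralMoment r i (u + 1) 2 =
      r i * (centralMoment r (i + 1) u 2 - 2 * centralMoment r (i + 1) u 1 + 1) +
      (1 - r i) * (centralMoment r (i + 1) (u + 1) 2 +
        2 * centralMoment r (i + 1) (u + 1) 1 + 1) := by
  rw [centralMoment_succ h]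
  simp [Finset.sum_range_succ, centralMoment_k_zero h]
  ring

lemma centralMoment_one_nonpos (h : IsCoins M r) (u : ℕ) : centralMoment r 0 u 1 ≤ 0 := by
  refine coin_induction (M := M) (motive := fun i => ∀ u, centralMoment r i u 1 ≤ 0) ?_ ?_ u
  · intro u; exact (centralMoment_fair_eq h u).2.1.le
  · intro i _ ih u
    rcases u with _ | u
    · simp [centralMoment_zero_left]
    · rw [centralMoment_one_succ h]
      nlinarith [ih u, ih (u + 1), h.half_le i, h.pos i, h.one_sub_pos i]

lemma centralMoment_one_two_eq (h : IsCoins M r) :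
    ∃ c : ℝ, ∀ u, M ≤ u → centralMoment r 0 u 1 = -2 ∧ centralMoment r 0 u 2 = 2 * u + c := by
  have := coin_induction (M := M) (motive := fun i => ∃ c : ℝ, ∀ u, M - i ≤ u →
    centralMoment r i u 1 = - ∑ j ∈ Finset.Ico i M, (2 * r j - 1) ∧
    centralMoment r i u 2 = 2 * u + c) ?_ ?_
  · obtain ⟨c, hc⟩ := this
    refine ⟨c, fun u hu => ?_⟩
    have := hc u (by simpa using hu)
    rwa [← Finset.range_eq_Ico, h.drift] at this
  · refine ⟨0, fun u _ => ?_⟩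
    have := centralMoment_fair_eq h u
    exact ⟨by simp [this.2.1], by simp [this.2.2.1]⟩
  · rintro i hi ⟨c, hc⟩
    set s := ∑ j ∈ Finset.Ico (i + 1) M, (2 * r j - 1) with hs
    refine ⟨r i * (2 * s + c - 1) + (1 - r i) * (1 + c - 2 * s), fun u hu => ?_⟩
    obtain ⟨u, rfl⟩ : ∃ v, u = v + 1 := ⟨u - 1, by omega⟩
    obtain ⟨p1, p2⟩ := hc u (by omega)
    obtain ⟨q1, q2⟩ := hc (u + 1) (by omega)
    constructor
    · rw [centralMoment_one_succ h, p1, q1, Finset.sum_eq_sum_Ico_succ_bot hi]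
      ring
    · rw [centralMoment_two_succ h, p1, p2, q1, q2]
      push_cast; ring

lemma centralMoment_even_le (h : IsCoins M r) (n : ℕ)
    (hfair : ∃ C : ℝ, ∀ u : ℕ, centralMoment r M u (2 * n) ≤ C * (1 + u) ^ n) :
    ∃ C : ℝ, ∀ u : ℕ, centralMoment r 0 u (2 * n) ≤ C * (1 + u) ^ n := by
  refine coin_induction (M := M) (motive := fun i => ∃ C : ℝ, ∀ u : ℕ,
    centralMoment r i u (2 * n) ≤ C * (1 + u) ^ n) hfair ?_
  rintro i - ⟨C, hC⟩
  have hC0 : 0 ≤ C := by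
    have h1 := hC 0
    have h2 : (0 : ℝ) ≤ centralMoment r (i + 1) 0 (2 * n) := by
      rw [centralMoment_zero_left]; positivity
    simp at h1
    linarith
  have pw : ∀ x y : ℝ, |y| = 1 → (x + y) ^ (2 * n) ≤ 2 ^ (2 * n - 1) * x ^ (2 * n) +
      2 ^ (2 * n - 1) := by
    intro x y hy
    have := Even.add_pow_le (a := x) (b := y) (n := 2 * n) (even_two_mul n)
    have hy' : y ^ (2 * n) = 1 := by rw [pow_mul, ← sq_abs, hy]; simp
    rw [hy', mul_add, mul_one] at this
    exact this
  set A : ℝ := 2 ^ (2 * n - 1) with hA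
  have hA0 : 0 ≤ A := by positivity
  have bd : ∀ v y, |y| = 1 → ev r (i + 1) v (fun d => ((d : ℝ) - v + y) ^ (2 * n)) ≤
      A * (C * (1 + v) ^ n) + A := by
    intro v y hy
    have e1 : ExpBdd fun d => ((d : ℝ) - v + y) ^ (2 * n) := by
      simpa [sub_add] using expBdd_sub_pow (v - y) (2 * n)
    have e2 := (expBdd_sub_pow v (2 * n)).const_mul A
    have h1 := ev_mono h e1 (e2.add (expBdd_const A)) (i + 1) v fun d => pw _ _ hy
    rw [ev_add h e2 (expBdd_const A), ev_const_mul] at h1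
    have h2 : ev r (i + 1) v (fun _ => A) = A := by
      have := ev_const_mul (r := r) A (fun _ => 1) (i + 1) v
      simpa [ev_one h] using this
    rw [h2] at h1
    have := mul_le_mul_of_nonneg_left (hC v) hA0
    rw [centralMoment] at this
    linarith
  refine ⟨A * C + A + 1 + A * C * 2 ^ n, fun u => ?_⟩
  have hu1 : (1 : ℝ) ≤ (1 + (u : ℝ)) ^ n := one_le_pow₀ (by simp)
  rcases u with _ | u
  · rw [centralMoment_zero_left]
    have : (0 : ℝ) ^ (2 * n) ≤ 1 := pow_le_one₀ le_rfl zero_le_one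
    have h3 : (0 : ℝ) ≤ A * C * 2 ^ n := by positivity
    have h4 : (0 : ℝ) ≤ A * C := by positivity
    simp only [Nat.cast_zero, add_zero, one_pow, mul_one]
    linarith
  · rw [centralMoment, ev_succ h (expBdd_sub_pow _ _)]
    have b1 := bd u (-1) (by simp)
    have b2 := bd (u + 1) 1 (by simp)
    have c1 : (fun d : ℕ => ((d : ℝ) - ((u + 1 : ℕ) : ℝ)) ^ (2 * n)) =
        fun d : ℕ => ((d : ℝ) - u + -1) ^ (2 * n) := by ext d; push_cast; ring
    have c2 : (fun d : ℕ => (((d + 1 : ℕ) : ℝ) - ((u + 1 : ℕ) : ℝ)) ^ (2 * n)) =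
        fun d : ℕ => ((d : ℝ) - ((u + 1 : ℕ) : ℝ) + 1) ^ (2 * n) := by ext d; push_cast; ring
    rw [c1, c2]
    have hmono : (1 + (u : ℝ)) ^ n ≤ (1 + ((u + 1 : ℕ) : ℝ)) ^ n := by
      gcongr; simp
    set w := (1 + ((u + 1 : ℕ) : ℝ)) ^ n
    have hAC : 0 ≤ A * C := mul_nonneg hA0 hC0
    have b1' : ev r (i + 1) u (fun d => ((d : ℝ) - u + -1) ^ (2 * n)) ≤ A * C * w + A := by
      nlinarith
    have b2' : ev r (i + 1) (u + 1) (fun d => ((d : ℝ) - ((u + 1 : ℕ) : ℝ) + 1) ^ (2 * n)) ≤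
        A * C * w + A := by linarith
    have := add_le_add (mul_le_mul_of_nonneg_left b1' (h.pos i).le)
      (mul_le_mul_of_nonneg_left b2' (h.one_sub_pos i).le)
    have h3 : (0 : ℝ) ≤ A * C * 2 ^ n := by positivity
    nlinarith

/-- The one-step operator of the Markov chain counting left steps at consecutive sites. -/
def stepOp (r : ℕ → ℝ) (φ : ℕ → ℝ) (z : ℕ) : ℝ := ev r 0 (z + 1) φ

lemma stepOp_mean_le (h : IsCoins M r) (u : ℕ) : ev r 0 u (fun d => (d : ℝ)) ≤ u := by
  have h1 := centralMoment_one_nonpos h u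
  have h2 := ev_add h (expBdd_sub_pow u 1) (expBdd_const u) 0 u
  rw [ev_const h] at h2
  simp only [pow_one, sub_add_cancel] at h2
  simp only [centralMoment, pow_one] at h1
  linarith

lemma stepOp_mean (h : IsCoins M r) (z : ℕ) (hz : M ≤ z) :
    stepOp r (fun d => (d : ℝ) - z) z = -1 := by
  obtain ⟨c, hc⟩ := centralMoment_one_two_eq h
  have h1 := (hc (z + 1) (by omega)).1
  have h2 := ev_sub_add_pow h 0 (z + 1) 1 1
  simp [Finset.sum_range_succ, centralMoment_k_zero h, h1] at h2
  have e : (fun d : ℕ => (d : ℝ) - z) = fun d : ℕ => (d : ℝ) - (z + 1) + 1 := by ext d; ring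
  rw [stepOp, e, h2]
  norm_num

lemma stepOp_sq (h : IsCoins M r) :
    ∃ κ : ℝ, ∀ z : ℕ, M ≤ z → stepOp r (fun d => ((d : ℝ) - z) ^ 2) z = 2 * z + κ := by
  obtain ⟨c, hc⟩ := centralMoment_one_two_eq h
  refine ⟨c - 1, fun z hz => ?_⟩
  obtain ⟨h1, h2⟩ := hc (z + 1) (by omega)
  have h3 := ev_sub_add_pow h 0 (z + 1) 2 1
  simp [Finset.sum_range_succ, centralMoment_k_zero h, h1, h2] at h3
  have e : (fun d : ℕ => ((d : ℝ) - z) ^ 2) = fun d : ℕ => ((d : ℝ) - (z + 1) + 1) ^ 2 := by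
    ext d; ring
  rw [stepOp, e, h3]
  ring

lemma stepOp_even_le (h : IsCoins M r) : ∃ C : ℝ, 0 ≤ C ∧ ∀ z : ℕ,
    stepOp r (fun d => ((d : ℝ) - z) ^ 2) z ≤ C * (1 + z) ∧
    stepOp r (fun d => ((d : ℝ) - z) ^ 4) z ≤ C * (1 + z) ^ 2 ∧
    stepOp r (fun d => ((d : ℝ) - z) ^ 6) z ≤ C * (1 + z) ^ 3 := by
  have conv : ∀ n : ℕ, (∃ C : ℝ, ∀ u : ℕ, centralMoment r M u (2 * n) ≤ C * (1 + u) ^ n) →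
      ∃ C : ℝ, 0 ≤ C ∧ ∀ z : ℕ,
        stepOp r (fun d => ((d : ℝ) - z) ^ (2 * n)) z ≤ C * (1 + z) ^ n := by
    intro n hn
    obtain ⟨C, hC⟩ := centralMoment_even_le h n hn
    refine ⟨2 ^ (2 * n - 1) * (|C| * 2 ^ n + 1), by positivity, fun z => ?_⟩
    have e1 := (expBdd_sub_pow (z + 1 : ℕ) (2 * n)).add (expBdd_const 1)
    have e2 := e1.const_mul (2 ^ (2 * n - 1))
    have h1 := ev_mono h (expBdd_sub_pow z (2 * n)) e2 0 (z + 1) fun d => by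
      have := Even.add_pow_le (a := (d : ℝ) - (z + 1 : ℕ)) (b := 1) (n := 2 * n) (even_two_mul n)
      rw [one_pow] at this
      have e : (d : ℝ) - z = (d : ℝ) - ((z + 1 : ℕ) : ℝ) + 1 := by push_cast; ring
      rw [e]
      exact this
    rw [ev_const_mul, ev_add h (expBdd_sub_pow _ _) (expBdd_const 1), ev_const h] at h1
    have h2 := hC (z + 1)
    rw [centralMoment] at h2
    have h3 : C * (1 + ((z + 1 : ℕ) : ℝ)) ^ n ≤ |C| * 2 ^ n * (1 + z) ^ n := by
      rw [mul_assoc, ← mul_pow]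
      refine mul_le_mul (le_abs_self C) ?_ (by positivity) (abs_nonneg C)
      gcongr; push_cast; nlinarith [Nat.cast_nonneg (α := ℝ) z]
    have h4 : (1 : ℝ) ≤ (1 + (z : ℝ)) ^ n := one_le_pow₀ (by simp)
    rw [stepOp]
    calc _ ≤ _ := h1
      _ ≤ 2 ^ (2 * n - 1) * (|C| * 2 ^ n * (1 + z) ^ n + (1 + z) ^ n) := by
        gcongr; linarith
      _ = _ := by ring
  have mom := centralMoment_fair_eq h
  obtain ⟨C1, p1, h1⟩ := conv 1 ⟨2, fun u => by
    have := (mom u).2.2.1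
    simp only [mul_one, this]; linarith⟩
  obtain ⟨C2, p2, h2⟩ := conv 2 ⟨26, fun u => by
    have := (mom u).2.2.2.2.1
    have hu := Nat.cast_nonneg (α := ℝ) u
    norm_num [this]; nlinarith⟩
  obtain ⟨C3, p3, h3⟩ := conv 3 ⟨1140, fun u => by
    have := (mom u).2.2.2.2.2.2
    have hu := Nat.cast_nonneg (α := ℝ) u
    norm_num [this]; nlinarith [pow_nonneg hu 2, pow_nonneg hu 3]⟩
  norm_num at h1 h2 h3
  refine ⟨C1 + C2 + C3, by positivity, fun z => ⟨(h1 z).trans ?_, (h2 z).trans ?_,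
    (h3 z).trans ?_⟩⟩ <;> gcongr <;> linarith

lemma sq_mul_log_bound_aux {u : ℝ} (hu : 0 ≤ u) :
    |u ^ 2 * Real.log u - (u - 1) - 3 / 2 * (u - 1) ^ 2| ≤ 1 / 2 * |u - 1| ^ 3 := by
  have upper : ∀ v : ℝ, 1 ≤ v → Real.log v * v * 2 ≤ v ^ 2 - 1 := by
    intro v hv
    have hv0 : 0 < v := by linarith
    have h1 := Real.self_le_sinh_iff.2 (Real.log_nonneg hv)
    rw [Real.sinh_log hv0] at h1
    have h2 := mul_le_mul_of_nonneg_right h1 hv0.le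
    have h3 : (v - v⁻¹) / 2 * v = (v ^ 2 - 1) / 2 := by field_simp
    linarith
  have lower : ∀ v : ℝ, 1 ≤ v → 2 * (v - 1) ≤ Real.log v * (v + 1) := by
    intro v hv
    have h1 := Real.le_log_one_add_of_nonneg (x := v - 1) (by linarith)
    rw [div_le_iff₀ (by linarith)] at h1
    have h2 : 1 + (v - 1) = v := by ring
    rw [h2] at h1
    linarith
  rcases hu.eq_or_lt with rfl | hu0
  · norm_num
  rcases le_total 1 u with h | h
  · rw [abs_of_nonneg (show 0 ≤ u - 1 by linarith), abs_le]
    have h1 := upper u h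
    have h2 := lower u h
    constructor
    · have : u ^ 2 * (2 * (u - 1)) ≤ u ^ 2 * Real.log u * (u + 1) := by
        nlinarith [mul_le_mul_of_nonneg_left h2 (sq_nonneg u)]
      have h3 : 0 ≤ (u ^ 2 * Real.log u - (u - 1) - 3 / 2 * (u - 1) ^ 2) * (u + 1) := by
        nlinarith [pow_nonneg (show 0 ≤ u - 1 by linarith) 3]
      have h4 := nonneg_of_mul_nonneg_left h3 (by linarith)
      have := pow_nonneg (show 0 ≤ u - 1 by linarith) 3
      linarith
    · nlinarith [mul_le_mul_of_nonneg_left h1 hu]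
  · have hinv : 1 ≤ u⁻¹ := (one_le_inv₀ hu0).2 h
    have h1 := upper _ hinv
    have h2 := lower _ hinv
    rw [Real.log_inv] at h1 h2
    have k1 : -(u ^ 2 * Real.log u) * 2 ≤ u * (1 - u ^ 2) := by
      have := mul_le_mul_of_nonneg_left h1 (pow_nonneg hu 3)
      have e1 : u ^ 3 * (-Real.log u * u⁻¹ * 2) = -(u ^ 2 * Real.log u) * 2 := by
        field_simp
      have e2 : u ^ 3 * (u⁻¹ ^ 2 - 1) = u * (1 - u ^ 2) := by
        field_simp
      rwa [e1, e2] at this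
    have k2 : 2 * (u ^ 2 * (1 - u)) ≤ -(u ^ 2 * Real.log u) * (1 + u) := by
      have := mul_le_mul_of_nonneg_left h2 (pow_nonneg hu 3)
      have e1 : u ^ 3 * (2 * (u⁻¹ - 1)) = 2 * (u ^ 2 * (1 - u)) := by
        field_simp
      have e2 : u ^ 3 * (-Real.log u * (u⁻¹ + 1)) = -(u ^ 2 * Real.log u) * (1 + u) := by
        field_simp
      rwa [e1, e2] at this
    have hc : 0 ≤ (1 - u) ^ 3 := pow_nonneg (by linarith) 3
    rw [abs_of_nonpos (show u - 1 ≤ 0 by linarith), abs_le]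
    constructor
    · nlinarith
    · have h3 : (u ^ 2 * Real.log u - (u - 1) - 3 / 2 * (u - 1) ^ 2) * (1 + u) ≤ 0 := by
        nlinarith
      have h4 := nonpos_of_mul_nonpos_left h3 (by linarith)
      have : -(u - 1) = 1 - u := by ring
      rw [this]
      linarith

/-- Second order Taylor expansion of `y ↦ y² log y`. -/
lemma sq_mul_log_taylor {y z : ℝ} (hy : 0 ≤ y) (hz : 0 < z) :
    |y ^ 2 * Real.log y - z ^ 2 * Real.log z - (2 * z * Real.log z + z) * (y - z) -
      (Real.log z + 3 / 2) * (y - z) ^ 2| ≤ 1 / 2 * (|y - z| ^ 3 / z) := by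
  have h := sq_mul_log_bound_aux (u := y / z) (by positivity)
  have h2 := mul_le_mul_of_nonneg_left h (sq_nonneg z)
  rw [← abs_of_nonneg (sq_nonneg z), ← abs_mul, abs_of_nonneg (sq_nonneg z)] at h2
  have e1 : |y / z - 1| = |y - z| / z := by
    rw [← abs_of_pos hz, ← abs_div, abs_of_pos hz]; congr 1; field_simp
  have e2 : y ^ 2 * Real.log (y / z) = y ^ 2 * (Real.log y - Real.log z) := by
    rcases hy.eq_or_lt with rfl | hy0
    · simp
    · rw [Real.log_div hy0.ne' hz.ne']
  have e3 : z ^ 2 * ((y / z) ^ 2 * Real.log (y / z) - (y / z - 1) - 3 / 2 * (y / z - 1) ^ 2) =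
      y ^ 2 * Real.log (y / z) - z * (y - z) - 3 / 2 * (y - z) ^ 2 := by
    field_simp
  rw [e3, e2, e1] at h2
  have e4 : z ^ 2 * (1 / 2 * (|y - z| / z) ^ 3) = 1 / 2 * (|y - z| ^ 3 / z) := by
    field_simp
  have e5 : y ^ 2 * Real.log y - z ^ 2 * Real.log z - (2 * z * Real.log z + z) * (y - z) -
      (Real.log z + 3 / 2) * (y - z) ^ 2 =
      y ^ 2 * (Real.log y - Real.log z) - z * (y - z) - 3 / 2 * (y - z) ^ 2 := by ring
  rwa [e4, ← e5] at h2

lemma cube_div_le {x z η : ℝ} (hz : 0 < z) (hη : 0 < η) :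
    |x| ^ 3 / z ≤ 1 / 2 * (η * x ^ 2 + x ^ 4 / (η * z ^ 2)) := by
  have h0 : 0 ≤ (|x| * η * z - x ^ 2) ^ 2 := sq_nonneg _
  have e : 1 / 2 * (η * x ^ 2 + x ^ 4 / (η * z ^ 2)) - |x| ^ 3 / z =
      (|x| * η * z - x ^ 2) ^ 2 / (2 * η * z ^ 2) := by
    have e1 : |x| ^ 3 = |x| * x ^ 2 := by rw [pow_succ', sq_abs]
    have e2 : (|x| * η * z - x ^ 2) ^ 2 = x ^ 2 * η ^ 2 * z ^ 2 - 2 * (|x| * x ^ 2) * η * z +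
        x ^ 4 := by
      have : |x| ^ 2 = x ^ 2 := sq_abs x
      linear_combination (η ^ 2 * z ^ 2) * this
    rw [e1, e2]; field_simp; ring
  have : 0 ≤ (|x| * η * z - x ^ 2) ^ 2 / (2 * η * z ^ 2) := by positivity
  linarith

lemma stepOp_quad (h : IsCoins M r) {κ : ℝ}
    (hκ : ∀ z : ℕ, M ≤ z → stepOp r (fun d => ((d : ℝ) - z) ^ 2) z = 2 * z + κ)
    (a b c : ℝ) {z : ℕ} (hz : M ≤ z) :
    stepOp r (fun d => a + b * ((d : ℝ) - z) + c * ((d : ℝ) - z) ^ 2) z =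
      a - b + c * (2 * z + κ) := by
  have h1 := stepOp_mean h z hz
  have h2 := hκ z hz
  have e1 : ExpBdd fun d => (d : ℝ) - z := by simpa using expBdd_sub_pow (z : ℝ) 1
  rw [stepOp] at h1 h2 ⊢
  rw [ev_add h ((expBdd_const a).add (e1.const_mul b)) ((expBdd_sub_pow z 2).const_mul c),
    ev_add h (expBdd_const a) (e1.const_mul b), ev_const_mul, ev_const_mul, ev_const h, h1, h2]
  ring

lemma stepOp_mono (h : IsCoins M r) {φ ψ : ℕ → ℝ} (hφ : ExpBdd φ) (hψ : ExpBdd ψ)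
    (hle : ∀ d, φ d ≤ ψ d) (z : ℕ) : stepOp r φ z ≤ stepOp r ψ z :=
  ev_mono h hφ hψ _ _ hle

lemma stepOp_add (h : IsCoins M r) {φ ψ : ℕ → ℝ} (hφ : ExpBdd φ) (hψ : ExpBdd ψ) (z : ℕ) :
    stepOp r (fun d => φ d + ψ d) z = stepOp r φ z + stepOp r ψ z :=
  ev_add h hφ hψ _ _

lemma stepOp_const_mul (a : ℝ) (φ : ℕ → ℝ) (z : ℕ) :
    stepOp r (fun d => a * φ d) z = a * stepOp r φ z := ev_const_mul _ _ _ _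

lemma stepOp_const (h : IsCoins M r) (a : ℝ) (z : ℕ) : stepOp r (fun _ => a) z = a :=
  ev_const h a _

lemma ExpBdd.sub {φ ψ : ℕ → ℝ} (hφ : ExpBdd φ) (hψ : ExpBdd ψ) :
    ExpBdd fun d => φ d - ψ d := by
  simpa [sub_eq_add_neg] using hφ.add (hψ.const_mul (-1))

lemma stepOp_sub (h : IsCoins M r) {φ ψ : ℕ → ℝ} (hφ : ExpBdd φ) (hψ : ExpBdd ψ) (z : ℕ) :
    stepOp r (fun d => φ d - ψ d) z = stepOp r φ z - stepOp r ψ z := by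
  have h1 := stepOp_add h hφ (hψ.const_mul (-1)) z
  rw [stepOp_const_mul] at h1
  simpa [sub_eq_add_neg] using h1

lemma ExpBdd.abs {φ : ℕ → ℝ} (hφ : ExpBdd φ) : ExpBdd fun d => |φ d| :=
  hφ.mono (C := 1) fun d => by simp

lemma abs_stepOp_le (h : IsCoins M r) {φ : ℕ → ℝ} (hφ : ExpBdd φ) (z : ℕ) :
    |stepOp r φ z| ≤ stepOp r (fun d => |φ d|) z := by
  rw [abs_le]
  constructor
  · have := stepOp_mono h (hφ.abs.const_mul (-1)) hφ
      (fun d => by have := neg_abs_le (φ d); linarith) z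
    rw [stepOp_const_mul] at this; linarith
  · exact stepOp_mono h hφ hφ.abs (fun d => le_abs_self _) z

/-- The function `z² log z`. -/
def sqLog (z : ℕ) : ℝ := (z : ℝ) ^ 2 * Real.log z

lemma log_natCast_le (z : ℕ) : Real.log z ≤ z :=
  (Real.log_le_self (Nat.cast_nonneg z))

lemma sqLog_nonneg (z : ℕ) : 0 ≤ sqLog z :=
  mul_nonneg (sq_nonneg _) (Real.log_natCast_nonneg z)

lemma abs_sqLog_le (z : ℕ) : |sqLog z| ≤ 1 * ((1 : ℝ) + z) ^ 3 := by
  rw [abs_of_nonneg (sqLog_nonneg z), sqLog]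
  have h0 : (0 : ℝ) ≤ z := Nat.cast_nonneg z
  have := mul_le_mul_of_nonneg_left (log_natCast_le z) (sq_nonneg (z : ℝ))
  nlinarith

lemma expBdd_sqLog : ExpBdd sqLog := ExpBdd.of_poly abs_sqLog_le

lemma stepOp_sqLog (h : IsCoins M r) {η : ℝ} (hη : 0 < η) :
    ∃ C : ℝ, 0 ≤ C ∧ ∀ z : ℕ, |stepOp r sqLog z - sqLog z - 2 * z| ≤ η * z + C := by
  obtain ⟨κ, hκ⟩ := stepOp_sq h
  obtain ⟨C, hC0, hC⟩ := stepOp_even_le h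
  set θ := η / (|κ| + C + 1) with hθ
  have hden : 0 < |κ| + C + 1 := by positivity
  have hθ0 : 0 < θ := by positivity
  have hθη : θ * (|κ| + C + 1) = η := by rw [hθ]; field_simp
  set D := |κ| * (|Real.log θ| + 3 / 2) + 4 * C / θ with hD
  have hD0 : 0 ≤ D := by positivity
  have main : ∀ z : ℕ, M ≤ z → 1 ≤ z → |stepOp r sqLog z - sqLog z - 2 * z| ≤ η * z + D := by
    intro z hz hz1
    have hzr : (1 : ℝ) ≤ z := by exact_mod_cast hz1
    have hz0 : (0 : ℝ) < z := by linarith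
    set L := Real.log z with hL
    have hquad := stepOp_quad h hκ (sqLog z) (2 * z * L + z) (L + 3 / 2) hz
    set Q : ℕ → ℝ := fun d => sqLog z + (2 * z * L + z) * ((d : ℝ) - z) +
      (L + 3 / 2) * ((d : ℝ) - z) ^ 2 with hQ
    have eQ : ExpBdd Q := by
      have e1 : ExpBdd fun d => (d : ℝ) - z := by simpa using expBdd_sub_pow (z : ℝ) 1
      exact ((expBdd_const _).add (e1.const_mul _)).add ((expBdd_sub_pow z 2).const_mul _)
    have e2 : ExpBdd fun d => (θ / 4) * ((d : ℝ) - z) ^ 2 +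
        (1 / (4 * θ * z ^ 2)) * ((d : ℝ) - z) ^ 4 :=
      ((expBdd_sub_pow z 2).const_mul _).add ((expBdd_sub_pow z 4).const_mul _)
    have hdiff := abs_stepOp_le h (expBdd_sqLog.sub eQ) z
    rw [stepOp_sub h expBdd_sqLog eQ, hquad] at hdiff
    have hle := stepOp_mono h (expBdd_sqLog.sub eQ).abs e2 (fun d => by
      have t1 := sq_mul_log_taylor (y := d) (z := z) (Nat.cast_nonneg d) hz0
      have t2 := cube_div_le (x := (d : ℝ) - z) hz0 hθ0
      have t3 : sqLog d - Q d = (d : ℝ) ^ 2 * Real.log d - z ^ 2 * Real.log z -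
          (2 * z * Real.log z + z) * (d - z) - (Real.log z + 3 / 2) * (d - z) ^ 2 := by
        simp only [hQ, sqLog, hL]; ring
      rw [t3]
      have t4 : 1 / (4 * θ * (z : ℝ) ^ 2) * ((d : ℝ) - z) ^ 4 =
          1 / 4 * (((d : ℝ) - z) ^ 4 / (θ * z ^ 2)) := by field_simp
      rw [t4]
      linarith) z
    rw [stepOp_add h ((expBdd_sub_pow z 2).const_mul _) ((expBdd_sub_pow z 4).const_mul _),
      stepOp_const_mul, stepOp_const_mul] at hle
    obtain ⟨m2, m4, -⟩ := hC z
    have b2 : θ / 4 * stepOp r (fun d => ((d : ℝ) - z) ^ 2) z ≤ θ * C * z := by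
      have := mul_le_mul_of_nonneg_left m2 (show 0 ≤ θ / 4 by positivity)
      have : θ / 4 * (C * (1 + z)) ≤ θ * C * z := by
        have : 0 ≤ θ * C * (z - 1) := mul_nonneg (by positivity) (by linarith)
        nlinarith [mul_nonneg (mul_nonneg hθ0.le hC0) hz0.le]
      linarith
    have b4 : 1 / (4 * θ * (z : ℝ) ^ 2) * stepOp r (fun d => ((d : ℝ) - z) ^ 4) z ≤
        4 * C / θ := by
      have h1 := mul_le_mul_of_nonneg_left m4 (show 0 ≤ 1 / (4 * θ * (z : ℝ) ^ 2) by positivity)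
      have h2 : C * (1 + (z : ℝ)) ^ 2 ≤ C * (4 * z ^ 2) :=
        mul_le_mul_of_nonneg_left (by nlinarith) hC0
      have h3 := mul_le_mul_of_nonneg_left h2 (show 0 ≤ 1 / (4 * θ * (z : ℝ) ^ 2) by positivity)
      have h4 : 1 / (4 * θ * (z : ℝ) ^ 2) * (C * (4 * z ^ 2)) = C / θ := by field_simp
      have h5 : C / θ ≤ 4 * C / θ := by gcongr; linarith
      linarith
    have hL0 : 0 ≤ L := Real.log_nonneg hzr
    have hLθ : L ≤ θ * z + |Real.log θ| := by
      have h1 : Real.log (θ * z) ≤ θ * z := Real.log_le_self (by positivity)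
      rw [Real.log_mul hθ0.ne' hz0.ne'] at h1
      have := neg_abs_le (Real.log θ)
      linarith
    have hdecomp : stepOp r sqLog z - sqLog z - 2 * z =
        (stepOp r sqLog z - (sqLog z - (2 * z * L + z) + (L + 3 / 2) * (2 * z + κ))) +
          κ * (L + 3 / 2) := by ring
    rw [hdecomp]
    refine (abs_add_le _ _).trans ?_
    rw [abs_mul, abs_of_nonneg (show 0 ≤ L + 3 / 2 by linarith)]
    have h6 : |κ| * (L + 3 / 2) ≤ |κ| * (θ * z + |Real.log θ| + 3 / 2) :=
      mul_le_mul_of_nonneg_left (by linarith) (abs_nonneg κ)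
    have h7 : (|κ| * θ + θ * C) * z ≤ η * z := by
      refine mul_le_mul_of_nonneg_right ?_ hz0.le
      rw [← hθη]; nlinarith
    have h8 := hdiff.trans hle
    rw [hD]
    nlinarith
  refine ⟨D + ∑ z ∈ Finset.range (M + 1), |stepOp r sqLog z - sqLog z - 2 * z|,
    add_nonneg hD0 (Finset.sum_nonneg fun _ _ => abs_nonneg _), fun z => ?_⟩
  have hzn : 0 ≤ η * z := by positivity
  have hsum : 0 ≤ ∑ z ∈ Finset.range (M + 1), |stepOp r sqLog z - sqLog z - 2 * z| :=
    Finset.sum_nonneg fun _ _ => abs_nonneg _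
  by_cases hz : M ≤ z ∧ 1 ≤ z
  · linarith [main z hz.1 hz.2]
  · have hmem : z ∈ Finset.range (M + 1) := by rw [Finset.mem_range]; omega
    have := Finset.single_le_sum
      (f := fun z : ℕ => |stepOp r sqLog z - sqLog z - 2 * z|) (fun _ _ => abs_nonneg _) hmem
    linarith

/-- The harmonic function (away from finitely many points) `z² + κ z` of the chain. -/
def quad (κ : ℝ) (z : ℕ) : ℝ := (z : ℝ) ^ 2 + κ * z

lemma abs_quad_le (κ : ℝ) (z : ℕ) : |quad κ z| ≤ (1 + |κ|) * ((1 : ℝ) + z) ^ 2 := by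
  have hz : (0 : ℝ) ≤ z := Nat.cast_nonneg z
  rw [quad]
  refine (abs_add_le _ _).trans ?_
  rw [abs_of_nonneg (sq_nonneg _), abs_mul, abs_of_nonneg hz]
  nlinarith [abs_nonneg κ, mul_nonneg (abs_nonneg κ) hz, mul_nonneg (abs_nonneg κ) (mul_nonneg hz hz)]

lemma expBdd_quad (κ : ℝ) : ExpBdd (quad κ) := ExpBdd.of_poly (abs_quad_le κ)

lemma stepOp_quad_eq (h : IsCoins M r) {κ : ℝ}
    (hκ : ∀ z : ℕ, M ≤ z → stepOp r (fun d => ((d : ℝ) - z) ^ 2) z = 2 * z + κ)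
    {z : ℕ} (hz : M ≤ z) : stepOp r (quad κ) z = quad κ z := by
  have := stepOp_quad h hκ (quad κ z) (2 * z + κ) 1 hz
  have e : (fun d : ℕ => quad κ z + (2 * z + κ) * ((d : ℝ) - z) + 1 * ((d : ℝ) - z) ^ 2) =
      quad κ := by
    ext d; simp only [quad]; ring
  rw [e] at this
  rw [this]; ring

/-- The function whose generator is, up to lower order terms, `-z`, below level `m`. -/
def pot (κ m : ℝ) (z : ℕ) : ℝ := (Real.log m * quad κ z - sqLog z) / 2

lemma expBdd_pot (κ m : ℝ) : ExpBdd (pot κ m) := by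
  have := (((expBdd_quad κ).const_mul (Real.log m)).sub expBdd_sqLog).const_mul (1 / 2)
  convert this using 2
  simp only [pot]; ring

lemma abs_pot_le_cube (κ m : ℝ) (z : ℕ) :
    |pot κ m z| ≤ (|Real.log m| * (1 + |κ|) + 1) * ((1 : ℝ) + z) ^ 3 := by
  have h1 := abs_quad_le κ z
  have h2 := abs_sqLog_le z
  have hz : (0 : ℝ) ≤ z := Nat.cast_nonneg z
  have h3 : |pot κ m z| ≤ (|Real.log m| * |quad κ z| + |sqLog z|) := by
    rw [pot, abs_div, abs_two, ← abs_mul]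
    have := abs_sub (Real.log m * quad κ z) (sqLog z)
    have := abs_nonneg (Real.log m * quad κ z - sqLog z)
    linarith
  have h4 : (1 + |κ|) * ((1 : ℝ) + z) ^ 2 ≤ (1 + |κ|) * ((1 : ℝ) + z) ^ 3 := by
    gcongr
    · linarith
    · norm_num
  have := mul_le_mul_of_nonneg_left (h1.trans h4) (abs_nonneg (Real.log m))
  linarith

lemma stepOp_pot (h : IsCoins M r) (κ m : ℝ) (z : ℕ) :
    stepOp r (pot κ m) z - pot κ m z =
      (Real.log m * (stepOp r (quad κ) z - quad κ z) - (stepOp r sqLog z - sqLog z)) / 2 := by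
  have h1 := stepOp_sub h ((expBdd_quad κ).const_mul (Real.log m)) expBdd_sqLog z
  have h2 := stepOp_const_mul (r := r) (1 / 2) (fun d => Real.log m * quad κ d - sqLog d) z
  have e : (fun d : ℕ => 1 / 2 * (Real.log m * quad κ d - sqLog d)) = pot κ m := by
    ext d; simp only [pot]; ring
  rw [stepOp_const_mul] at h1
  rw [e, h1] at h2
  rw [h2]; simp only [pot]; ring

lemma abs_pot_le {κ m : ℝ} (hm : 1 ≤ m) {z : ℕ} (hz : (z : ℝ) ≤ m) :
    |pot κ m z| ≤ (1 + |κ|) * m ^ 2 := by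
  have hz0 : (0 : ℝ) ≤ z := Nat.cast_nonneg z
  rcases Nat.eq_zero_or_pos z with rfl | hzp
  · simp [pot, quad, sqLog]; positivity
  have hzr : (0 : ℝ) < z := by exact_mod_cast hzp
  have hlog : Real.log m - Real.log z ≤ m / z := by
    rw [← Real.log_div (by linarith) hzr.ne']
    exact Real.log_le_self (by positivity)
  have hlog0 : 0 ≤ Real.log m - Real.log z := by
    have := Real.log_le_log hzr hz; linarith
  have hlm : Real.log m ≤ m := Real.log_le_self (by linarith)
  have hlm0 : 0 ≤ Real.log m := Real.log_nonneg hm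
  have e : pot κ m z = ((z : ℝ) ^ 2 * (Real.log m - Real.log z) + κ * (z * Real.log m)) / 2 := by
    simp only [pot, quad, sqLog]; ring
  have h1 : (z : ℝ) ^ 2 * (Real.log m - Real.log z) ≤ m ^ 2 := by
    have := mul_le_mul_of_nonneg_left hlog (sq_nonneg (z : ℝ))
    have e2 : (z : ℝ) ^ 2 * (m / z) = z * m := by field_simp
    nlinarith
  have h1' : 0 ≤ (z : ℝ) ^ 2 * (Real.log m - Real.log z) := by positivity
  have h2 : (z : ℝ) * Real.log m ≤ m ^ 2 := by nlinarith
  have h2' : 0 ≤ (z : ℝ) * Real.log m := by positivity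
  rw [e, abs_div, abs_two]
  have h3 := abs_add_le ((z : ℝ) ^ 2 * (Real.log m - Real.log z)) (κ * (z * Real.log m))
  rw [abs_of_nonneg h1', abs_mul, abs_of_nonneg h2'] at h3
  have := mul_le_mul_of_nonneg_left h2 (abs_nonneg κ)
  have : 0 ≤ |κ| * m ^ 2 := by positivity
  nlinarith

lemma abs_pot_sub_le {κ m : ℝ} (hm : 1 ≤ m) {z : ℕ} (hz : (z : ℝ) ≤ m) (y : ℕ) :
    |2 * (pot κ m y - pot κ m z)| ≤ (3 + |κ|) * m * |(y : ℝ) - z| +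
      3 * (m / max (z : ℝ) 1) * ((y : ℝ) - z) ^ 2 + |(y : ℝ) - z| ^ 3 / max (z : ℝ) 1 := by
  have hy0 : (0 : ℝ) ≤ y := Nat.cast_nonneg y
  have hlm : Real.log m ≤ m := Real.log_le_self (by linarith)
  have hlm0 : 0 ≤ Real.log m := Real.log_nonneg hm
  rcases Nat.eq_zero_or_pos z with rfl | hzp
  · have e : 2 * (pot κ m y - pot κ m (0 : ℕ)) =
        Real.log m * (y : ℝ) ^ 2 + κ * (Real.log m * y) - sqLog y := by
      simp only [pot, quad, sqLog]; push_cast; ring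
    have h1 := abs_sub (Real.log m * (y : ℝ) ^ 2 + κ * (Real.log m * y)) (sqLog y)
    have h2 := abs_add_le (Real.log m * (y : ℝ) ^ 2) (κ * (Real.log m * y))
    rw [abs_of_nonneg (show 0 ≤ Real.log m * (y : ℝ) ^ 2 by positivity), abs_mul κ,
      abs_of_nonneg (show 0 ≤ Real.log m * (y : ℝ) by positivity)] at h2
    rw [abs_of_nonneg (sqLog_nonneg y)] at h1
    have h3 : sqLog y ≤ (y : ℝ) ^ 3 := by
      rw [sqLog, pow_succ _ 2]; exact mul_le_mul_of_nonneg_left (log_natCast_le y) (sq_nonneg _)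
    have h4 : Real.log m * (y : ℝ) ≤ m * y := mul_le_mul_of_nonneg_right hlm hy0
    have h5 := mul_le_mul_of_nonneg_left h4 (abs_nonneg κ)
    have h6 : Real.log m * (y : ℝ) ^ 2 ≤ m * (y : ℝ) ^ 2 :=
      mul_le_mul_of_nonneg_right hlm (sq_nonneg _)
    have h7 : 0 ≤ m * (y : ℝ) ^ 2 := by positivity
    have h8 : 0 ≤ m * (y : ℝ) := by positivity
    rw [e]
    simp only [Nat.cast_zero, sub_zero, abs_of_nonneg hy0, max_eq_right (zero_le_one' ℝ), div_one]
    nlinarith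
  · have hz1 : (1 : ℝ) ≤ z := by exact_mod_cast hzp
    have hzr : (0 : ℝ) < z := by linarith
    rw [max_eq_left hz1]
    set D := (y : ℝ) - z with hD
    have ht := sq_mul_log_taylor hy0 hzr
    set R := (y : ℝ) ^ 2 * Real.log y - z ^ 2 * Real.log z - (2 * z * Real.log z + z) * (y - z) -
      (Real.log z + 3 / 2) * (y - z) ^ 2 with hR
    have hlog : Real.log m - Real.log z ≤ m / z := by
      rw [← Real.log_div (by linarith) hzr.ne']
      exact Real.log_le_self (by positivity)
    have hlog0 : 0 ≤ Real.log m - Real.log z := by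
      have := Real.log_le_log hzr hz; linarith
    have hmz : 1 ≤ m / z := by rwa [le_div_iff₀ hzr, one_mul]
    have hzl : (z : ℝ) * (Real.log m - Real.log z) ≤ m := by
      have := mul_le_mul_of_nonneg_left hlog hzr.le
      rwa [mul_div_cancel₀ _ hzr.ne'] at this
    have hzl0 : 0 ≤ (z : ℝ) * (Real.log m - Real.log z) := by positivity
    have e : 2 * (pot κ m y - pot κ m z) =
        (2 * (z * (Real.log m - Real.log z)) + κ * Real.log m - z) * D +
          ((Real.log m - Real.log z) - 3 / 2) * D ^ 2 - R := by
      simp only [pot, quad, sqLog, hR, hD]; ring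
    have b1 : |2 * (z * (Real.log m - Real.log z)) + κ * Real.log m - z| ≤ (3 + |κ|) * m := by
      have := mul_le_mul_of_nonneg_left hlm (abs_nonneg κ)
      have h5 : |κ * Real.log m| ≤ |κ| * m := by rwa [abs_mul, abs_of_nonneg hlm0]
      rw [abs_le] at h5 ⊢
      constructor <;> nlinarith [h5.1, h5.2]
    have b2 : |(Real.log m - Real.log z) - 3 / 2| ≤ 3 * (m / z) := by
      rw [abs_le]; constructor <;> linarith
    rw [e]
    have h1 := abs_sub ((2 * (z * (Real.log m - Real.log z)) + κ * Real.log m - z) * D +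
          ((Real.log m - Real.log z) - 3 / 2) * D ^ 2) R
    have h2 := abs_add_le ((2 * (z * (Real.log m - Real.log z)) + κ * Real.log m - z) * D)
      (((Real.log m - Real.log z) - 3 / 2) * D ^ 2)
    rw [abs_mul, abs_mul, abs_of_nonneg (sq_nonneg D)] at h2
    have h3 := mul_le_mul_of_nonneg_right b1 (abs_nonneg D)
    have h4 := mul_le_mul_of_nonneg_right b2 (sq_nonneg D)
    have h5 : 0 ≤ |D| ^ 3 / z := by positivity
    linarith

lemma stepOp_pot_sub_sq (h : IsCoins M r) (κ : ℝ) : ∃ C : ℝ, 0 ≤ C ∧ ∀ m : ℝ, 1 ≤ m →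
    ∀ z : ℕ, (z : ℝ) ≤ m →
      stepOp r (fun y => (pot κ m y - pot κ m z) ^ 2) z ≤ C * m ^ 2 * (1 + z) := by
  obtain ⟨C, hC0, hC⟩ := stepOp_even_le h
  refine ⟨C * ((3 + |κ|) ^ 2 + 40), by positivity, fun m hm z hz => ?_⟩
  obtain ⟨m2, m4, m6⟩ := hC z
  have hz0 : (0 : ℝ) ≤ z := Nat.cast_nonneg z
  set w := max (z : ℝ) 1 with hw
  have hw1 : 1 ≤ w := le_max_right _ _
  have hw0 : 0 < w := by linarith
  have hzw : 1 + (z : ℝ) ≤ 2 * w := by have := le_max_left (z : ℝ) 1; linarith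
  set a := (3 + |κ|) ^ 2 * m ^ 2
  set b := 9 * m ^ 2 / w ^ 2
  set c := 1 / w ^ 2
  have e1 := (expBdd_sub_pow (z : ℝ) 2).const_mul a
  have e2 := (expBdd_sub_pow (z : ℝ) 4).const_mul b
  have e3 := (expBdd_sub_pow (z : ℝ) 6).const_mul c
  have eb : ExpBdd fun y => (pot κ m y - pot κ m z) ^ 2 := by
    refine ExpBdd.of_poly (k := 6)
      (C := (2 * (|Real.log m| * (1 + |κ|) + 1) ^ 2 + 2 * pot κ m z ^ 2)) fun d => ?_
    rw [abs_of_nonneg (sq_nonneg _)]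
    have h1 := abs_pot_le_cube κ m d
    have h2 := pow_le_pow_left₀ (abs_nonneg _) h1 2
    rw [sq_abs, mul_pow, ← pow_mul] at h2
    have h3 : (1 : ℝ) ≤ (1 + (d : ℝ)) ^ 6 := one_le_pow₀ (by simp)
    have h4 := mul_le_mul_of_nonneg_left h3 (sq_nonneg (pot κ m z))
    norm_num at h2
    nlinarith [sq_nonneg (pot κ m d + pot κ m z)]
  have hle := stepOp_mono h eb ((e1.add e2).add e3) (fun y => by
    have h1 := abs_pot_sub_le (κ := κ) hm hz y
    rw [← hw] at h1
    have h2 := pow_le_pow_left₀ (abs_nonneg _) h1 2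
    rw [sq_abs, mul_pow] at h2
    have h3 : ∀ p q s : ℝ, (p + q + s) ^ 2 ≤ 3 * (p ^ 2 + q ^ 2 + s ^ 2) := fun p q s => by
      nlinarith [sq_nonneg (p - q), sq_nonneg (p - s), sq_nonneg (q - s)]
    have h4 := h2.trans (h3 _ _ _)
    have k1 : ((3 + |κ|) * m * |(y : ℝ) - z|) ^ 2 = a * ((y : ℝ) - z) ^ 2 := by
      rw [mul_pow, sq_abs, mul_pow]
    have k2 : (3 * (m / w) * ((y : ℝ) - z) ^ 2) ^ 2 = b * ((y : ℝ) - z) ^ 4 := by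
      simp only [b]; field_simp; ring
    have k3 : (|(y : ℝ) - z| ^ 3 / w) ^ 2 = c * ((y : ℝ) - z) ^ 6 := by
      rw [div_pow, ← pow_mul, ← (show Even (3 * 2) by decide).pow_abs ((y : ℝ) - z)]
      simp only [c]; field_simp
    rw [k1, k2, k3] at h4
    have p1 : 0 ≤ a * ((y : ℝ) - z) ^ 2 := by positivity
    have p2 : 0 ≤ b * ((y : ℝ) - z) ^ 4 := by positivity
    have p3 : 0 ≤ c * ((y : ℝ) - z) ^ 6 := by positivity
    linarith) z
  rw [stepOp_add h (e1.add e2) e3, stepOp_add h e1 e2, stepOp_const_mul, stepOp_const_mul,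
    stepOp_const_mul] at hle
  have k1 := mul_le_mul_of_nonneg_left m2 (show 0 ≤ a by positivity)
  have k2 := mul_le_mul_of_nonneg_left m4 (show 0 ≤ b by positivity)
  have k3 := mul_le_mul_of_nonneg_left m6 (show 0 ≤ c by positivity)
  have hq : (1 + (z : ℝ)) ^ 2 / w ^ 2 ≤ 4 := by
    rw [div_le_iff₀ (by positivity)]
    nlinarith
  have hm2 : 1 ≤ m ^ 2 := one_le_pow₀ hm
  have l2 : b * (C * (1 + (z : ℝ)) ^ 2) ≤ C * 36 * m ^ 2 * (1 + z) := by
    have : b * (C * (1 + (z : ℝ)) ^ 2) = 9 * m ^ 2 * C * ((1 + (z : ℝ)) ^ 2 / w ^ 2) := by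
      simp only [b]; ring
    rw [this]
    have h1 := mul_le_mul_of_nonneg_left hq (show 0 ≤ 9 * m ^ 2 * C by positivity)
    have h2 : 0 ≤ m ^ 2 * C * z := by positivity
    linarith
  have l3 : c * (C * (1 + (z : ℝ)) ^ 3) ≤ C * 4 * m ^ 2 * (1 + z) := by
    have : c * (C * (1 + (z : ℝ)) ^ 3) = C * (1 + z) * ((1 + (z : ℝ)) ^ 2 / w ^ 2) := by
      simp only [c]; ring
    rw [this]
    have h1 := mul_le_mul_of_nonneg_left hq (show 0 ≤ C * (1 + (z : ℝ)) by positivity)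
    have h2 := mul_le_mul_of_nonneg_left hm2 (show 0 ≤ C * (1 + (z : ℝ)) by positivity)
    nlinarith
  have l1 : a * (C * (1 + (z : ℝ))) = C * (3 + |κ|) ^ 2 * m ^ 2 * (1 + z) := by
    simp only [a]; ring
  nlinarith

lemma stepOp_sub_stepOp_sq (h : IsCoins M r) {φ : ℕ → ℝ} (hφ : ExpBdd φ)
    (hφ2 : ExpBdd fun d => φ d ^ 2) (z : ℕ) (a : ℝ) :
    stepOp r (fun y => (φ y - stepOp r φ z) ^ 2) z ≤ stepOp r (fun y => (φ y - a) ^ 2) z := by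
  have key : ∀ c : ℝ, stepOp r (fun y => (φ y - c) ^ 2) z =
      stepOp r (fun y => φ y ^ 2) z + (-2 * c) * stepOp r φ z + c ^ 2 := by
    intro c
    have e : (fun y => (φ y - c) ^ 2) = fun y => φ y ^ 2 + (-2 * c) * φ y + c ^ 2 := by
      ext y; ring
    rw [e, stepOp_add h (hφ2.add (hφ.const_mul _)) (expBdd_const _),
      stepOp_add h hφ2 (hφ.const_mul _), stepOp_const_mul, stepOp_const h]
  rw [key, key]
  nlinarith [sq_nonneg (stepOp r φ z - a)]

lemma stepOp_mean_sub_le (h : IsCoins M r) (z : ℕ) :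
    stepOp r (fun d => (d : ℝ) - z) z ≤ 1 := by
  have h1 := stepOp_mean_le h (z + 1)
  have e : ExpBdd fun d : ℕ => (d : ℝ) := by simpa using expBdd_sub_pow 0 1
  rw [stepOp_sub h e (expBdd_const _), stepOp_const h, stepOp]
  push_cast at h1; linarith

lemma stepOp_pow_two_le (h : IsCoins M r) : ∃ C : ℝ, 0 ≤ C ∧ ∀ z : ℕ,
    stepOp r (fun d => (d : ℝ) ^ 2) z ≤ (z : ℝ) ^ 2 + C := by
  obtain ⟨κ, hκ⟩ := stepOp_sq h
  refine ⟨|κ| + ∑ z ∈ Finset.range M, |stepOp r (fun d => (d : ℝ) ^ 2) z|,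
    add_nonneg (abs_nonneg _) (Finset.sum_nonneg fun _ _ => abs_nonneg _), fun z => ?_⟩
  have hsum : 0 ≤ ∑ z ∈ Finset.range M, |stepOp r (fun d => (d : ℝ) ^ 2) z| :=
    Finset.sum_nonneg fun _ _ => abs_nonneg _
  by_cases hz : M ≤ z
  · have := stepOp_quad h hκ ((z : ℝ) ^ 2) (2 * z) 1 hz
    have e : (fun d : ℕ => (z : ℝ) ^ 2 + (2 * z) * ((d : ℝ) - z) + 1 * ((d : ℝ) - z) ^ 2) =
        fun d : ℕ => (d : ℝ) ^ 2 := by ext d; ring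
    rw [e] at this
    rw [this]
    have := le_abs_self κ
    linarith
  · have := Finset.single_le_sum (f := fun z : ℕ => |stepOp r (fun d => (d : ℝ) ^ 2) z|)
      (fun _ _ => abs_nonneg _) (Finset.mem_range.2 (not_le.1 hz))
    have := le_abs_self (stepOp r (fun d => (d : ℝ) ^ 2) z)
    have := sq_nonneg (z : ℝ)
    have := abs_nonneg κ
    linarith

lemma stepOp_pow_three_le (h : IsCoins M r) : ∃ C : ℝ, 0 ≤ C ∧ ∀ z : ℕ,
    stepOp r (fun d => (d : ℝ) ^ 3) z ≤ (z : ℝ) ^ 3 + C * (1 + (z : ℝ) ^ 2) := by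
  obtain ⟨C, hC0, hC⟩ := stepOp_even_le h
  refine ⟨2 * (3 + 4 * C), by positivity, fun z => ?_⟩
  obtain ⟨m2, m4, -⟩ := hC z
  have m1 := stepOp_mean_sub_le h z
  have hz0 : (0 : ℝ) ≤ z := Nat.cast_nonneg z
  have e0 : ExpBdd fun d : ℕ => (d : ℝ) - z := by simpa using expBdd_sub_pow (z : ℝ) 1
  have e1 := e0.const_mul (3 * z ^ 2 : ℝ)
  have e2 := (expBdd_sub_pow (z : ℝ) 2).const_mul (3 * z + 1 / 2 : ℝ)
  have e3 := (expBdd_sub_pow (z : ℝ) 4).const_mul (1 / 2)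
  have e4 := expBdd_const ((z : ℝ) ^ 3)
  have hle := stepOp_mono h (by simpa using expBdd_sub_pow 0 3) (((e4.add e1).add e2).add e3)
    (fun d => by
      set D := (d : ℝ) - z with hD
      have : (d : ℝ) = z + D := by rw [hD]; ring
      rw [this]
      nlinarith [sq_nonneg (D ^ 2 - D)]) z
  rw [stepOp_add h ((e4.add e1).add e2) e3, stepOp_add h (e4.add e1) e2, stepOp_add h e4 e1,
    stepOp_const h, stepOp_const_mul, stepOp_const_mul, stepOp_const_mul] at hle
  have k1 := mul_le_mul_of_nonneg_left m1 (show 0 ≤ 3 * (z : ℝ) ^ 2 by positivity)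
  have k2 := mul_le_mul_of_nonneg_left m2 (show 0 ≤ 3 * (z : ℝ) + 1 / 2 by positivity)
  nlinarith [mul_nonneg hC0 hz0, mul_nonneg hC0 (sq_nonneg ((z : ℝ) - 1))]

lemma stepOp_pow_six_le (h : IsCoins M r) : ∃ C : ℝ, 0 ≤ C ∧ ∀ z : ℕ,
    stepOp r (fun d => (1 + (d : ℝ)) ^ 6) z ≤ C * (1 + (z : ℝ)) ^ 6 := by
  obtain ⟨C, hC0, hC⟩ := stepOp_even_le h
  refine ⟨32 * (1 + C), by positivity, fun z => ?_⟩
  obtain ⟨-, -, m6⟩ := hC z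
  have hz0 : (0 : ℝ) ≤ z := Nat.cast_nonneg z
  have e1 := (expBdd_sub_pow (z : ℝ) 6).add (expBdd_const ((1 + (z : ℝ)) ^ 6))
  have hle := stepOp_mono h (expBdd_pow 6) (e1.const_mul 32) (fun d => by
    have := Even.add_pow_le (a := (d : ℝ) - z) (b := 1 + z) (n := 6) (by decide)
    have e : (d : ℝ) - z + (1 + z) = 1 + d := by ring
    rw [e] at this
    exact this.trans_eq (by norm_num)) z
  rw [stepOp_const_mul, stepOp_add h (expBdd_sub_pow _ _) (expBdd_const _), stepOp_const h] at hle
  have : C * (1 + (z : ℝ)) ^ 3 ≤ C * (1 + (z : ℝ)) ^ 6 := by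
    gcongr
    · linarith
    · norm_num
  linarith

/-- A strictly subharmonic bounded perturbation of `quad κ`. -/
lemma exists_subharmonic (h : IsCoins M r) {κ : ℝ}
    (hκ : ∀ z : ℕ, M ≤ z → stepOp r (fun d => ((d : ℝ) - z) ^ 2) z = 2 * z + κ) :
    ∃ g : ℕ → ℝ, (∃ B, ∀ z, |g z - quad κ z| ≤ B) ∧ (∀ z, g z ≤ stepOp r g z) ∧
      g 0 < stepOp r g 0 := by
  obtain ⟨A, hA⟩ : ∃ A : ℝ, 0 < A ∧ ∀ z < M, quad κ z ≤ A := by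
    refine ⟨1 + ∑ z ∈ Finset.range M, |quad κ z|,
      add_pos_of_pos_of_nonneg one_pos (Finset.sum_nonneg fun _ _ => abs_nonneg _),
      fun z hz => ?_⟩
    have := Finset.single_le_sum (f := fun z : ℕ => |quad κ z|)
      (fun _ _ => abs_nonneg _) (Finset.mem_range.2 hz)
    have := le_abs_self (quad κ z)
    linarith
  set g : ℕ → ℝ := fun z => max (quad κ z) A with hg
  have hqlow : ∀ z : ℕ, -(κ ^ 2) ≤ quad κ z := fun z => by
    rw [quad]; nlinarith [sq_nonneg ((z : ℝ) + κ / 2), sq_nonneg κ]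
  have hgb : ∀ z, |g z| ≤ (1 + |κ| + A) * ((1 : ℝ) + z) ^ 2 := fun z => by
    have h1 := abs_quad_le κ z
    have h2 : (1 : ℝ) ≤ (1 + (z : ℝ)) ^ 2 := one_le_pow₀ (by simp)
    have h3 := mul_le_mul_of_nonneg_left h2 hA.1.le
    have h4 : |g z| ≤ |quad κ z| + A := by
      rw [abs_le]
      have := abs_nonneg (quad κ z)
      constructor
      · have := le_max_right (quad κ z) A; simp only [hg]; linarith
      · refine max_le ?_ (by linarith)
        have := le_abs_self (quad κ z); linarith
    nlinarith
  have eg : ExpBdd g := ExpBdd.of_poly hgb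
  have hgA : ∀ z, A ≤ stepOp r g z := fun z => by
    have := stepOp_mono h (expBdd_const A) eg (fun d => le_max_right _ _) z
    rwa [stepOp_const h] at this
  refine ⟨g, ⟨A + κ ^ 2, fun z => ?_⟩, fun z => ?_, ?_⟩
  · have h1 := hqlow z
    rw [abs_le]; simp only [hg]
    have := sq_nonneg κ
    constructor
    · have := le_max_left (quad κ z) A; linarith [hA.1]
    · rw [sub_le_iff_le_add]; refine max_le ?_ ?_ <;> linarith [hA.1]
  · by_cases hz : M ≤ z
    · refine max_le ?_ (hgA z)
      rw [← stepOp_quad_eq h hκ hz]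
      exact stepOp_mono h (expBdd_quad κ) eg (fun d => le_max_left _ _) z
    · have : g z = A := max_eq_right (hA.2 z (not_le.1 hz))
      rw [this]; exact hgA z
  · have h0 : g 0 = A := by
      refine max_eq_right ?_
      simp [quad, hA.1.le]
    rw [h0]
    obtain ⟨d, hd⟩ : ∃ d : ℕ, A < quad κ d := by
      obtain ⟨d, hd⟩ := exists_nat_gt (|κ| + A + 1)
      refine ⟨d, ?_⟩
      rw [quad]
      have := neg_abs_le κ
      have := abs_nonneg κ
      nlinarith [hA.1]
    have hgd : A < g d := lt_max_of_lt_left hd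
    have hp := negBin_one_pos h 0 d
    have e : ExpBdd fun y => if y = d then g d - A else 0 :=
      ExpBdd.of_poly (k := 0) (C := g d - A) fun y => by
        split_ifs <;> simp [abs_of_pos (sub_pos.2 hgd), hgd.le]
    have h1 := stepOp_mono h ((expBdd_const A).add e) eg (fun y => by
      split_ifs with hy
      · rw [hy]; linarith
      · have : A ≤ g y := le_max_right _ _
        linarith) 0
    rw [stepOp_add h (expBdd_const A) e, stepOp_const h] at h1
    have h2 : stepOp r (fun y => if y = d then g d - A else 0) 0 =
        negBin r 0 1 d * (g d - A) := by
      rw [stepOp, ev, tsum_eq_single d]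
      · simp
      · intro y hy; simp [hy]
    have h3 : 0 < negBin r 0 1 d * (g d - A) := mul_pos hp (by linarith)
    linarith

/-- `Y` is a Markov chain started at `0` with transition operator `stepOp r`, with respect to
the filtration `ℱ`. -/
structure IsChain (r : ℕ → ℝ) {Ω : Type*} {mΩ : MeasurableSpace Ω} (μ : Measure Ω)
    (ℱ : Filtration ℕ mΩ) (Y : ℕ → Ω → ℕ) : Prop where
  init : ∀ ω, Y 0 ω = 0
  adapted : ∀ i, Measurable[ℱ i] (Y i)
  markov : ∀ i A, MeasurableSet[ℱ i] A → ∀ z y,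
    μ (A ∩ Y i ⁻¹' {z} ∩ Y (i + 1) ⁻¹' {y}) =
      ENNReal.ofReal (negBin r 0 (z + 1) y) * μ (A ∩ Y i ⁻¹' {z})

section Chain

variable {Ω : Type*} {mΩ : MeasurableSpace Ω} {μ : Measure Ω} {ℱ : Filtration ℕ mΩ}
  {Y : ℕ → Ω → ℕ}

lemma IsChain.measurable (hY : IsChain r μ ℱ Y) (i : ℕ) : Measurable (Y i) :=
  (hY.adapted i).mono (ℱ.le i) le_rfl

lemma IsChain.lintegral_step (hY : IsChain r μ ℱ Y) {i : ℕ} {A : Set Ω}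
    (hA : MeasurableSet[ℱ i] A) (g : ℕ → ℕ → ℝ≥0∞) :
    ∫⁻ ω in A, g (Y i ω) (Y (i + 1) ω) ∂μ =
      ∫⁻ ω in A, (∑' y, ENNReal.ofReal (negBin r 0 (Y i ω + 1) y) * g (Y i ω) y) ∂μ := by
  have hAm : MeasurableSet A := ℱ.le i A hA
  have m1 := hY.measurable i
  have m2 := hY.measurable (i + 1)
  have e1 : ∫⁻ ω in A, g (Y i ω) (Y (i + 1) ω) ∂μ =
      ∫⁻ q, g q.1 q.2 ∂(μ.restrict A).map fun ω => (Y i ω, Y (i + 1) ω) := by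
    rw [lintegral_map (measurable_of_countable _) (m1.prodMk m2)]
  have e2 : ∫⁻ ω in A, (∑' y, ENNReal.ofReal (negBin r 0 (Y i ω + 1) y) * g (Y i ω) y) ∂μ =
      ∫⁻ z, (∑' y, ENNReal.ofReal (negBin r 0 (z + 1) y) * g z y) ∂(μ.restrict A).map (Y i) := by
    rw [lintegral_map (measurable_of_countable _) m1]
  rw [e1, e2, lintegral_countable', lintegral_countable', ENNReal.tsum_prod']
  refine tsum_congr fun z => ?_
  rw [← ENNReal.tsum_mul_right]
  refine tsum_congr fun y => ?_
  rw [Measure.map_apply (m1.prodMk m2) (measurableSet_singleton _),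
    Measure.map_apply m1 (measurableSet_singleton _), Measure.restrict_apply
      ((m1.prodMk m2) (measurableSet_singleton _)),
    Measure.restrict_apply (m1 (measurableSet_singleton _))]
  have h1 := hY.markov i A hA z y
  have s1 : (fun ω => (Y i ω, Y (i + 1) ω)) ⁻¹' {(z, y)} ∩ A =
      A ∩ Y i ⁻¹' {z} ∩ Y (i + 1) ⁻¹' {y} := by
    ext ω; simp [Prod.ext_iff]; tauto
  rw [s1, h1, inter_comm]
  ring

/-- `∑ negBin * φ` in `ℝ≥0∞` agrees with `stepOp`. -/
lemma tsum_ofReal_negBin (h : IsCoins M r) {φ : ℕ → ℝ} (hφ : ExpBdd φ) (h0 : ∀ d, 0 ≤ φ d)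
    (z : ℕ) : ∑' y, ENNReal.ofReal (negBin r 0 (z + 1) y) * ENNReal.ofReal (φ y) =
      ENNReal.ofReal (stepOp r φ z) := by
  rw [stepOp, ev, ENNReal.ofReal_tsum_of_nonneg
    (fun y => mul_nonneg (negBin_nonneg h _ _ _) (h0 y)) (hφ.summable h _ _)]
  exact tsum_congr fun y => (ENNReal.ofReal_mul (negBin_nonneg h _ _ _)).symm

lemma stepOp_nonneg (h : IsCoins M r) {φ : ℕ → ℝ} (h0 : ∀ d, 0 ≤ φ d) (z : ℕ) :
    0 ≤ stepOp r φ z :=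
  tsum_nonneg fun y => mul_nonneg (negBin_nonneg h _ _ _) (h0 y)

/-- Functions of degree at most six. -/
def PolyBdd (φ : ℕ → ℝ) : Prop := ∃ C : ℝ, ∀ z : ℕ, |φ z| ≤ C * (1 + (z : ℝ)) ^ 6

lemma PolyBdd.expBdd {φ : ℕ → ℝ} (hφ : PolyBdd φ) : ExpBdd φ :=
  let ⟨_, hC⟩ := hφ; ExpBdd.of_poly hC

lemma PolyBdd.of_le {φ : ℕ → ℝ} {C : ℝ} {k : ℕ} (hk : k ≤ 6)
    (hC : ∀ z : ℕ, |φ z| ≤ C * (1 + (z : ℝ)) ^ k) : PolyBdd φ := by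
  refine ⟨|C|, fun z => (hC z).trans ?_⟩
  have h1 : (1 + (z : ℝ)) ^ k ≤ (1 + (z : ℝ)) ^ 6 := pow_le_pow_right₀ (by simp) hk
  calc C * (1 + (z : ℝ)) ^ k ≤ |C| * (1 + (z : ℝ)) ^ k :=
        mul_le_mul_of_nonneg_right (le_abs_self C) (by positivity)
    _ ≤ _ := mul_le_mul_of_nonneg_left h1 (abs_nonneg C)

lemma polyBdd_pow {k : ℕ} (hk : k ≤ 6) : PolyBdd fun d => (d : ℝ) ^ k :=
  PolyBdd.of_le (C := 1) hk fun z => by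
    rw [abs_of_nonneg (by positivity), one_mul]; gcongr; linarith

lemma PolyBdd.add {φ ψ : ℕ → ℝ} (hφ : PolyBdd φ) (hψ : PolyBdd ψ) :
    PolyBdd fun d => φ d + ψ d := by
  obtain ⟨C, hC⟩ := hφ
  obtain ⟨D, hD⟩ := hψ
  refine ⟨C + D, fun z => (abs_add_le _ _).trans ?_⟩
  linarith [hC z, hD z]

lemma PolyBdd.const_mul {φ : ℕ → ℝ} (hφ : PolyBdd φ) (a : ℝ) : PolyBdd fun d => a * φ d := by
  obtain ⟨C, hC⟩ := hφ
  refine ⟨|a| * C, fun z => ?_⟩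
  rw [abs_mul, mul_assoc]
  exact mul_le_mul_of_nonneg_left (hC z) (abs_nonneg a)

lemma PolyBdd.sub {φ ψ : ℕ → ℝ} (hφ : PolyBdd φ) (hψ : PolyBdd ψ) :
    PolyBdd fun d => φ d - ψ d := by
  simpa [sub_eq_add_neg] using hφ.add (hψ.const_mul (-1))

lemma polyBdd_of_bdd {φ : ℕ → ℝ} {C : ℝ} (hC : ∀ z : ℕ, |φ z| ≤ C) : PolyBdd φ :=
  PolyBdd.of_le (C := C) (k := 0) (by norm_num) fun z => by simpa using hC z

lemma polyBdd_quad (κ : ℝ) : PolyBdd (quad κ) := PolyBdd.of_le (by norm_num) (abs_quad_le κ)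

lemma polyBdd_sqLog : PolyBdd sqLog := PolyBdd.of_le (by norm_num) abs_sqLog_le

lemma PolyBdd.stepOp (h : IsCoins M r) {φ : ℕ → ℝ} (hφ : PolyBdd φ) : PolyBdd (stepOp r φ) := by
  obtain ⟨C, hC⟩ := hφ
  obtain ⟨D, hD0, hD⟩ := stepOp_pow_six_le h
  have hC0 : 0 ≤ C := by simpa using (abs_nonneg _).trans (hC 0)
  refine ⟨C * D, fun z => ?_⟩
  have e : ExpBdd φ := ExpBdd.of_poly hC
  have h1 := (abs_stepOp_le h e z).trans
    (stepOp_mono h e.abs ((expBdd_pow 6).const_mul C) hC z)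
  rw [stepOp_const_mul] at h1
  have := mul_le_mul_of_nonneg_left (hD z) hC0
  linarith

/-- Functions of two variables of degree at most six. -/
def PolyBdd₂ (g : ℕ → ℕ → ℝ) : Prop :=
  ∃ C : ℝ, ∀ z y : ℕ, |g z y| ≤ C * ((1 + (z : ℝ)) ^ 6 + (1 + (y : ℝ)) ^ 6)

lemma PolyBdd₂.polyBdd {g : ℕ → ℕ → ℝ} (hg : PolyBdd₂ g) (z : ℕ) : PolyBdd (g z) := by
  obtain ⟨C, hC⟩ := hg
  have hC0 : 0 ≤ C := by
    have := (abs_nonneg _).trans (hC 0 0)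
    norm_num at this; linarith
  refine ⟨C * ((1 + (z : ℝ)) ^ 6 + 1), fun y => (hC z y).trans ?_⟩
  have h1 : (1 : ℝ) ≤ (1 + (y : ℝ)) ^ 6 := one_le_pow₀ (by simp)
  rw [mul_assoc]
  refine mul_le_mul_of_nonneg_left ?_ hC0
  have h2 : (0 : ℝ) ≤ (1 + (z : ℝ)) ^ 6 := by positivity
  nlinarith

variable [IsProbabilityMeasure μ]

lemma IsChain.lintegral_pow_lt_top (h : IsCoins M r) (hY : IsChain r μ ℱ Y) (i : ℕ) :
    ∫⁻ ω, ENNReal.ofReal ((1 + (Y i ω : ℝ)) ^ 6) ∂μ < ∞ := by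
  induction i with
  | zero => simp [hY.init]
  | succ i ih =>
    obtain ⟨D, hD0, hD⟩ := stepOp_pow_six_le h
    have h1 := hY.lintegral_step (i := i) (A := univ) MeasurableSet.univ
      (fun _ y => ENNReal.ofReal ((1 + (y : ℝ)) ^ 6))
    simp only [Measure.restrict_univ] at h1
    rw [h1]
    calc _ ≤ ∫⁻ ω, ENNReal.ofReal D * ENNReal.ofReal ((1 + (Y i ω : ℝ)) ^ 6) ∂μ := by
          refine lintegral_mono fun ω => ?_
          rw [tsum_ofReal_negBin h (expBdd_pow 6) (fun d => by positivity),
            ← ENNReal.ofReal_mul hD0]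
          exact ENNReal.ofReal_le_ofReal (hD _)
      _ < ∞ := by
          rw [lintegral_const_mul' _ _ ENNReal.ofReal_ne_top]
          exact ENNReal.mul_lt_top ENNReal.ofReal_lt_top ih

lemma IsChain.integrable_pow_six (h : IsCoins M r) (hY : IsChain r μ ℱ Y) (i : ℕ) :
    Integrable (fun ω => (1 + (Y i ω : ℝ)) ^ 6) μ := by
  refine ⟨((measurable_of_countable (fun z : ℕ => (1 + (z : ℝ)) ^ 6)).comp
    (hY.measurable i)).aestronglyMeasurable, ?_⟩
  rw [hasFiniteIntegral_iff_ofReal (ae_of_all _ fun ω => by positivity)]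
  exact hY.lintegral_pow_lt_top h i

lemma IsChain.integrable (h : IsCoins M r) (hY : IsChain r μ ℱ Y) {φ : ℕ → ℝ} (hφ : PolyBdd φ)
    (i : ℕ) : Integrable (fun ω => φ (Y i ω)) μ := by
  obtain ⟨C, hC⟩ := hφ
  refine ((hY.integrable_pow_six h i).const_mul C).mono'
    ((measurable_of_countable φ).comp (hY.measurable i)).aestronglyMeasurable
    (ae_of_all _ fun ω => hC _)

lemma IsChain.integrable₂ (h : IsCoins M r) (hY : IsChain r μ ℱ Y) {g : ℕ → ℕ → ℝ}
    (hg : PolyBdd₂ g) (i : ℕ) : Integrable (fun ω => g (Y i ω) (Y (i + 1) ω)) μ := by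
  obtain ⟨C, hC⟩ := hg
  refine (((hY.integrable_pow_six h i).add (hY.integrable_pow_six h (i + 1))).const_mul C).mono'
    ((measurable_of_countable (fun q : ℕ × ℕ => g q.1 q.2)).comp
      ((hY.measurable i).prodMk (hY.measurable (i + 1)))).aestronglyMeasurable
    (ae_of_all _ fun ω => hC _ _)

lemma PolyBdd₂.polyBdd_stepOp (h : IsCoins M r) {g : ℕ → ℕ → ℝ} (hg : PolyBdd₂ g) :
    PolyBdd fun z => CookieWalk.stepOp r (g z) z := by
  obtain ⟨C, hC⟩ := id hg
  obtain ⟨D, hD0, hD⟩ := stepOp_pow_six_le h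
  have hC0 : 0 ≤ C := by
    have := (abs_nonneg _).trans (hC 0 0)
    norm_num at this; linarith
  refine ⟨C * (1 + D), fun z => ?_⟩
  have e := (hg.polyBdd z).expBdd
  have e2 := (expBdd_const ((1 + (z : ℝ)) ^ 6)).add (expBdd_pow 6)
  have h1 := (abs_stepOp_le h e z).trans (stepOp_mono h e.abs (e2.const_mul C) (hC z) z)
  rw [stepOp_const_mul, stepOp_add h (expBdd_const _) (expBdd_pow 6), stepOp_const h] at h1
  have := mul_le_mul_of_nonneg_left (hD z) hC0
  linarith

lemma IsChain.setIntegral_step_of_nonneg (h : IsCoins M r) (hY : IsChain r μ ℱ Y) {i : ℕ}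
    {A : Set Ω} (hA : MeasurableSet[ℱ i] A) {g : ℕ → ℕ → ℝ} (hg : PolyBdd₂ g)
    (h0 : ∀ z y, 0 ≤ g z y) :
    ∫ ω in A, g (Y i ω) (Y (i + 1) ω) ∂μ = ∫ ω in A, stepOp r (g (Y i ω)) (Y i ω) ∂μ := by
  rw [integral_eq_lintegral_of_nonneg_ae (ae_of_all _ fun ω => h0 _ _)
      (hY.integrable₂ h hg i).integrableOn.aestronglyMeasurable,
    integral_eq_lintegral_of_nonneg_ae (ae_of_all _ fun ω => stepOp_nonneg h (h0 _) _)
      (hY.integrable h (hg.polyBdd_stepOp h) i).integrableOn.aestronglyMeasurable]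
  congr 1
  rw [hY.lintegral_step hA (fun z y => ENNReal.ofReal (g z y))]
  refine lintegral_congr fun ω => ?_
  rw [tsum_ofReal_negBin h (hg.polyBdd _).expBdd (h0 _)]

lemma IsChain.setIntegral_step (h : IsCoins M r) (hY : IsChain r μ ℱ Y) {i : ℕ}
    {A : Set Ω} (hA : MeasurableSet[ℱ i] A) {g : ℕ → ℕ → ℝ} (hg : PolyBdd₂ g) :
    ∫ ω in A, g (Y i ω) (Y (i + 1) ω) ∂μ = ∫ ω in A, stepOp r (g (Y i ω)) (Y i ω) ∂μ := by
  obtain ⟨C, hC⟩ := id hg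
  have hC0 : 0 ≤ C := by
    have := (abs_nonneg _).trans (hC 0 0)
    norm_num at this; linarith
  set w : ℕ → ℕ → ℝ := fun z y => C * ((1 + (z : ℝ)) ^ 6 + (1 + (y : ℝ)) ^ 6) with hw
  have hw0 : ∀ z y, 0 ≤ w z y := fun z y => by positivity
  have hwb : PolyBdd₂ w := ⟨C, fun z y => by rw [abs_of_nonneg (hw0 z y)]⟩
  have hs0 : ∀ z y, 0 ≤ g z y + w z y := fun z y => by
    have := neg_abs_le (g z y); have := hC z y; simp only [hw]; linarith
  have hsb : PolyBdd₂ fun z y => g z y + w z y := ⟨2 * C, fun z y => by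
    refine (abs_add_le _ _).trans ?_
    rw [abs_of_nonneg (hw0 z y)]
    have := hC z y; simp only [hw]; linarith⟩
  have k1 := hY.setIntegral_step_of_nonneg h hA hsb hs0
  have k2 := hY.setIntegral_step_of_nonneg h hA hwb hw0
  rw [integral_add (hY.integrable₂ h hg i).integrableOn (hY.integrable₂ h hwb i).integrableOn]
    at k1
  have e : ∀ z, stepOp r (fun y => g z y + w z y) z = stepOp r (g z) z + stepOp r (w z) z :=
    fun z => stepOp_add h (hg.polyBdd z).expBdd (hwb.polyBdd z).expBdd z
  simp only [e] at k1
  rw [integral_add (hY.integrable h (hg.polyBdd_stepOp h) i).integrableOn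
    (hY.integrable h (hwb.polyBdd_stepOp h) i).integrableOn] at k1
  linarith

lemma polyBdd₂_snd {φ : ℕ → ℝ} (hφ : PolyBdd φ) : PolyBdd₂ fun _ y => φ y := by
  obtain ⟨C, hC⟩ := hφ
  have hC0 : 0 ≤ C := by simpa using (abs_nonneg _).trans (hC 0)
  refine ⟨C, fun z y => (hC y).trans (mul_le_mul_of_nonneg_left ?_ hC0)⟩
  have : (0 : ℝ) ≤ (1 + (z : ℝ)) ^ 6 := by positivity
  linarith

lemma IsChain.setIntegral_succ (h : IsCoins M r) (hY : IsChain r μ ℱ Y) {φ : ℕ → ℝ}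
    (hφ : PolyBdd φ) {i : ℕ} {A : Set Ω} (hA : MeasurableSet[ℱ i] A) :
    ∫ ω in A, φ (Y (i + 1) ω) ∂μ = ∫ ω in A, stepOp r φ (Y i ω) ∂μ :=
  hY.setIntegral_step h hA (polyBdd₂_snd hφ)

lemma IsChain.integral_succ (h : IsCoins M r) (hY : IsChain r μ ℱ Y) {φ : ℕ → ℝ}
    (hφ : PolyBdd φ) (i : ℕ) : ∫ ω, φ (Y (i + 1) ω) ∂μ = ∫ ω, stepOp r φ (Y i ω) ∂μ := by
  simpa using hY.setIntegral_succ h hφ (i := i) (A := univ) MeasurableSet.univ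

lemma IsChain.integral_eq_sum (h : IsCoins M r) (hY : IsChain r μ ℱ Y) {φ : ℕ → ℝ}
    (hφ : PolyBdd φ) (n : ℕ) : ∫ ω, φ (Y n ω) ∂μ =
      φ 0 + ∑ i ∈ Finset.range n, ∫ ω, (stepOp r φ (Y i ω) - φ (Y i ω)) ∂μ := by
  induction n with
  | zero => simp [hY.init]
  | succ n ih =>
    rw [Finset.sum_range_succ, ← add_assoc, ← ih,
      integral_sub (hY.integrable h (hφ.stepOp h) n) (hY.integrable h hφ n),
      hY.integral_succ h hφ]
    ring

lemma IsChain.integral_sub_le (h : IsCoins M r) (hY : IsChain r μ ℱ Y) {φ ψ : ℕ → ℝ}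
    (hφ : PolyBdd φ) (hψ : PolyBdd ψ) (hle : ∀ z, stepOp r φ z ≤ φ z + ψ z) (n : ℕ) :
    ∫ ω, φ (Y n ω) ∂μ ≤ φ 0 + ∑ i ∈ Finset.range n, ∫ ω, ψ (Y i ω) ∂μ := by
  rw [hY.integral_eq_sum h hφ]
  refine add_le_add le_rfl (Finset.sum_le_sum fun i _ => ?_)
  exact integral_mono (hY.integrable h ((hφ.stepOp h).sub hφ) i) (hY.integrable h hψ i)
    fun ω => by have := hle (Y i ω); simp only; linarith

lemma integral_sq_le (h : IsCoins M r) (μ : Measure Ω) [IsProbabilityMeasure μ] :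
    ∃ C : ℝ, 0 ≤ C ∧ ∀ (ℱ : Filtration ℕ mΩ) (Y : ℕ → Ω → ℕ), IsChain r μ ℱ Y →
      ∀ n : ℕ, ∫ ω, (Y n ω : ℝ) ^ 2 ∂μ ≤ C * n := by
  obtain ⟨C, hC0, hC⟩ := stepOp_pow_two_le h
  refine ⟨C, hC0, fun ℱ Y hY n => ?_⟩
  have := hY.integral_sub_le h (polyBdd_pow (k := 2) (by norm_num))
    (polyBdd_of_bdd (C := C) (φ := fun _ => C) fun _ => (abs_of_nonneg hC0).le) hC n
  simp at this
  linarith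

lemma integral_cube_le (h : IsCoins M r) (μ : Measure Ω) [IsProbabilityMeasure μ] :
    ∃ C : ℝ, 0 ≤ C ∧ ∀ (ℱ : Filtration ℕ mΩ) (Y : ℕ → Ω → ℕ), IsChain r μ ℱ Y →
      ∀ n : ℕ, ∫ ω, (Y n ω : ℝ) ^ 3 ∂μ ≤ C * n ^ 2 := by
  obtain ⟨C, hC0, hC⟩ := stepOp_pow_three_le h
  obtain ⟨D, hD0, hD⟩ := integral_sq_le h μ
  refine ⟨C * (1 + D), by positivity, fun ℱ Y hY n => ?_⟩
  have p2 : PolyBdd fun d : ℕ => (d : ℝ) ^ 2 := polyBdd_pow (by norm_num)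
  have p1 : PolyBdd fun _ : ℕ => (1 : ℝ) := polyBdd_of_bdd (C := 1) fun _ => by simp
  have := hY.integral_sub_le h (polyBdd_pow (k := 3) (by norm_num))
    ((p1.add p2).const_mul C) hC n
  refine this.trans ?_
  have h2 : ∀ i ∈ Finset.range n, ∫ ω, C * (1 + (Y i ω : ℝ) ^ 2) ∂μ ≤ C * (1 + D) * n := by
    intro i hi
    rw [integral_const_mul, integral_add (integrable_const _) (hY.integrable h p2 i)]
    have h3 := hD ℱ Y hY i
    have h4 : (i : ℝ) + 1 ≤ n := by exact_mod_cast Finset.mem_range.1 hi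
    simp only [integral_const, probReal_univ, one_smul]
    have h5 : 1 + ∫ ω, (Y i ω : ℝ) ^ 2 ∂μ ≤ (1 + D) * n := by
      have : (0 : ℝ) ≤ i := Nat.cast_nonneg i
      nlinarith
    nlinarith [mul_le_mul_of_nonneg_left h5 hC0]
  have h3 := Finset.sum_le_sum h2
  simp at h3 ⊢
  linarith

lemma integral_sqLog_le (h : IsCoins M r) (μ : Measure Ω) [IsProbabilityMeasure μ] :
    ∃ C : ℝ, 0 ≤ C ∧ ∀ (ℱ : Filtration ℕ mΩ) (Y : ℕ → Ω → ℕ), IsChain r μ ℱ Y →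
      ∀ n : ℕ, 1 ≤ n → ∫ ω, sqLog (Y n ω) ∂μ ≤ C * n * (1 + Real.log n) := by
  obtain ⟨C, hC0, hC⟩ := integral_cube_le h μ
  obtain ⟨D, hD0, hD⟩ := integral_sq_le h μ
  refine ⟨C + D, by positivity, fun ℱ Y hY n hn => ?_⟩
  have hn1 : (1 : ℝ) ≤ n := by exact_mod_cast hn
  have hn0 : (0 : ℝ) < n := by linarith
  have p2 : PolyBdd fun d : ℕ => (d : ℝ) ^ 2 := polyBdd_pow (by norm_num)
  have p3 : PolyBdd fun d : ℕ => (d : ℝ) ^ 3 := polyBdd_pow (by norm_num)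
  have hle : ∀ y : ℕ, sqLog y ≤ Real.log n * (y : ℝ) ^ 2 + 1 / n * (y : ℝ) ^ 3 := by
    intro y
    rcases Nat.eq_zero_or_pos y with rfl | hy
    · simp [sqLog]
    have hy0 : (0 : ℝ) < y := by exact_mod_cast hy
    have h1 : Real.log (y / n) ≤ y / n := Real.log_le_self (by positivity)
    rw [Real.log_div hy0.ne' hn0.ne'] at h1
    have h2 := mul_le_mul_of_nonneg_left h1 (sq_nonneg (y : ℝ))
    have e : (y : ℝ) ^ 2 * (y / n) = 1 / n * (y : ℝ) ^ 3 := by ring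
    rw [sqLog]; linarith
  have h1 := integral_mono (μ := μ) (hY.integrable h polyBdd_sqLog n)
    (hY.integrable h ((p2.const_mul (Real.log n)).add (p3.const_mul (1 / n))) n)
    (fun ω => hle (Y n ω))
  have i2 := hY.integrable h p2 n
  have i3 := hY.integrable h p3 n
  rw [integral_add (i2.const_mul _) (i3.const_mul _), integral_const_mul, integral_const_mul] at h1
  have h2 := mul_le_mul_of_nonneg_left (hD ℱ Y hY n) (Real.log_nonneg hn1)
  have h3 := mul_le_mul_of_nonneg_left (hC ℱ Y hY n) (show (0 : ℝ) ≤ 1 / n by positivity)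
  have e : 1 / (n : ℝ) * (C * n ^ 2) = C * n := by field_simp
  have h4 : 0 ≤ D * n := by positivity
  have h5 : 0 ≤ C * n * Real.log n :=
    mul_nonneg (by positivity) (Real.log_nonneg hn1)
  nlinarith

lemma sum_integral_le (h : IsCoins M r) (μ : Measure Ω) [IsProbabilityMeasure μ] :
    ∃ C : ℝ, 0 ≤ C ∧ ∀ (ℱ : Filtration ℕ mΩ) (Y : ℕ → Ω → ℕ), IsChain r μ ℱ Y →
      ∀ n : ℕ, 1 ≤ n →
        ∑ i ∈ Finset.range n, ∫ ω, (Y i ω : ℝ) ∂μ ≤ C * n * (1 + Real.log n) := by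
  obtain ⟨C, hC0, hC⟩ := integral_sqLog_le h μ
  obtain ⟨D, hD0, hD⟩ := stepOp_sqLog h one_pos
  refine ⟨C + D, by positivity, fun ℱ Y hY n hn => ?_⟩
  have hn1 : (1 : ℝ) ≤ n := by exact_mod_cast hn
  have p1 : PolyBdd fun d : ℕ => (d : ℝ) := by
    simpa using polyBdd_pow (k := 1) (by norm_num)
  have h1 := hC ℱ Y hY n hn
  rw [hY.integral_eq_sum h polyBdd_sqLog] at h1
  have h2 : ∀ i ∈ Finset.range n, ∫ ω, (Y i ω : ℝ) ∂μ - D ≤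
      ∫ ω, (stepOp r sqLog (Y i ω) - sqLog (Y i ω)) ∂μ := by
    intro i _
    have i1 := hY.integrable h p1 i
    have := integral_mono (μ := μ) (i1.sub (integrable_const D))
      (hY.integrable h ((polyBdd_sqLog.stepOp h).sub polyBdd_sqLog) i) (fun ω => by
        have := (abs_le.1 (hD (Y i ω))).1
        simp only [Pi.sub_apply]; linarith)
    simp only [Pi.sub_apply] at this
    rw [integral_sub i1 (integrable_const D)] at this
    simpa using this
  have h3 := Finset.sum_le_sum h2
  rw [Finset.sum_sub_distrib] at h3
  simp [sqLog] at h1 h3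
  have h5 : 0 ≤ D * n * Real.log n := mul_nonneg (by positivity) (Real.log_nonneg hn1)
  nlinarith

lemma measure_exists_gt_le (h : IsCoins M r) (μ : Measure Ω) [IsProbabilityMeasure μ] :
    ∃ C : ℝ, 0 ≤ C ∧ ∀ (ℱ : Filtration ℕ mΩ) (Y : ℕ → Ω → ℕ), IsChain r μ ℱ Y →
      ∀ (n : ℕ) (m : ℝ), 0 < m → μ.real {ω | ∃ i ≤ n, m < Y i ω} ≤ C * n / m ^ 2 := by
  obtain ⟨C, hC0, hC⟩ := stepOp_pow_two_le h
  refine ⟨C, hC0, fun ℱ Y hY n m hm => ?_⟩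
  have p2 : PolyBdd fun d : ℕ => (d : ℝ) ^ 2 := polyBdd_pow (by norm_num)
  set A : ℕ → Set Ω := fun n => {ω | ∀ i ≤ n, (Y i ω : ℝ) ≤ m} with hA
  have hAm : ∀ n, MeasurableSet[ℱ n] (A n) := fun n => by
    have : A n = ⋂ i, ⋂ (_ : i ≤ n), Y i ⁻¹' {z | (z : ℝ) ≤ m} := by
      ext ω; simp [hA]
    rw [this]
    exact MeasurableSet.iInter fun i => MeasurableSet.iInter fun hi =>
      ((hY.adapted i).mono (ℱ.mono hi) le_rfl) (MeasurableSet.of_discrete)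
  have hAm' : ∀ n, MeasurableSet (A n) := fun n => ℱ.le n _ (hAm n)
  have hsub : ∀ n, A (n + 1) ⊆ A n := fun n ω hω i hi => hω i (by omega)
  have key : ∀ n : ℕ, ∫ ω in A n, (Y n ω : ℝ) ^ 2 ∂μ + m ^ 2 * μ.real (A n)ᶜ ≤ C * n := by
    intro n
    induction n with
    | zero =>
      have : A 0 = univ := by
        ext ω; simp [hA, hY.init, hm.le]
      simp [this, hY.init]
    | succ n ih =>
      have i1 := hY.integrable h p2 (n + 1)
      have h1 := hY.setIntegral_succ h p2 (hAm n)
      have h2 : ∫ ω in A n, stepOp r (fun d => (d : ℝ) ^ 2) (Y n ω) ∂μ ≤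
          ∫ ω in A n, ((Y n ω : ℝ) ^ 2 + C) ∂μ :=
        integral_mono (hY.integrable h (p2.stepOp h) n).integrableOn
          ((hY.integrable h p2 n).add (integrable_const C)).integrableOn fun ω => hC _
      rw [integral_add (hY.integrable h p2 n).integrableOn (integrable_const C).integrableOn,
        setIntegral_const, smul_eq_mul] at h2
      have h3 : μ.real (A n) * C ≤ C := mul_le_of_le_one_left hC0 measureReal_le_one
      have h4 : ∫ ω in A n, (Y (n + 1) ω : ℝ) ^ 2 ∂μ =
          ∫ ω in A (n + 1), (Y (n + 1) ω : ℝ) ^ 2 ∂μ +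
            ∫ ω in A n \ A (n + 1), (Y (n + 1) ω : ℝ) ^ 2 ∂μ := by
        rw [← setIntegral_union disjoint_sdiff_right ((hAm' n).diff (hAm' (n + 1)))
          i1.integrableOn i1.integrableOn, union_sdiff_cancel (hsub n)]
      have h5 : m ^ 2 * μ.real (A n \ A (n + 1)) ≤
          ∫ ω in A n \ A (n + 1), (Y (n + 1) ω : ℝ) ^ 2 ∂μ := by
        have := setIntegral_mono_on (μ := μ) (s := A n \ A (n + 1)) (f := fun _ => m ^ 2)
          (integrable_const _).integrableOn i1.integrableOn
          ((hAm' n).diff (hAm' (n + 1))) (fun ω hω => by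
            have : m < Y (n + 1) ω := by
              by_contra hlt
              refine hω.2 fun i hi => ?_
              rcases Nat.lt_or_ge n i with hi' | hi'
              · have : i = n + 1 := by omega
                rw [this]; exact not_lt.1 hlt
              · exact hω.1 i hi'
            gcongr)
        rw [setIntegral_const, smul_eq_mul] at this
        linarith
      have h6 : μ.real (A (n + 1))ᶜ = μ.real (A n)ᶜ + μ.real (A n \ A (n + 1)) := by
        rw [← measureReal_union _ ((hAm' n).diff (hAm' (n + 1)))]
        · congr 1; ext ω
          have := @hsub n ω
          simp only [mem_compl_iff, mem_union, Set.mem_sdiff]; tauto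
        · rw [disjoint_left]; intro ω hω hω'; exact hω hω'.1
      rw [h6]; push_cast
      nlinarith
  have h1 := key n
  have h2 : 0 ≤ ∫ ω in A n, (Y n ω : ℝ) ^ 2 ∂μ := integral_nonneg fun ω => by positivity
  have e : {ω | ∃ i ≤ n, m < Y i ω} = (A n)ᶜ := by
    ext ω; simp [hA]
  rw [e, le_div_iff₀ (by positivity)]
  linarith

end Chain

section Martingale

variable {Ω : Type*} {mΩ : MeasurableSpace Ω} {μ : Measure Ω} [IsProbabilityMeasure μ]

/-- Orthogonality of square integrable martingale differences. -/
lemma integral_sq_sum_eq (ℱ : Filtration ℕ mΩ) {D : ℕ → Ω → ℝ}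
    (hm : ∀ i, StronglyMeasurable[ℱ (i + 1)] (D i)) (hL : ∀ i, MemLp (D i) 2 μ)
    (h0 : ∀ i A, MeasurableSet[ℱ i] A → ∫ ω in A, D i ω ∂μ = 0) (n : ℕ) :
    ∫ ω, (∑ i ∈ Finset.range n, D i ω) ^ 2 ∂μ = ∑ i ∈ Finset.range n, ∫ ω, D i ω ^ 2 ∂μ := by
  induction n with
  | zero => simp
  | succ n ih =>
    set S : Ω → ℝ := fun ω => ∑ i ∈ Finset.range n, D i ω with hS
    have hSm : StronglyMeasurable[ℱ n] S := by
      refine Finset.stronglyMeasurable_fun_sum _ fun i hi => ?_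
      exact (hm i).mono (ℱ.mono (by have := Finset.mem_range.1 hi; omega))
    have hSL : MemLp S 2 μ := memLp_finsetSum _ fun i _ => hL i
    have hprod : Integrable (S * D n) μ := hSL.integrable_mul (hL n)
    have hDi : Integrable (D n) μ := (hL n).integrable (by norm_num)
    have hce : μ[D n|ℱ n] =ᵐ[μ] 0 := by
      refine (ae_eq_condExp_of_forall_setIntegral_eq (ℱ.le n) hDi (fun s _ _ => integrableOn_zero)
        (fun s hs _ => ?_) aestronglyMeasurable_zero).symm
      simp [h0 n s hs]
    have hcross : ∫ ω, S ω * D n ω ∂μ = 0 := by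
      have h1 := condExp_mul_of_stronglyMeasurable_left hSm hprod hDi
      have h2 := integral_condExp (μ := μ) (ℱ.le n) (f := S * D n)
      rw [integral_congr_ae (h1.trans (EventuallyEq.rfl.mul hce))] at h2
      simpa using h2.symm
    have e : ∀ ω, (∑ i ∈ Finset.range (n + 1), D i ω) ^ 2 =
        (S ω ^ 2 + 2 * (S ω * D n ω)) + D n ω ^ 2 := fun ω => by
      rw [Finset.sum_range_succ]; simp only [hS]; ring
    simp only [e]
    have i1 : Integrable (fun ω => S ω ^ 2) μ := hSL.integrable_sq
    have i2 : Integrable (fun ω => 2 * (S ω * D n ω)) μ := hprod.const_mul 2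
    have i3 : Integrable (fun ω => S ω ^ 2 + 2 * (S ω * D n ω)) μ := i1.add i2
    rw [integral_add i3 (hL n).integrable_sq, integral_add i1 i2, integral_const_mul,
      hcross, ih, Finset.sum_range_succ]
    ring

lemma integral_abs_le_sqrt {S : Ω → ℝ} (hS : MemLp S 2 μ) :
    ∫ ω, |S ω| ∂μ ≤ √(∫ ω, S ω ^ 2 ∂μ) := by
  refine Real.le_sqrt_of_sq_le ?_
  have h1 := variance_nonneg |S| μ
  rw [variance_eq_sub hS.abs] at h1
  simp only [Pi.pow_apply, Pi.abs_apply, sq_abs] at h1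
  linarith

end Martingale

section Chain

variable {Ω : Type*} {mΩ : MeasurableSpace Ω} {ℱ : Filtration ℕ mΩ}
  {Y : ℕ → Ω → ℕ}

/-- The truncated martingale differences of `φ`. -/
def mgDiff (r : ℕ → ℝ) (m : ℝ) (φ : ℕ → ℝ) (z y : ℕ) : ℝ :=
  if (z : ℝ) ≤ m then φ y - stepOp r φ z else 0

lemma exists_abs_mgDiff_le (h : IsCoins M r) (m : ℝ) {φ : ℕ → ℝ} {C : ℝ}
    (hφ : ∀ z : ℕ, |φ z| ≤ C * (1 + (z : ℝ)) ^ 3) :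
    ∃ D, 0 ≤ D ∧ ∀ z y, |mgDiff r m φ z y| ≤ D * (1 + (y : ℝ)) ^ 3 := by
  have hb : PolyBdd φ := PolyBdd.of_le (by norm_num) hφ
  have hC0 : 0 ≤ C := by simpa using (abs_nonneg _).trans (hφ 0)
  obtain ⟨B, hB⟩ := hb.stepOp h
  have hB0 : 0 ≤ B := by simpa using (abs_nonneg _).trans (hB 0)
  refine ⟨C + B * (1 + |m|) ^ 6, by positivity, fun z y => ?_⟩
  have h1 : (1 : ℝ) ≤ (1 + (y : ℝ)) ^ 3 := one_le_pow₀ (by simp)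
  rw [mgDiff]
  split_ifs with hz
  · refine (abs_sub _ _).trans ?_
    have h2 : B * (1 + (z : ℝ)) ^ 6 ≤ B * (1 + |m|) ^ 6 := by
      have := le_abs_self m
      gcongr; linarith
    have h3 : 0 ≤ B * (1 + |m|) ^ 6 := by positivity
    nlinarith [hφ y, hB z]
  · rw [abs_zero]; positivity

lemma sq_sum_mgDiff_le (h : IsCoins M r) (κ : ℝ) (μ : Measure Ω) [IsProbabilityMeasure μ] :
    ∃ C : ℝ, 0 ≤ C ∧ ∀ (ℱ : Filtration ℕ mΩ) (Y : ℕ → Ω → ℕ), IsChain r μ ℱ Y →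
      ∀ (n : ℕ) (m : ℝ), 1 ≤ n → 1 ≤ m →
        MemLp (fun ω => ∑ i ∈ Finset.range n, mgDiff r m (pot κ m) (Y i ω) (Y (i + 1) ω)) 2 μ ∧
        ∫ ω, (∑ i ∈ Finset.range n, mgDiff r m (pot κ m) (Y i ω) (Y (i + 1) ω)) ^ 2 ∂μ ≤
          C * m ^ 2 * (n * (1 + Real.log n)) := by
  obtain ⟨C, hC0, hC⟩ := stepOp_pot_sub_sq h κ
  obtain ⟨D, hD0, hD⟩ := sum_integral_le h μ
  refine ⟨C * (1 + D), by positivity, fun ℱ Y hY n m hn hm => ?_⟩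
  obtain ⟨K, hK0, hK⟩ := exists_abs_mgDiff_le h m (abs_pot_le_cube κ m)
  set g := mgDiff r m (pot κ m) with hg
  have hn1 : (1 : ℝ) ≤ n := by exact_mod_cast hn
  have hg1 : PolyBdd₂ g := ⟨K, fun z y => (hK z y).trans <| by
    have h1 : (1 + (y : ℝ)) ^ 3 ≤ (1 + (y : ℝ)) ^ 6 :=
      pow_le_pow_right₀ (by simp) (by norm_num)
    have h2 : (0 : ℝ) ≤ (1 + (z : ℝ)) ^ 6 := by positivity
    exact mul_le_mul_of_nonneg_left (by linarith) hK0⟩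
  have hg2 : PolyBdd₂ fun z y => g z y ^ 2 := ⟨K ^ 2, fun z y => by
    rw [abs_pow]
    have h1 := pow_le_pow_left₀ (abs_nonneg _) (hK z y) 2
    rw [mul_pow, ← pow_mul] at h1
    refine h1.trans ?_
    have h2 : (0 : ℝ) ≤ (1 + (z : ℝ)) ^ 6 := by positivity
    exact mul_le_mul_of_nonneg_left (by norm_num; linarith) (sq_nonneg K)⟩
  have epot := expBdd_pot κ m
  have epot2 : ExpBdd fun d => pot κ m d ^ 2 :=
    ExpBdd.of_poly (k := 6) (C := (|Real.log m| * (1 + |κ|) + 1) ^ 2) fun d => by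
      rw [abs_of_nonneg (sq_nonneg _), ← sq_abs]
      have h1 := pow_le_pow_left₀ (abs_nonneg _) (abs_pot_le_cube κ m d) 2
      rwa [mul_pow, ← pow_mul] at h1
  have hg0 : ∀ z, stepOp r (g z) z = 0 := fun z => by
    have e : g z = fun y => (if (z : ℝ) ≤ m then 1 else 0) *
        (pot κ m y - stepOp r (pot κ m) z) := by
      ext y; simp only [hg, mgDiff]; split_ifs <;> simp
    rw [e, stepOp_const_mul, stepOp_sub h epot (expBdd_const _), stepOp_const h]
    simp
  have hgv : ∀ z, stepOp r (fun y => g z y ^ 2) z ≤ C * m ^ 2 * (1 + z) := fun z => by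
    by_cases hz : (z : ℝ) ≤ m
    · have e : (fun y => g z y ^ 2) = fun y => (pot κ m y - stepOp r (pot κ m) z) ^ 2 := by
        ext y; simp only [hg, mgDiff, if_pos hz]
      rw [e]
      exact (stepOp_sub_stepOp_sq h epot epot2 z _).trans (hC m hm z hz)
    · have e : (fun y => g z y ^ 2) = fun _ => 0 := by
        ext y; simp [hg, mgDiff, if_neg hz]
      rw [e, stepOp_const h]; positivity
  have hmeas : ∀ i, StronglyMeasurable[ℱ (i + 1)] fun ω => g (Y i ω) (Y (i + 1) ω) := fun i => by
    have m1 : Measurable[ℱ (i + 1)] (Y i) := (hY.adapted i).mono (ℱ.mono (by omega)) le_rfl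
    exact ((measurable_of_countable fun q : ℕ × ℕ => g q.1 q.2).comp
      (m1.prodMk (hY.adapted (i + 1)))).stronglyMeasurable
  have hL : ∀ i, MemLp (fun ω => g (Y i ω) (Y (i + 1) ω)) 2 μ := fun i =>
    (memLp_two_iff_integrable_sq (hY.integrable₂ h hg1 i).aestronglyMeasurable).2
      (hY.integrable₂ h hg2 i)
  refine ⟨memLp_finsetSum _ fun i _ => hL i, ?_⟩
  rw [integral_sq_sum_eq ℱ hmeas hL fun i A hA => by
    rw [hY.setIntegral_step h hA hg1]; simp [hg0]]
  have p1 : PolyBdd fun d : ℕ => (d : ℝ) := by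
    simpa using polyBdd_pow (k := 1) (by norm_num)
  have hstep : ∀ i ∈ Finset.range n, ∫ ω, g (Y i ω) (Y (i + 1) ω) ^ 2 ∂μ ≤
      C * m ^ 2 * (1 + ∫ ω, (Y i ω : ℝ) ∂μ) := fun i _ => by
    have h1 := hY.setIntegral_step h (i := i) (A := univ) MeasurableSet.univ hg2
    simp only [Measure.restrict_univ] at h1
    have i1 := hY.integrable h p1 i
    rw [h1]
    have h2 := integral_mono (hY.integrable h (hg2.polyBdd_stepOp h) i)
      (((integrable_const (1 : ℝ)).add i1).const_mul (C * m ^ 2)) fun ω => hgv (Y i ω)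
    refine h2.trans_eq ?_
    rw [integral_const_mul]
    congr 1
    simp only [Pi.add_apply]
    rw [integral_add (integrable_const _) i1]
    simp
  refine (Finset.sum_le_sum hstep).trans ?_
  rw [← Finset.mul_sum, Finset.sum_add_distrib]
  have h3 := hD ℱ Y hY n hn
  have hlog := Real.log_nonneg hn1
  have h4 : (n : ℝ) + ∑ i ∈ Finset.range n, ∫ ω, (Y i ω : ℝ) ∂μ ≤
      (1 + D) * (n * (1 + Real.log n)) := by
    have : 0 ≤ n * Real.log n := by positivity
    linarith
  have h5 := mul_le_mul_of_nonneg_left h4 (show 0 ≤ C * m ^ 2 by positivity)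
  simp only [Finset.sum_const, Finset.card_range, nsmul_eq_mul, mul_one]
  linarith

end Chain

section Ergodic

/-- Indicator of `{z < a}`. -/
def below (a z : ℕ) : ℝ := if z < a then 1 else 0

lemma below_nonneg (a z : ℕ) : 0 ≤ below a z := by rw [below]; split_ifs <;> norm_num

lemma below_le_one (a z : ℕ) : below a z ≤ 1 := by rw [below]; split_ifs <;> norm_num

lemma antitone_below (a : ℕ) : Antitone (below a) := fun y z hyz => by
  simp only [below]; split_ifs <;> first | omega | norm_num

/-- Functions with values in `[0, 1]`. -/
def UnitBdd (φ : ℕ → ℝ) : Prop := ∀ z, 0 ≤ φ z ∧ φ z ≤ 1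

lemma UnitBdd.polyBdd {φ : ℕ → ℝ} (hφ : UnitBdd φ) : PolyBdd φ :=
  polyBdd_of_bdd (C := 1) fun z => by rw [abs_of_nonneg (hφ z).1]; exact (hφ z).2

lemma UnitBdd.stepOp (h : IsCoins M r) {φ : ℕ → ℝ} (hφ : UnitBdd φ) :
    UnitBdd (stepOp r φ) := fun z =>
  ⟨stepOp_nonneg h (fun d => (hφ d).1) z, by
    have := stepOp_mono h hφ.polyBdd.expBdd (expBdd_const 1) (fun d => (hφ d).2) z
    rwa [stepOp_const h] at this⟩

lemma antitone_stepOp (h : IsCoins M r) {φ : ℕ → ℝ} (hφ : ExpBdd φ) (ha : Antitone φ) :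
    Antitone (stepOp r φ) := antitone_nat_of_succ_le fun z => by
  have h1 := ev_le_ev_succ h (hφ.const_mul (-1)) (fun y z hyz => by
    have := ha hyz; simp only; linarith) (z + 1)
  rw [ev_const_mul, ev_const_mul] at h1
  simp only [stepOp]; linarith

lemma unitBdd_iterate (h : IsCoins M r) {φ : ℕ → ℝ} (hφ : UnitBdd φ) (l : ℕ) :
    UnitBdd ((stepOp r)^[l] φ) := by
  induction l with
  | zero => exact hφ
  | succ l ih => rw [Function.iterate_succ_apply']; exact ih.stepOp h

lemma antitone_iterate (h : IsCoins M r) {φ : ℕ → ℝ} (hφ : UnitBdd φ) (ha : Antitone φ)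
    (l : ℕ) : Antitone ((stepOp r)^[l] φ) := by
  induction l with
  | zero => exact ha
  | succ l ih =>
    rw [Function.iterate_succ_apply']
    exact antitone_stepOp h (unitBdd_iterate h hφ l).polyBdd.expBdd ih

lemma antitone_iterate_zero (h : IsCoins M r) {φ : ℕ → ℝ} (hφ : UnitBdd φ) (ha : Antitone φ) :
    Antitone fun l => (stepOp r)^[l] φ 0 := antitone_nat_of_succ_le fun l => by
  rw [Function.iterate_succ_apply']
  have := stepOp_mono h (unitBdd_iterate h hφ l).polyBdd.expBdd
    (expBdd_const ((stepOp r)^[l] φ 0)) (fun d => antitone_iterate h hφ ha l (Nat.zero_le d)) 0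
  rwa [stepOp_const h] at this

variable {Ω : Type*} {mΩ : MeasurableSpace Ω}

lemma IsChain.setIntegral_add {μ : Measure Ω} [IsProbabilityMeasure μ] {ℱ : Filtration ℕ mΩ}
    {Y : ℕ → Ω → ℕ} (h : IsCoins M r) (hY : IsChain r μ ℱ Y)
    {φ : ℕ → ℝ} (hφ : UnitBdd φ) {i : ℕ} {A : Set Ω} (hA : MeasurableSet[ℱ i] A) (l : ℕ) :
    ∫ ω in A, φ (Y (i + l) ω) ∂μ = ∫ ω in A, (stepOp r)^[l] φ (Y i ω) ∂μ := by
  induction l generalizing φ with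
  | zero => rfl
  | succ l ih =>
    rw [← add_assoc, hY.setIntegral_succ h hφ.polyBdd (ℱ.mono (by omega) A hA),
      ih (hφ.stepOp h), Function.iterate_succ_apply]

lemma mean_sq_below_le (h : IsCoins M r) (a : ℕ) (μ : Measure Ω) [IsProbabilityMeasure μ] {π : ℝ}
    (hπ0 : 0 ≤ π) (hπ : ∀ l, π ≤ (stepOp r)^[l] (below a) 0) (ℱ : Filtration ℕ mΩ)
    (Y : ℕ → Ω → ℕ) (hY : IsChain r μ ℱ Y) (n : ℕ) :
    ∫ ω, (∑ i ∈ Finset.range n, (below a (Y i ω) - π)) ^ 2 ∂μ ≤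
      2 * n * ∑ l ∈ Finset.range n, ((stepOp r)^[l] (below a) 0 - π) := by
  set p : ℕ → ℝ := fun l => (stepOp r)^[l] (below a) 0 with hp
  have hu : UnitBdd (below a) := fun z => ⟨below_nonneg a z, below_le_one a z⟩
  have ib : ∀ i, Integrable (fun ω => below a (Y i ω)) μ := fun i => hY.integrable h hu.polyBdd i
  have hmean : ∀ i, ∫ ω, below a (Y i ω) ∂μ = p i := fun i => by
    have := hY.setIntegral_add h hu (i := 0) (A := univ) MeasurableSet.univ i
    simpa [hY.init] using this
  have hp1 : ∀ l, p l ≤ 1 := fun l => (unitBdd_iterate h hu l 0).2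
  have iprod : ∀ i j, Integrable (fun ω => below a (Y i ω) * below a (Y j ω)) μ := fun i j => by
    refine (ib j).bdd_mul (c := 1) (ib i).aestronglyMeasurable (ae_of_all _ fun ω => ?_)
    rw [Real.norm_of_nonneg (below_nonneg _ _)]; exact below_le_one _ _
  have hprod : ∀ i l, ∫ ω, below a (Y i ω) * below a (Y (i + l) ω) ∂μ ≤ p i * p l := by
    intro i l
    set A : Set Ω := Y i ⁻¹' {z | z < a} with hA
    have hAm : MeasurableSet[ℱ i] A := (hY.adapted i) MeasurableSet.of_discrete
    have e : (fun ω => below a (Y i ω) * below a (Y (i + l) ω)) =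
        A.indicator fun ω => below a (Y (i + l) ω) := by
      ext ω; by_cases hω : ω ∈ A
      · rw [indicator_of_mem hω]; simp only [hA, mem_preimage, mem_ofPred_eq] at hω
        simp [below, hω]
      · rw [indicator_of_notMem hω]; simp only [hA, mem_preimage, mem_ofPred_eq] at hω
        simp [below, hω]
    rw [e, integral_indicator (ℱ.le i _ hAm), hY.setIntegral_add h hu hAm l]
    have h1 := setIntegral_mono_on (μ := μ) (s := A)
      (hY.integrable h (unitBdd_iterate h hu l).polyBdd i).integrableOn
      (integrable_const (p l)).integrableOn (ℱ.le i _ hAm)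
      (fun ω _ => antitone_iterate h hu (antitone_below a) l (Nat.zero_le (Y i ω)))
    rw [setIntegral_const, smul_eq_mul] at h1
    have h2 : μ.real A = p i := by
      rw [← hmean i, ← integral_indicator_one (ℱ.le i _ hAm)]
      congr 1; ext ω
      simp [below, hA, indicator_apply]
    rwa [h2] at h1
  have hcov : ∀ i l, ∫ ω, (below a (Y i ω) - π) * (below a (Y (i + l) ω) - π) ∂μ ≤ p l - π := by
    intro i l
    have e : (fun ω => (below a (Y i ω) - π) * (below a (Y (i + l) ω) - π)) =
        fun ω => below a (Y i ω) * below a (Y (i + l) ω) - π * below a (Y i ω) -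
          π * below a (Y (i + l) ω) + π ^ 2 := by ext ω; ring
    have i1 : Integrable (fun ω => below a (Y i ω) * below a (Y (i + l) ω) -
        π * below a (Y i ω)) μ := (iprod _ _).sub ((ib _).const_mul _)
    have i2 : Integrable (fun ω => below a (Y i ω) * below a (Y (i + l) ω) -
        π * below a (Y i ω) - π * below a (Y (i + l) ω)) μ := i1.sub ((ib _).const_mul _)
    rw [e, integral_add i2 (integrable_const _), integral_sub i1 ((ib _).const_mul _),
      integral_sub (iprod _ _) ((ib _).const_mul _), integral_const_mul,
      integral_const_mul, hmean, hmean]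
    simp only [integral_const, probReal_univ, one_smul]
    have k1 := hprod i l
    have k2 := hπ (i + l)
    have k3 := hπ l
    have k4 := hp1 i
    have k5 : p i * (p l - π) ≤ 1 * (p l - π) := mul_le_mul_of_nonneg_right k4 (sub_nonneg.2 k3)
    have k6 : π * (π - p (i + l)) ≤ 0 := mul_nonpos_of_nonneg_of_nonpos hπ0 (by linarith)
    linarith
  have icov : ∀ i j, Integrable (fun ω => (below a (Y i ω) - π) * (below a (Y j ω) - π)) μ := by
    intro i j
    have e : (fun ω => (below a (Y i ω) - π) * (below a (Y j ω) - π)) =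
        fun ω => below a (Y i ω) * below a (Y j ω) - π * below a (Y i ω) -
          π * below a (Y j ω) + π ^ 2 := by ext ω; ring
    rw [e]
    exact (((iprod _ _).sub ((ib _).const_mul _)).sub ((ib _).const_mul _)).add
      (integrable_const _)
  have key : ∀ n : ℕ, Integrable (fun ω => (∑ i ∈ Finset.range n, (below a (Y i ω) - π)) ^ 2) μ ∧
      ∫ ω, (∑ i ∈ Finset.range n, (below a (Y i ω) - π)) ^ 2 ∂μ ≤
        ∑ k ∈ Finset.range n, 2 * ∑ l ∈ Finset.range (k + 1), (p l - π) := by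
    intro n
    induction n with
    | zero => simp
    | succ n ih =>
      have e : (fun ω => (∑ i ∈ Finset.range (n + 1), (below a (Y i ω) - π)) ^ 2) =
          fun ω => (∑ i ∈ Finset.range n, (below a (Y i ω) - π)) ^ 2 +
            (2 * ∑ i ∈ Finset.range n, (below a (Y i ω) - π) * (below a (Y n ω) - π) +
              (below a (Y n ω) - π) * (below a (Y n ω) - π)) := by
        ext ω; rw [Finset.sum_range_succ, ← Finset.sum_mul]; ring
      have i1 : Integrable (fun ω => 2 * ∑ i ∈ Finset.range n,
          (below a (Y i ω) - π) * (below a (Y n ω) - π)) μ :=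
        (integrable_finsetSum _ fun i _ => icov i n).const_mul 2
      rw [e]
      refine ⟨ih.1.add (i1.add (icov n n)), ?_⟩
      have i2 : Integrable (fun ω => 2 * ∑ i ∈ Finset.range n,
          (below a (Y i ω) - π) * (below a (Y n ω) - π) +
            (below a (Y n ω) - π) * (below a (Y n ω) - π)) μ := i1.add (icov n n)
      rw [integral_add ih.1 i2, integral_add i1 (icov n n), integral_const_mul,
        integral_finsetSum _ fun i _ => icov i n, Finset.sum_range_succ _ n]
      refine add_le_add ih.2 ?_
      have h1 : ∑ i ∈ Finset.range n, ∫ ω, (below a (Y i ω) - π) * (below a (Y n ω) - π) ∂μ ≤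
          ∑ i ∈ Finset.range n, (p (n - i) - π) := Finset.sum_le_sum fun i hi => by
        have h2 := hcov i (n - i)
        rwa [Nat.add_sub_cancel' (Finset.mem_range.1 hi).le] at h2
      have h3 : ∑ i ∈ Finset.range n, (p (n - i) - π) = ∑ l ∈ Finset.range n, (p (l + 1) - π) := by
        rw [← Finset.sum_range_reflect]
        refine Finset.sum_congr rfl fun i hi => ?_
        have : n - (n - 1 - i) = i + 1 := by have := Finset.mem_range.1 hi; omega
        rw [this]
      have h4 := hcov n 0
      have h5 : 0 ≤ p 0 - π := sub_nonneg.2 (hπ 0)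
      rw [Finset.sum_range_succ']
      rw [h3] at h1
      simp only [add_zero] at h4
      linarith
  refine (key n).2.trans ?_
  rw [← Finset.mul_sum, mul_assoc]
  refine mul_le_mul_of_nonneg_left ?_ (by norm_num)
  have := Finset.sum_le_card_nsmul (Finset.range n)
    (fun k => ∑ l ∈ Finset.range (k + 1), (p l - π))
    (∑ l ∈ Finset.range n, (p l - π)) (fun k hk => by
      refine Finset.sum_le_sum_of_subset_of_nonneg ?_ fun l _ _ => sub_nonneg.2 (hπ l)
      intro l hl
      have := Finset.mem_range.1 hk
      have := Finset.mem_range.1 hl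
      exact Finset.mem_range.2 (by omega))
  simpa using this

/-- Law of large numbers for the occupation of `{z < a}`, uniformly over all chains. -/
lemma exists_lln_below (h : IsCoins M r) (a : ℕ) (μ : Measure Ω) [IsProbabilityMeasure μ] :
    ∃ (π : ℝ) (γ : ℕ → ℝ), Tendsto γ atTop (𝓝 0) ∧
      ∀ (ℱ : Filtration ℕ mΩ) (Y : ℕ → Ω → ℕ), IsChain r μ ℱ Y → ∀ n : ℕ,
        ∫ ω, |∑ i ∈ Finset.range n, (below a (Y i ω) - π)| ∂μ ≤ n * γ n := by
  have hu : UnitBdd (below a) := fun z => ⟨below_nonneg a z, below_le_one a z⟩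
  set p : ℕ → ℝ := fun l => (stepOp r)^[l] (below a) 0 with hp
  have hanti : Antitone p := antitone_iterate_zero h hu (antitone_below a)
  have hp0 : ∀ l, 0 ≤ p l := fun l => (unitBdd_iterate h hu l 0).1
  have hbdd : BddBelow (range p) := ⟨0, by rintro _ ⟨l, rfl⟩; exact hp0 l⟩
  set π := ⨅ l, p l with hπdef
  have hlim : Tendsto p atTop (𝓝 π) := tendsto_atTop_ciInf hanti hbdd
  have hπ : ∀ l, π ≤ p l := fun l => ciInf_le hbdd l
  have hπ0 : 0 ≤ π := le_ciInf hp0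
  refine ⟨π, fun n => √(2 * ((n : ℝ)⁻¹ * ∑ l ∈ Finset.range n, (p l - π))), ?_, ?_⟩
  · have h1 : Tendsto (fun l => p l - π) atTop (𝓝 0) := by simpa using hlim.sub_const π
    have h2 := (h1.cesaro.const_mul 2).sqrt
    simpa using h2
  · intro ℱ Y hY n
    have ib : ∀ i, MemLp (fun ω => below a (Y i ω) - π) 2 μ := fun i => by
      refine MemLp.of_bound ((hY.integrable h hu.polyBdd i).aestronglyMeasurable.sub
        aestronglyMeasurable_const) (1 + |π|) (ae_of_all _ fun ω => ?_)
      refine (norm_sub_le _ _).trans ?_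
      rw [Real.norm_of_nonneg (below_nonneg _ _)]
      exact add_le_add (below_le_one _ _) le_rfl
    have hS : MemLp (fun ω => ∑ i ∈ Finset.range n, (below a (Y i ω) - π)) 2 μ :=
      memLp_finsetSum _ fun i _ => ib i
    refine (integral_abs_le_sqrt hS).trans ?_
    rcases Nat.eq_zero_or_pos n with rfl | hn
    · simp
    have hn0 : (0 : ℝ) < n := by exact_mod_cast hn
    refine Real.sqrt_le_iff.2 ⟨by positivity, ?_⟩
    rw [mul_pow, Real.sq_sqrt (by
      have := Finset.sum_nonneg fun l (_ : l ∈ Finset.range n) => sub_nonneg.2 (hπ l)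
      positivity)]
    refine (mean_sq_below_le h a μ hπ0 hπ ℱ Y hY n).trans_eq ?_
    field_simp
    rfl

/-- Law of large numbers for a finitely supported observable. -/
lemma exists_lln (h : IsCoins M r) {b : ℕ → ℝ} (hb : ∀ z, M ≤ z → b z = 0) (μ : Measure Ω)
    [IsProbabilityMeasure μ] :
    ∃ (β : ℝ) (γ : ℕ → ℝ), Tendsto γ atTop (𝓝 0) ∧
      ∀ (ℱ : Filtration ℕ mΩ) (Y : ℕ → Ω → ℕ), IsChain r μ ℱ Y → ∀ n : ℕ,
        ∫ ω, |∑ i ∈ Finset.range n, b (Y i ω) - n * β| ∂μ ≤ n * γ n := by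
  choose π γ hγ hbound using fun a => exists_lln_below (mΩ := mΩ) h a μ
  refine ⟨∑ a ∈ Finset.range M, b a * (π (a + 1) - π a),
    fun n => ∑ a ∈ Finset.range M, |b a| * (γ (a + 1) n + γ a n), ?_, fun ℱ Y hY n => ?_⟩
  · have := tendsto_finsetSum (Finset.range M) fun a _ =>
      ((hγ (a + 1)).add (hγ a)).const_mul |b a|
    simpa using this
  · have hdecomp : ∀ z, b z = ∑ a ∈ Finset.range M, b a * (below (a + 1) z - below a z) := by
      intro z
      have e : ∀ a, below (a + 1) z - below a z = if a = z then 1 else 0 := fun a => by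
        simp only [below]; split_ifs <;> first | omega | norm_num
      simp only [e, mul_ite, mul_one, mul_zero, Finset.sum_ite_eq', Finset.mem_range]
      split_ifs with hz
      · rfl
      · exact hb z (not_lt.1 hz)
    set V : ℕ → Ω → ℝ := fun a ω => ∑ i ∈ Finset.range n, (below a (Y i ω) - π a) with hV
    have hVi : ∀ a, Integrable (V a) μ := fun a => integrable_finsetSum _ fun i _ =>
      (hY.integrable h (UnitBdd.polyBdd fun z => ⟨below_nonneg a z, below_le_one a z⟩) i).sub
        (integrable_const _)
    have e : ∀ ω, ∑ i ∈ Finset.range n, b (Y i ω) -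
        n * ∑ a ∈ Finset.range M, b a * (π (a + 1) - π a) =
          ∑ a ∈ Finset.range M, b a * (V (a + 1) ω - V a ω) := fun ω => by
      have h1 : ∑ i ∈ Finset.range n, b (Y i ω) = ∑ a ∈ Finset.range M,
          b a * ∑ i ∈ Finset.range n, (below (a + 1) (Y i ω) - below a (Y i ω)) := by
        rw [Finset.sum_congr rfl fun i _ => hdecomp (Y i ω), Finset.sum_comm]
        simp only [Finset.mul_sum]
      rw [h1, Finset.mul_sum, ← Finset.sum_sub_distrib]
      refine Finset.sum_congr rfl fun a _ => ?_
      simp only [hV, Finset.sum_sub_distrib, Finset.sum_const, Finset.card_range, nsmul_eq_mul]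
      ring
    simp only [e]
    have hle : ∀ ω, |∑ a ∈ Finset.range M, b a * (V (a + 1) ω - V a ω)| ≤
        ∑ a ∈ Finset.range M, |b a| * (|V (a + 1) ω| + |V a ω|) := fun ω => by
      refine (Finset.abs_sum_le_sum_abs _ _).trans (Finset.sum_le_sum fun a _ => ?_)
      rw [abs_mul]
      exact mul_le_mul_of_nonneg_left (abs_sub _ _) (abs_nonneg _)
    have hi : ∀ a, Integrable (fun ω => |b a| * (|V (a + 1) ω| + |V a ω|)) μ := fun a =>
      ((hVi (a + 1)).abs.add (hVi a).abs).const_mul _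
    refine (integral_mono (integrable_finsetSum _ fun a _ =>
      ((hVi (a + 1)).sub (hVi a)).const_mul (b a)).abs
      (integrable_finsetSum _ fun a _ => hi a) hle).trans ?_
    rw [integral_finsetSum _ fun a _ => hi a, Finset.mul_sum]
    refine Finset.sum_le_sum fun a _ => ?_
    rw [integral_const_mul, integral_add (hVi _).abs (hVi _).abs]
    have h1 := hbound (a + 1) ℱ Y hY n
    have h2 := hbound a ℱ Y hY n
    have := mul_le_mul_of_nonneg_left (add_le_add h1 h2) (abs_nonneg (b a))
    simp only [hV]
    linarith

end Ergodic

section Positive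

variable {Ω : Type*} {mΩ : MeasurableSpace Ω} {μ : Measure Ω} [IsProbabilityMeasure μ]
  {ℱ : Filtration ℕ mΩ} {Y : ℕ → Ω → ℕ}

lemma unitBdd_below (a : ℕ) : UnitBdd (below a) := fun z => ⟨below_nonneg a z, below_le_one a z⟩

lemma stepOp_below_one_pos (h : IsCoins M r) (z : ℕ) : 0 < stepOp r (below 1) z := by
  have e : ∀ d, negBin r 0 (z + 1) d * below 1 d = if d = 0 then negBin r 0 (z + 1) 0 else 0 := by
    intro d
    by_cases hd : d = 0
    · subst hd; simp [below]
    · simp [below, hd]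
  rw [stepOp, ev]
  simp only [e, tsum_ite_eq]
  exact negBin_zero_right_pos h 0 (z + 1)

lemma half_le_sum_below (h : IsCoins M r) (hY : IsChain r μ ℱ Y) (n : ℕ) :
    (n : ℝ) / 2 ≤ ∑ i ∈ Finset.range n, ∫ ω, below M (Y i ω) ∂μ := by
  have p1 : PolyBdd fun d : ℕ => (d : ℝ) := by simpa using polyBdd_pow (k := 1) (by norm_num)
  have pb : PolyBdd (below M) := (unitBdd_below M).polyBdd
  have pc : PolyBdd fun _ : ℕ => (-1 : ℝ) := polyBdd_of_bdd (C := 1) fun _ => by norm_num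
  have hstep : ∀ z : ℕ, stepOp r (fun d => (d : ℝ)) z ≤ z + (-1 + 2 * below M z) := fun z => by
    have e := stepOp_sub h p1.expBdd (expBdd_const (z : ℝ)) z
    rw [stepOp_const h] at e
    by_cases hz : z < M
    · have := stepOp_mean_sub_le h z
      simp only [below, if_pos hz]
      linarith
    · have := stepOp_mean h z (not_lt.1 hz)
      simp only [below, if_neg hz]
      linarith
  have h1 := hY.integral_sub_le h p1 (pc.add (pb.const_mul 2)) hstep n
  have h2 : 0 ≤ ∫ ω, (Y n ω : ℝ) ∂μ := integral_nonneg fun ω => Nat.cast_nonneg _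
  have e : ∀ i, ∫ ω, (-1 + 2 * below M (Y i ω)) ∂μ = -1 + 2 * ∫ ω, below M (Y i ω) ∂μ := by
    intro i
    rw [integral_add (integrable_const _) ((hY.integrable h pb i).const_mul 2),
      integral_const_mul]
    simp
  simp only [e, Finset.sum_add_distrib, ← Finset.mul_sum, Finset.sum_const, Finset.card_range,
    nsmul_eq_mul] at h1
  simp only [Nat.cast_zero] at h1
  linarith

lemma sum_below_one_ge (h : IsCoins M r) (hY : IsChain r μ ℱ Y) (n : ℕ) :
    stepOp r (below 1) M * (n / 2) - 1 ≤ ∑ i ∈ Finset.range n, ∫ ω, below 1 (Y i ω) ∂μ := by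
  have pb : ∀ a, PolyBdd (below a) := fun a => (unitBdd_below a).polyBdd
  set p₀ := stepOp r (below 1) M with hp₀
  have h1 : ∀ i, p₀ * ∫ ω, below M (Y i ω) ∂μ ≤ ∫ ω, below 1 (Y (i + 1) ω) ∂μ := fun i => by
    rw [hY.integral_succ h (pb 1), ← integral_const_mul]
    refine integral_mono ((hY.integrable h (pb M) i).const_mul p₀)
      (hY.integrable h ((pb 1).stepOp h) i) fun ω => ?_
    by_cases hz : Y i ω < M
    · simp only [below, if_pos hz, mul_one]
      exact antitone_stepOp h (pb 1).expBdd (antitone_below 1) hz.le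
    · simp only [below, if_neg hz, mul_zero]
      exact ((unitBdd_below 1).stepOp h (Y i ω)).1
  have h2 := Finset.sum_le_sum fun i (_ : i ∈ Finset.range n) => h1 i
  rw [← Finset.mul_sum] at h2
  have h3 := mul_le_mul_of_nonneg_left (half_le_sum_below h hY n) (stepOp_below_one_pos h M).le
  have h4 : ∑ i ∈ Finset.range n, ∫ ω, below 1 (Y (i + 1) ω) ∂μ + ∫ ω, below 1 (Y 0 ω) ∂μ =
      ∑ i ∈ Finset.range n, ∫ ω, below 1 (Y i ω) ∂μ + ∫ ω, below 1 (Y n ω) ∂μ := by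
    rw [← Finset.sum_range_succ]
    exact (Finset.sum_range_succ' (fun i => ∫ ω, below 1 (Y i ω) ∂μ) n).symm
  have h5 : ∀ i, 0 ≤ ∫ ω, below 1 (Y i ω) ∂μ ∧ ∫ ω, below 1 (Y i ω) ∂μ ≤ 1 := fun i =>
    ⟨integral_nonneg fun ω => below_nonneg _ _, by
      have := integral_mono (hY.integrable h (pb 1) i) (integrable_const (μ := μ) (1 : ℝ))
        fun ω => below_le_one 1 (Y i ω)
      simpa using this⟩
  linarith [(h5 0).2, (h5 n).1, (h5 0).1, (h5 n).2]

/-- The mean of the harmonic defect of `quad κ` under the limiting occupation law is positive. -/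
lemma mean_defect_pos (h : IsCoins M r) {κ : ℝ}
    (hκ : ∀ z : ℕ, M ≤ z → stepOp r (fun d => ((d : ℝ) - z) ^ 2) z = 2 * z + κ)
    (hY : IsChain r μ ℱ Y) {β : ℝ} {γ : ℕ → ℝ} (hγ : Tendsto γ atTop (𝓝 0))
    (hβ : ∀ n : ℕ, ∫ ω, |∑ i ∈ Finset.range n,
      (stepOp r (quad κ) (Y i ω) - quad κ (Y i ω)) - n * β| ∂μ ≤ n * γ n) : 0 < β := by
  obtain ⟨g, ⟨B, hB⟩, hsub, h0⟩ := exists_subharmonic h hκ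
  set ρ := stepOp r g 0 - g 0 with hρ
  have hρ0 : 0 < ρ := sub_pos.2 h0
  set p₀ := stepOp r (below 1) M with hp₀
  have hp₀0 : 0 < p₀ := stepOp_below_one_pos h M
  have pq : PolyBdd (quad κ) := polyBdd_quad κ
  have pg : PolyBdd g := by
    have := pq.add (polyBdd_of_bdd hB)
    simpa using this
  have pb : PolyBdd (below 1) := (unitBdd_below 1).polyBdd
  have pd : PolyBdd fun z => stepOp r (quad κ) z - quad κ z := (pq.stepOp h).sub pq
  have key : ∀ n : ℕ, g 0 + ρ * (p₀ * (n / 2) - 1) ≤ n * β + n * γ n + B := fun n => by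
    have e1 := hY.integral_eq_sum h pg n
    have e2 := hY.integral_eq_sum h pq n
    have i1 : Integrable (fun ω => ∑ i ∈ Finset.range n,
        (stepOp r (quad κ) (Y i ω) - quad κ (Y i ω))) μ :=
      integrable_finsetSum _ fun i _ => hY.integrable h pd i
    have h1 : ∫ ω, g (Y n ω) ∂μ ≤ ∫ ω, quad κ (Y n ω) ∂μ + B := by
      have := integral_mono (hY.integrable h pg n)
        ((hY.integrable h pq n).add (integrable_const B)) fun ω => by
          have := (abs_le.1 (hB (Y n ω))).2
          simp only [Pi.add_apply]; linarith
      refine this.trans_eq ?_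
      simp only [Pi.add_apply]
      rw [integral_add (hY.integrable h pq n) (integrable_const B)]
      simp
    have h2 : ∑ i ∈ Finset.range n, ∫ ω, (stepOp r (quad κ) (Y i ω) - quad κ (Y i ω)) ∂μ ≤
        n * β + n * γ n := by
      rw [← integral_finsetSum _ fun i _ => hY.integrable h pd i]
      have h3 : ∫ ω, (∑ i ∈ Finset.range n,
          (stepOp r (quad κ) (Y i ω) - quad κ (Y i ω)) - n * β) ∂μ ≤ n * γ n :=
        (integral_mono (i1.sub (integrable_const _)) (i1.sub (integrable_const _)).abs
          fun ω => le_abs_self _).trans (hβ n)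
      rw [integral_sub i1 (integrable_const _)] at h3
      simp only [integral_const, probReal_univ, one_smul] at h3
      linarith
    have h4 : ρ * ∑ i ∈ Finset.range n, ∫ ω, below 1 (Y i ω) ∂μ ≤
        ∑ i ∈ Finset.range n, ∫ ω, (stepOp r g (Y i ω) - g (Y i ω)) ∂μ := by
      rw [Finset.mul_sum]
      refine Finset.sum_le_sum fun i _ => ?_
      rw [← integral_const_mul]
      refine integral_mono ((hY.integrable h pb i).const_mul ρ)
        (hY.integrable h ((pg.stepOp h).sub pg) i) fun ω => ?_
      by_cases hz : Y i ω = 0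
      · simp [below, hz, hρ]
      · have := hsub (Y i ω)
        simp only [below, Nat.lt_one_iff, hz, if_false, mul_zero]
        linarith
    have h5 := mul_le_mul_of_nonneg_left (sum_below_one_ge h hY n) hρ0.le
    have h6 : quad κ 0 = 0 := by simp [quad]
    linarith
  have hlim : Tendsto (fun n : ℕ => β + γ n + (B - g 0 + ρ) / (n : ℝ)) atTop (𝓝 (β + 0 + 0)) :=
    (tendsto_const_nhds.add hγ).add (tendsto_const_div_atTop_nhds_zero_nat _)
  have hle : ρ * p₀ / 2 ≤ β + 0 + 0 := ge_of_tendsto hlim <| by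
    filter_upwards [eventually_ge_atTop 1] with n hn
    have hn0 : (0 : ℝ) < n := by exact_mod_cast hn
    have h1 : β + γ n + (B - g 0 + ρ) / n = (n * β + n * γ n + (B - g 0 + ρ)) / n := by
      field_simp
    rw [h1, le_div_iff₀ hn0]
    have := key n
    linarith
  have : 0 < ρ * p₀ / 2 := by positivity
  linarith

end Positive

section WeakLaw

lemma tendsto_sqrt_sqrt_mul_div (C : ℝ) :
    Tendsto (fun L : ℝ => √(C * √L * (1 + L)) / L) atTop (𝓝 0) := by
  have h1 : Tendsto (fun L : ℝ => (√L)⁻¹) atTop (𝓝 0) :=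
    tendsto_inv_atTop_zero.comp Real.tendsto_sqrt_atTop
  have h2 : Tendsto (fun L : ℝ => L⁻¹ + 1) atTop (𝓝 (0 + 1)) :=
    tendsto_inv_atTop_zero.add_const 1
  have h3 := (((h1.mul h2).const_mul C)).sqrt
  simp only [zero_mul, mul_zero, Real.sqrt_zero] at h3
  refine h3.congr' ?_
  filter_upwards [eventually_gt_atTop 0] with L hL
  have hs : √L * √L = L := Real.mul_self_sqrt hL.le
  have hs0 : 0 < √L := Real.sqrt_pos.2 hL
  have e : C * ((√L)⁻¹ * (L⁻¹ + 1)) = C * √L * (1 + L) / L ^ 2 := by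
    field_simp
    rw [Real.sq_sqrt hL.le]
  rw [e, Real.sqrt_div' _ (sq_nonneg L), Real.sqrt_sq hL.le]

lemma tendsto_one_add_div : Tendsto (fun L : ℝ => (1 + L) / L) atTop (𝓝 1) := by
  have h2 : Tendsto (fun L : ℝ => L⁻¹ + 1) atTop (𝓝 (0 + 1)) :=
    tendsto_inv_atTop_zero.add_const 1
  rw [zero_add] at h2
  refine h2.congr' ?_
  filter_upwards [eventually_gt_atTop 0] with L hL
  field_simp

lemma tendsto_log_div_self : Tendsto (fun L : ℝ => Real.log L / L) atTop (𝓝 0) := by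
  simpa using Real.isLittleO_log_id_atTop.tendsto_div_nhds_zero

variable {Ω : Type*} {mΩ : MeasurableSpace Ω}

/-- Weak law for the sum of a chain, uniformly over all chains: the sum of the first `n` terms is
about `β / 4 * (n * log n)`. -/
lemma exists_weak_law (h : IsCoins M r) (μ : Measure Ω) [IsProbabilityMeasure μ] :
    ∃ β : ℝ, (∀ (ℱ : Filtration ℕ mΩ) (Y : ℕ → Ω → ℕ), IsChain r μ ℱ Y → 0 < β) ∧
      ∀ ε : ℝ, 0 < ε → ∀ δ : ℝ, 0 < δ → ∀ᶠ n : ℕ in atTop,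
        ∀ (ℱ : Filtration ℕ mΩ) (Y : ℕ → Ω → ℕ), IsChain r μ ℱ Y →
          μ.real {ω | ε * (n * Real.log n) <
            |∑ i ∈ Finset.range n, (Y i ω : ℝ) - β / 4 * (n * Real.log n)|} ≤ δ := by
  obtain ⟨κ, hκ⟩ := stepOp_sq h
  set b : ℕ → ℝ := fun z => stepOp r (quad κ) z - quad κ z with hb
  obtain ⟨β, γ, hγ, hβ⟩ := exists_lln h (b := b)
    (fun z hz => sub_eq_zero.2 (stepOp_quad_eq h hκ hz)) μ
  refine ⟨β, fun ℱ Y hY => mean_defect_pos h hκ hY hγ (hβ ℱ Y hY), fun ε hε δ hδ => ?_⟩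
  obtain ⟨D, hD0, hD⟩ := sum_integral_le h μ
  obtain ⟨D', hD'0, hD'⟩ := measure_exists_gt_le h μ
  obtain ⟨C', hC'0, hC'⟩ := sq_sum_mgDiff_le h κ μ
  set η := ε * δ / (2 * (D + 1)) with hη
  have hη0 : 0 < η := by positivity
  obtain ⟨C, hC0, hC⟩ := stepOp_sqLog h hη0
  have hlog : Tendsto (fun n : ℕ => Real.log n) atTop atTop :=
    Real.tendsto_log_atTop.comp tendsto_natCast_atTop_atTop
  have hinvs : Tendsto (fun n : ℕ => (√(Real.log n))⁻¹) atTop (𝓝 0) :=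
    tendsto_inv_atTop_zero.comp (Real.tendsto_sqrt_atTop.comp hlog)
  have ev1 : ∀ᶠ n : ℕ in atTop, |β| / 8 * (Real.log (Real.log n) / Real.log n) +
      (1 + |κ|) * (√(Real.log n))⁻¹ < ε / 2 := by
    have := ((tendsto_log_div_self.comp hlog).const_mul (|β| / 8)).add
      (hinvs.const_mul (1 + |κ|))
    simp only [mul_zero, add_zero] at this
    exact this.eventually (gt_mem_nhds (by positivity))
  have ev2 : ∀ᶠ n : ℕ in atTop, D' * (√(Real.log n))⁻¹ + 2 / ε * (1 / 2 * γ n +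
      1 / 2 * (η * D * ((1 + Real.log n) / Real.log n) + C * (Real.log n)⁻¹) +
      √(C' * √(Real.log n) * (1 + Real.log n)) / Real.log n) < δ := by
    have := (hinvs.const_mul D').add ((((hγ.const_mul (1 / 2)).add
      ((((tendsto_one_add_div.comp hlog).const_mul (η * D)).add
        ((tendsto_inv_atTop_zero.comp hlog).const_mul C)).const_mul (1 / 2))).add
        ((tendsto_sqrt_sqrt_mul_div C').comp hlog)).const_mul (2 / ε))
    refine this.eventually (gt_mem_nhds ?_)
    have e : D' * 0 + 2 / ε * (1 / 2 * 0 + 1 / 2 * (η * D * 1 + C * 0) + 0) =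
        δ * (D / (2 * (D + 1))) := by rw [hη]; field_simp; ring
    rw [e]
    have : D / (2 * (D + 1)) < 1 := by rw [div_lt_one (by positivity)]; linarith
    nlinarith
  filter_upwards [ev1, ev2, hlog.eventually_ge_atTop 1, eventually_ge_atTop 1] with n h1 h2 hL hn
    ℱ Y hY
  set L := Real.log n with hLdef
  have hn1 : (1 : ℝ) ≤ n := by exact_mod_cast hn
  have hn0 : (0 : ℝ) < n := by linarith
  have hL0 : 0 < L := by linarith
  have hsL : 1 ≤ √L := Real.one_le_sqrt.2 hL
  have hsLL : √L * √L = L := Real.mul_self_sqrt hL0.le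
  set m := √(n * √L) with hm
  have hm2 : m ^ 2 = n * √L := Real.sq_sqrt (by positivity)
  have hm1 : 1 ≤ m := Real.one_le_sqrt.2 (by nlinarith)
  have hlogm : Real.log m = L / 2 + Real.log L / 4 := by
    rw [hm, Real.log_sqrt (by positivity), Real.log_mul hn0.ne' (by positivity),
      Real.log_sqrt hL0.le]
    ring
  have hloglog0 : 0 ≤ Real.log L := Real.log_nonneg hL
  have hloglog : Real.log L ≤ L := Real.log_le_self hL0.le
  obtain ⟨hNL, hN⟩ := hC' ℱ Y hY n m hn hm1
  set N : Ω → ℝ := fun ω => ∑ i ∈ Finset.range n, mgDiff r m (pot κ m) (Y i ω) (Y (i + 1) ω)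
    with hNdef
  set V : Ω → ℝ := fun ω => ∑ i ∈ Finset.range n, b (Y i ω) - n * β with hV
  have pd : PolyBdd b := ((polyBdd_quad κ).stepOp h).sub (polyBdd_quad κ)
  have p1 : PolyBdd fun d : ℕ => (d : ℝ) := by simpa using polyBdd_pow (k := 1) (by norm_num)
  have iV : Integrable V μ := (integrable_finsetSum _ fun i _ => hY.integrable h pd i).sub
    (integrable_const _)
  have iS : Integrable (fun ω => ∑ i ∈ Finset.range n, (Y i ω : ℝ)) μ :=
    integrable_finsetSum _ fun i _ => hY.integrable h p1 i
  have iN : Integrable N μ := hNL.integrable (by norm_num)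
  set R : Ω → ℝ := fun ω => L / 2 * |V ω| +
    (1 / 2 * (η * ∑ i ∈ Finset.range n, (Y i ω : ℝ) + C * n) + |N ω|) with hR
  have iT : Integrable (fun ω => 1 / 2 * (η * ∑ i ∈ Finset.range n, (Y i ω : ℝ) + C * n)) μ :=
    ((iS.const_mul η).add (integrable_const _)).const_mul _
  have iTN : Integrable
      (fun ω => 1 / 2 * (η * ∑ i ∈ Finset.range n, (Y i ω : ℝ) + C * n) + |N ω|) μ :=
    iT.add iN.abs
  have iR : Integrable R μ := (iV.abs.const_mul _).add iTN
  have hR0 : ∀ ω, 0 ≤ R ω := fun ω => by simp only [hR]; positivity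
  have hER : ∫ ω, R ω ∂μ ≤ n * L * (1 / 2 * γ n +
      1 / 2 * (η * D * ((1 + L) / L) + C * L⁻¹) + √(C' * √L * (1 + L)) / L) := by
    have e : ∫ ω, R ω ∂μ = L / 2 * ∫ ω, |V ω| ∂μ +
        (1 / 2 * (η * ∑ i ∈ Finset.range n, ∫ ω, (Y i ω : ℝ) ∂μ + C * n) + ∫ ω, |N ω| ∂μ) := by
      simp only [hR]
      rw [integral_add (iV.abs.const_mul _) iTN, integral_add iT iN.abs, integral_const_mul,
        integral_const_mul, integral_add (iS.const_mul η) (integrable_const _),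
        integral_const_mul, integral_finsetSum _ fun i _ => hY.integrable h p1 i]
      simp
    have k1 := mul_le_mul_of_nonneg_left (hβ ℱ Y hY n) (show 0 ≤ L / 2 by positivity)
    have k2 := mul_le_mul_of_nonneg_left (hD ℱ Y hY n hn) hη0.le
    have k3 : ∫ ω, |N ω| ∂μ ≤ n * √(C' * √L * (1 + L)) := by
      refine (integral_abs_le_sqrt hNL).trans ((Real.sqrt_le_sqrt hN).trans_eq ?_)
      rw [hm2, show C' * (n * √L) * (n * (1 + L)) = n ^ 2 * (C' * √L * (1 + L)) by ring,
        Real.sqrt_mul (sq_nonneg _), Real.sqrt_sq hn0.le]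
    have e2 : n * L * (1 / 2 * γ n +
        1 / 2 * (η * D * ((1 + L) / L) + C * L⁻¹) + √(C' * √L * (1 + L)) / L) =
        L / 2 * (n * γ n) + 1 / 2 * (η * (D * n * (1 + L)) + C * n) +
          n * √(C' * √L * (1 + L)) := by
      field_simp
    rw [e, e2]
    linarith
  have hsubset : {ω | ε * (n * L) < |∑ i ∈ Finset.range n, (Y i ω : ℝ) - β / 4 * (n * L)|} ⊆
      {ω | ∃ i ≤ n, m < Y i ω} ∪ {ω | ε / 2 * (n * L) ≤ R ω} := by
    intro ω hω
    simp only [mem_ofPred_eq] at hω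
    by_contra hcon
    simp only [mem_union, mem_ofPred_eq, not_or, not_exists, not_and, not_lt, not_le] at hcon
    obtain ⟨hgood, hRω⟩ := hcon
    have hpot0 : pot κ m 0 = 0 := by simp [pot, quad, sqLog]
    have htel : pot κ m (Y n ω) = N ω + ∑ i ∈ Finset.range n,
        (stepOp r (pot κ m) (Y i ω) - pot κ m (Y i ω)) := by
      have e1 : pot κ m (Y n ω) = ∑ i ∈ Finset.range n,
          (pot κ m (Y (i + 1) ω) - pot κ m (Y i ω)) := by
        rw [Finset.sum_range_sub (fun i => pot κ m (Y i ω)), hY.init, hpot0, sub_zero]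
      rw [e1, hNdef, ← Finset.sum_add_distrib]
      refine Finset.sum_congr rfl fun i hi => ?_
      rw [mgDiff, if_pos (hgood i (Finset.mem_range.1 hi).le)]
      ring
    have hdrift : ∀ z, stepOp r (pot κ m) z - pot κ m z =
        Real.log m / 2 * b z - z - (stepOp r sqLog z - sqLog z - 2 * z) / 2 := fun z => by
      rw [stepOp_pot h]; simp only [hb]; ring
    set E := ∑ i ∈ Finset.range n,
      (stepOp r sqLog (Y i ω) - sqLog (Y i ω) - 2 * (Y i ω : ℝ)) with hE
    have hEle : |E| ≤ η * ∑ i ∈ Finset.range n, (Y i ω : ℝ) + C * n := by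
      refine (Finset.abs_sum_le_sum_abs _ _).trans
        ((Finset.sum_le_sum fun i _ => hC (Y i ω)).trans_eq ?_)
      rw [Finset.sum_add_distrib, ← Finset.mul_sum]
      simp only [Finset.sum_const, Finset.card_range, nsmul_eq_mul]
      ring
    simp only [hdrift, Finset.sum_sub_distrib, ← Finset.mul_sum, ← Finset.sum_div] at htel
    have hE' : E = ∑ i ∈ Finset.range n, stepOp r sqLog (Y i ω) -
        ∑ i ∈ Finset.range n, sqLog (Y i ω) - 2 * ∑ i ∈ Finset.range n, (Y i ω : ℝ) := by
      rw [hE]; simp only [Finset.sum_sub_distrib, ← Finset.mul_sum]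
    rw [← hE'] at htel
    have hVω : ∑ i ∈ Finset.range n, b (Y i ω) = V ω + n * β := by simp only [hV]; ring
    rw [hVω] at htel
    have hS : ∑ i ∈ Finset.range n, (Y i ω : ℝ) - β / 4 * (n * L) =
        Real.log m / 2 * V ω + Real.log L / 8 * (n * β) - E / 2 + N ω - pot κ m (Y n ω) := by
      rw [htel, hlogm]; ring
    have hp := abs_pot_le (κ := κ) hm1 (hgood n le_rfl)
    rw [hm2] at hp
    have a1 : |Real.log m / 2 * V ω| ≤ L / 2 * |V ω| := by
      rw [abs_mul, abs_of_nonneg (by rw [hlogm]; positivity)]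
      exact mul_le_mul_of_nonneg_right (by rw [hlogm]; linarith) (abs_nonneg _)
    have a2 : |Real.log L / 8 * (n * β)| = |β| / 8 * (Real.log L / L) * (n * L) := by
      rw [abs_mul, abs_mul, abs_of_nonneg hn0.le, abs_of_nonneg (by positivity)]
      field_simp
    have a3 : (1 + |κ|) * (n * √L) = (1 + |κ|) * (√L)⁻¹ * (n * L) := by
      nth_rewrite 3 [← hsLL]
      field_simp
    have a4 : |E / 2| = |E| / 2 := by rw [abs_div, abs_two]
    have a5 := mul_lt_mul_of_pos_right h1 (show 0 < n * L by positivity)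
    have a6 : |∑ i ∈ Finset.range n, (Y i ω : ℝ) - β / 4 * (n * L)| ≤
        |Real.log m / 2 * V ω| + |Real.log L / 8 * (n * β)| + |E / 2| + |N ω| +
          |pot κ m (Y n ω)| := by
      rw [hS]
      exact (abs_sub _ _).trans (add_le_add_left ((abs_add_le _ _).trans
        (add_le_add_left ((abs_sub _ _).trans (add_le_add_left (abs_add_le _ _) _)) _)) _)
    simp only [hR] at hRω
    linarith
  have hbad := hD' ℱ Y hY n m (by linarith)
  rw [hm2, show D' * n / (n * √L) = D' * (√L)⁻¹ by field_simp] at hbad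
  have hmarkov : μ.real {ω | ε / 2 * (n * L) ≤ R ω} ≤ 2 / ε * (1 / 2 * γ n +
      1 / 2 * (η * D * ((1 + L) / L) + C * L⁻¹) + √(C' * √L * (1 + L)) / L) := by
    have k1 := mul_meas_ge_le_integral_of_nonneg (ae_of_all _ hR0) iR (ε / 2 * (n * L))
    have k2 := k1.trans hER
    have k3 : 0 < ε / 2 * (n * L) := by positivity
    rw [← mul_le_mul_iff_right₀ k3]
    refine k2.trans_eq ?_
    field_simp
  calc _ ≤ μ.real ({ω | ∃ i ≤ n, m < Y i ω} ∪ {ω | ε / 2 * (n * L) ≤ R ω}) :=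
        measureReal_mono hsubset
    _ ≤ _ := measureReal_union_le _ _
    _ ≤ _ := add_le_add hbad hmarkov
    _ ≤ δ := h2.le

end WeakLaw

section Hit

/-- In the sequence `s i, s (i + 1), …` exactly `d` failures precede the `u`-th success. -/
def hit (s : ℕ → Bool) : ℕ → ℕ → ℕ → Prop
  | _, 0, d => d = 0
  | i, u + 1, 0 => s i = true ∧ hit s (i + 1) u 0
  | i, u + 1, d + 1 => (s i = true ∧ hit s (i + 1) u (d + 1)) ∨
      (s i = false ∧ hit s (i + 1) (u + 1) d)
termination_by _ u d => u + d

/-- The number of successes among `s i, …, s (i + N - 1)`. -/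
def ones (s : ℕ → Bool) (i N : ℕ) : ℕ := ∑ j ∈ Finset.range N, if s (i + j) then 1 else 0

/-- The number of failures among `s i, …, s (i + N - 1)`. -/
def zeros (s : ℕ → Bool) (i N : ℕ) : ℕ := ∑ j ∈ Finset.range N, if s (i + j) then 0 else 1

lemma ones_succ' (s : ℕ → Bool) (i N : ℕ) :
    ones s i (N + 1) = ones s (i + 1) N + if s i then 1 else 0 := by
  rw [ones, Finset.sum_range_succ', ones]
  simp only [add_zero, add_assoc, add_comm 1]

lemma zeros_succ' (s : ℕ → Bool) (i N : ℕ) :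
    zeros s i (N + 1) = zeros s (i + 1) N + if s i then 0 else 1 := by
  rw [zeros, Finset.sum_range_succ', zeros]
  simp only [add_zero, add_assoc, add_comm 1]

lemma le_zeros_of_hit {s : ℕ → Bool} {u d : ℕ} : ∀ {i : ℕ}, hit s i u d →
    ∀ {N : ℕ}, u ≤ ones s i N → d ≤ zeros s i N := by
  induction u generalizing d with
  | zero => intro i hh N _; rw [hit] at hh; omega
  | succ u ihu =>
    induction d with
    | zero => intro i _ N _; exact Nat.zero_le _
    | succ d ihd =>
      intro i hh N hN
      rw [hit] at hh
      cases N with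
      | zero => simp [ones] at hN
      | succ N =>
        rw [ones_succ'] at hN
        rw [zeros_succ']
        rcases hh with ⟨hs, hh⟩ | ⟨hs, hh⟩
        · simp only [hs, if_true] at hN ⊢
          exact ihu hh (by omega)
        · simp only [hs, Bool.false_eq_true, if_false, add_zero] at hN ⊢
          have := ihd hh hN
          omega

lemma zeros_le_of_hit {s : ℕ → Bool} {u d : ℕ} : ∀ {i : ℕ}, hit s i u d →
    ∀ {N : ℕ}, ones s i N < u → zeros s i N ≤ d := by
  induction u generalizing d with
  | zero => intro i _ N hN; omega
  | succ u ihu =>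
    induction d with
    | zero =>
      intro i hh N hN
      rw [hit] at hh
      cases N with
      | zero => simp [zeros]
      | succ N =>
        rw [ones_succ'] at hN
        rw [zeros_succ']
        simp only [hh.1, if_true] at hN ⊢
        exact ihu hh.2 (by omega)
    | succ d ihd =>
      intro i hh N hN
      rw [hit] at hh
      cases N with
      | zero => simp [zeros]
      | succ N =>
        rw [ones_succ'] at hN
        rw [zeros_succ']
        rcases hh with ⟨hs, hh⟩ | ⟨hs, hh⟩
        · simp only [hs, if_true] at hN ⊢
          exact ihu hh (by omega)
        · simp only [hs, Bool.false_eq_true, if_false, add_zero] at hN ⊢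
          have := ihd hh hN
          omega

lemma hit_unique {s : ℕ → Bool} {u d : ℕ} : ∀ {i d' : ℕ}, hit s i u d → hit s i u d' → d = d' := by
  induction u generalizing d with
  | zero => intro i d' h1 h2; simp only [hit] at h1 h2; omega
  | succ u ihu =>
    induction d with
    | zero =>
      intro i d' h1 h2
      cases d' with
      | zero => rfl
      | succ d' =>
        simp only [hit] at h1 h2
        rcases h2 with ⟨_, h2⟩ | ⟨hs, _⟩
        · exact ihu h1.2 h2
        · simp [h1.1] at hs
    | succ d ihd =>
      intro i d' h1 h2
      cases d' with
      | zero =>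
        simp only [hit] at h1 h2
        rcases h1 with ⟨_, h1⟩ | ⟨hs, _⟩
        · exact ihu h1 h2.2
        · simp [h2.1] at hs
      | succ d' =>
        simp only [hit] at h1 h2
        rcases h1 with ⟨hs, h1⟩ | ⟨hs, h1⟩ <;> rcases h2 with ⟨hs', h2⟩ | ⟨hs', h2⟩
        · exact ihu h1 h2
        · simp [hs] at hs'
        · simp [hs] at hs'
        · rw [ihd h1 h2]

/-- The number of failures before the `u`-th success (and `0` if there is none). -/
def fails (s : ℕ → Bool) (u : ℕ) : ℕ := sInf {d | hit s 0 u d}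

lemma fails_eq_iff {s : ℕ → Bool} {u y : ℕ} :
    fails s u = y ↔ hit s 0 u y ∨ (y = 0 ∧ ∀ d, ¬ hit s 0 u d) := by
  by_cases hex : ∃ d, hit s 0 u d
  · obtain ⟨d, hd⟩ := hex
    have hf : hit s 0 u (fails s u) := Nat.sInf_mem (s := {d | hit s 0 u d}) ⟨d, hd⟩
    constructor
    · rintro rfl; exact Or.inl hf
    · rintro (hy | ⟨_, hn⟩)
      · exact hit_unique hf hy
      · exact absurd hd (hn d)
  · push Not at hex
    have h0 : fails s u = 0 := by
      have : {d | hit s 0 u d} = ∅ := by ext d; simp [hex d]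
      rw [fails, this, Nat.sInf_empty]
    rw [h0]
    constructor
    · rintro rfl; exact Or.inr ⟨rfl, hex⟩
    · rintro (hy | ⟨hy, _⟩)
      · exact absurd hy (hex y)
      · exact hy.symm

lemma fails_le_zeros {s : ℕ → Bool} {u N : ℕ} (hN : u ≤ ones s 0 N) :
    fails s u ≤ zeros s 0 N := by
  rcases fails_eq_iff.1 (rfl : fails s u = fails s u) with hh | ⟨h0, _⟩
  · exact le_zeros_of_hit hh hN
  · omega

lemma zeros_le_fails {s : ℕ → Bool} {u N : ℕ} (hex : ∃ d, hit s 0 u d) (hN : ones s 0 N < u) :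
    zeros s 0 N ≤ fails s u := by
  obtain ⟨d, hd⟩ := hex
  rw [fails_eq_iff.2 (Or.inl hd)]
  exact zeros_le_of_hit hd hN

end Hit

section CoinField

/-- A family of independent coins; coin number `j` of each site shows `true` with
probability `r j`. -/
structure IsCoinField (r : ℕ → ℝ) {Ω : Type*} {mΩ : MeasurableSpace Ω} (μ : Measure Ω)
    (ξ : ℤ × ℕ → Ω → Bool) : Prop where
  isProb : IsProbabilityMeasure μ
  meas : ∀ q, Measurable (ξ q)
  indep : iIndepFun ξ μ
  law : ∀ q, μ (ξ q ⁻¹' {true}) = ENNReal.ofReal (r q.2)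

lemma exists_isCoinField (h : IsCoins M r) :
    ∃ (μ : Measure (ℤ × ℕ → Bool)) (ξ : ℤ × ℕ → (ℤ × ℕ → Bool) → Bool), IsCoinField r μ ξ := by
  set ν : ℤ × ℕ → Measure Bool := fun q =>
    ENNReal.ofReal (r q.2) • Measure.dirac true + ENNReal.ofReal (1 - r q.2) • Measure.dirac false
    with hν
  have hprob : ∀ q, IsProbabilityMeasure (ν q) := fun q => ⟨by
    simp only [hν, Measure.coe_add, Measure.coe_smul, Pi.add_apply, Pi.smul_apply, measure_univ,
      smul_eq_mul, mul_one]
    rw [← ENNReal.ofReal_add (h.pos _).le (h.one_sub_pos _).le]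
    simp⟩
  refine ⟨Measure.infinitePi ν, fun q ω => ω q, inferInstance, fun q => measurable_pi_apply q,
    iIndepFun_infinitePi (X := fun _ b => b) fun q => measurable_id, fun q => ?_⟩
  rw [← Measure.map_apply (measurable_pi_apply q) (measurableSet_singleton _),
    Measure.infinitePi_map_eval]
  simp [hν]

variable {Ω : Type*} {mΩ : MeasurableSpace Ω} {μ : Measure Ω} {ξ : ℤ × ℕ → Ω → Bool}

/-- The σ-algebra generated by the coins in `S`. -/
@[reducible] def sig (ξ : ℤ × ℕ → Ω → Bool) (S : Set (ℤ × ℕ)) : MeasurableSpace Ω :=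
  ⨆ q ∈ S, MeasurableSpace.comap (ξ q) inferInstance

lemma sig_mono {S T : Set (ℤ × ℕ)} (hST : S ⊆ T) : sig ξ S ≤ sig ξ T :=
  biSup_mono hST

lemma measurable_coin {S : Set (ℤ × ℕ)} {q : ℤ × ℕ} (hq : q ∈ S) : Measurable[sig ξ S] (ξ q) :=
  measurable_iff_comap_le.2 (le_biSup (fun q => MeasurableSpace.comap (ξ q) inferInstance) hq)

lemma IsCoinField.sig_le (hξ : IsCoinField r μ ξ) (S : Set (ℤ × ℕ)) : sig ξ S ≤ mΩ :=
  iSup₂_le fun q _ => measurable_iff_comap_le.1 (hξ.meas q)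

lemma IsCoinField.measure_inter (hξ : IsCoinField r μ ξ) {S T : Set (ℤ × ℕ)} (hST : Disjoint S T)
    {A B : Set Ω} (hA : MeasurableSet[sig ξ S] A) (hB : MeasurableSet[sig ξ T] B) :
    μ (A ∩ B) = μ A * μ B :=
  (Indep_iff _ _ _).1 (indep_iSup_of_disjoint
    (fun q => measurable_iff_comap_le.1 (hξ.meas q))
    ((iIndepFun_iff_iIndep _ _ _).1 hξ.indep) hST) A B hA hB

lemma IsCoinField.law_false (hξ : IsCoinField r μ ξ) (h : IsCoins M r) (q : ℤ × ℕ) :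
    μ (ξ q ⁻¹' {false}) = ENNReal.ofReal (1 - r q.2) := by
  have := hξ.isProb
  have e : ξ q ⁻¹' {false} = (ξ q ⁻¹' {true})ᶜ := by ext ω; simp
  rw [e, prob_compl_eq_one_sub (hξ.meas q (measurableSet_singleton _)), hξ.law,
    ENNReal.ofReal_sub _ (h.pos _).le, ENNReal.ofReal_one]

/-- The coins number `i, i + 1, …` of site `k`. -/
def siteFrom (k : ℤ) (i : ℕ) : Set (ℤ × ℕ) := {q | q.1 = k ∧ i ≤ q.2}

lemma siteFrom_succ_subset (k : ℤ) (i : ℕ) : siteFrom k (i + 1) ⊆ siteFrom k i :=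
  fun _ hq => ⟨hq.1, by have := hq.2; omega⟩

lemma measurableSet_coin (b : Bool) {S : Set (ℤ × ℕ)} {q : ℤ × ℕ} (hq : q ∈ S) :
    MeasurableSet[sig ξ S] {ω | ξ q ω = b} :=
  measurable_coin hq (measurableSet_singleton b)

lemma measurableSet_hit (k : ℤ) (u d : ℕ) : ∀ i : ℕ,
    MeasurableSet[sig ξ (siteFrom k i)] {ω | hit (fun j => ξ (k, j) ω) i u d} := by
  induction u generalizing d with
  | zero => intro i; simp [hit]
  | succ u ihu =>
    have hmem : ∀ i, (k, i) ∈ siteFrom k i := fun i => ⟨rfl, le_rfl⟩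
    induction d with
    | zero =>
      intro i
      simp only [hit]
      exact (measurableSet_coin true (hmem i)).inter (sig_mono (siteFrom_succ_subset k i) _ (ihu 0 _))
    | succ d ihd =>
      intro i
      simp only [hit]
      exact ((measurableSet_coin true (hmem i)).inter
        (sig_mono (siteFrom_succ_subset k i) _ (ihu _ _))).union
        ((measurableSet_coin false (hmem i)).inter (sig_mono (siteFrom_succ_subset k i) _ (ihd _)))

lemma IsCoinField.measure_hit (hξ : IsCoinField r μ ξ) (h : IsCoins M r) (k : ℤ) (u d : ℕ) :
    ∀ i : ℕ, μ {ω | hit (fun j => ξ (k, j) ω) i u d} = ENNReal.ofReal (negBin r i u d) := by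
  have := hξ.isProb
  have hstep : ∀ (b : Bool) (i u d : ℕ),
      μ ({ω | ξ (k, i) ω = b} ∩ {ω | hit (fun j => ξ (k, j) ω) (i + 1) u d}) =
        μ {ω | ξ (k, i) ω = b} * μ {ω | hit (fun j => ξ (k, j) ω) (i + 1) u d} :=
    fun b i u d => by
      refine hξ.measure_inter (S := {(k, i)}) (T := siteFrom k (i + 1)) ?_
        (measurableSet_coin b rfl) (measurableSet_hit k u d _)
      rw [Set.disjoint_singleton_left]
      exact fun hq => absurd hq.2 (by simp)
  have ht : ∀ i, μ {ω | ξ (k, i) ω = true} = ENNReal.ofReal (r i) := fun i => hξ.law (k, i)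
  have hf : ∀ i, μ {ω | ξ (k, i) ω = false} = ENNReal.ofReal (1 - r i) := fun i =>
    hξ.law_false h (k, i)
  induction u generalizing d with
  | zero =>
    intro i
    by_cases hd : d = 0 <;> simp [hit, negBin_zero, hd]
  | succ u ihu =>
    induction d with
    | zero =>
      intro i
      have e : {ω | hit (fun j => ξ (k, j) ω) i (u + 1) 0} = {ω | ξ (k, i) ω = true} ∩
          {ω | hit (fun j => ξ (k, j) ω) (i + 1) u 0} := by ext ω; simp only [hit]; rfl
      rw [e, hstep, ht, ihu, negBin_succ_zero, ENNReal.ofReal_mul (h.pos i).le]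
    | succ d ihd =>
      intro i
      have e : {ω | hit (fun j => ξ (k, j) ω) i (u + 1) (d + 1)} =
          ({ω | ξ (k, i) ω = true} ∩ {ω | hit (fun j => ξ (k, j) ω) (i + 1) u (d + 1)}) ∪
          ({ω | ξ (k, i) ω = false} ∩ {ω | hit (fun j => ξ (k, j) ω) (i + 1) (u + 1) d}) := by
        ext ω; simp only [hit]; rfl
      have hdisj : Disjoint
          ({ω | ξ (k, i) ω = true} ∩ {ω | hit (fun j => ξ (k, j) ω) (i + 1) u (d + 1)})
          ({ω | ξ (k, i) ω = false} ∩ {ω | hit (fun j => ξ (k, j) ω) (i + 1) (u + 1) d}) := by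
        rw [Set.disjoint_left]
        rintro ω ⟨h1, _⟩ ⟨h2, _⟩
        have h1' : ξ (k, i) ω = true := h1
        have h2' : ξ (k, i) ω = false := h2
        simp [h1'] at h2'
      rw [e, measure_union hdisj (((hξ.meas _) (measurableSet_singleton false)).inter
        (hξ.sig_le _ _ (measurableSet_hit k _ _ _))), hstep, hstep, ht, hf, ihu, ihd,
        negBin_succ_succ, ENNReal.ofReal_add (mul_nonneg (h.pos i).le (negBin_nonneg h _ _ _))
          (mul_nonneg (h.one_sub_pos i).le (negBin_nonneg h _ _ _)),
        ENNReal.ofReal_mul (h.pos i).le, ENNReal.ofReal_mul (h.one_sub_pos i).le]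

lemma IsCoinField.ae_exists_hit (hξ : IsCoinField r μ ξ) (h : IsCoins M r) (k : ℤ) (u : ℕ) :
    ∀ᵐ ω ∂μ, ∃ d, hit (fun j => ξ (k, j) ω) 0 u d := by
  have := hξ.isProb
  have hm : ∀ d, MeasurableSet {ω | hit (fun j => ξ (k, j) ω) 0 u d} := fun d =>
    hξ.sig_le _ _ (measurableSet_hit k u d 0)
  have h1 : μ (⋃ d, {ω | hit (fun j => ξ (k, j) ω) 0 u d}) = 1 := by
    rw [measure_iUnion (fun d d' hdd => ?_) hm]
    · simp only [hξ.measure_hit h]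
      have hs : Summable fun d => negBin r 0 u d := by
        simpa using (expBdd_const 1).summable h 0 u
      rw [← ENNReal.ofReal_tsum_of_nonneg (fun d => negBin_nonneg h _ _ _) hs]
      have : ev r 0 u (fun _ => 1) = 1 := ev_const h 1 u
      simp only [ev, mul_one] at this
      rw [this, ENNReal.ofReal_one]
    · simp only [Function.onFun, Set.disjoint_left]
      exact fun ω h1 h2 => hdd (hit_unique h1 h2)
  have h2 := (mem_ae_iff_prob_eq_one (μ := μ) (MeasurableSet.iUnion hm)).2 h1
  filter_upwards [h2] with ω hω
  simpa using hω

lemma measurableSet_fails (k : ℤ) (u y : ℕ) :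
    MeasurableSet[sig ξ (siteFrom k 0)] {ω | fails (fun j => ξ (k, j) ω) u = y} := by
  have h1 := fun d => measurableSet_hit (ξ := ξ) k u d 0
  by_cases hy : y = 0
  · have e : {ω | fails (fun j => ξ (k, j) ω) u = y} =
        {ω | hit (fun j => ξ (k, j) ω) 0 u 0} ∪
          ⋂ d, {ω | hit (fun j => ξ (k, j) ω) 0 u d}ᶜ := by
      ext ω; simp [fails_eq_iff, hy]
    rw [e]
    exact (h1 0).union (MeasurableSet.iInter fun d => (h1 d).compl)
  · simp only [fails_eq_iff, hy, false_and, or_false]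
    exact h1 y

lemma IsCoinField.measure_fails (hξ : IsCoinField r μ ξ) (h : IsCoins M r) (k : ℤ) (u y : ℕ) :
    μ {ω | fails (fun j => ξ (k, j) ω) u = y} = ENNReal.ofReal (negBin r 0 u y) := by
  rw [← hξ.measure_hit h k]
  refine measure_congr ?_
  filter_upwards [hξ.ae_exists_hit h k u] with ω ⟨d, hd⟩
  refine propext (fails_eq_iff.trans ⟨?_, Or.inl⟩)
  rintro (h1 | ⟨_, h1⟩)
  · exact h1
  · exact absurd hd (h1 d)

/-- The generation sizes read off the sites `n - 1, n - 2, …`, with immigration `a`. -/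
def branch (ξ : ℤ × ℕ → Ω → Bool) (a : ℕ → ℕ) (n : ℕ) : ℕ → Ω → ℕ
  | 0, _ => 0
  | i + 1, ω => fails (fun j => ξ ((n : ℤ) - (i + 1), j) ω) (branch ξ a n i ω + a i)

/-- The σ-algebras of the coins at the sites `n - i` and above. -/
def siteFiltration (hξ : IsCoinField r μ ξ) (n : ℕ) : Filtration ℕ mΩ where
  seq i := sig ξ {q | (n : ℤ) - i ≤ q.1}
  mono' i j hij := sig_mono fun q (hq : (n : ℤ) - i ≤ q.1) => by
    change (n : ℤ) - j ≤ q.1; omega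
  le' i := hξ.sig_le _

lemma measurable_branch (hξ : IsCoinField r μ ξ) (a : ℕ → ℕ) (n i : ℕ) :
    Measurable[siteFiltration hξ n i] (branch ξ a n i) := by
  induction i with
  | zero => exact measurable_const
  | succ i ih =>
    refine @measurable_to_countable' _ _ _ _ (siteFiltration hξ n (i + 1)) _ fun y => ?_
    have e : branch ξ a n (i + 1) ⁻¹' {y} = ⋃ z, branch ξ a n i ⁻¹' {z} ∩
        {ω | fails (fun j => ξ ((n : ℤ) - (i + 1), j) ω) (z + a i) = y} := by
      ext ω; simp [branch]
    rw [e]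
    refine MeasurableSet.iUnion fun z => ?_
    refine ((siteFiltration hξ n).mono (Nat.le_succ i) _ (ih (measurableSet_singleton z))).inter ?_
    refine sig_mono ?_ _ (measurableSet_fails _ _ _)
    rintro q ⟨hq, _⟩
    simp [hq]

lemma measure_branch (hξ : IsCoinField r μ ξ) (h : IsCoins M r) (a : ℕ → ℕ) (n i : ℕ) {A : Set Ω}
    (hA : MeasurableSet[siteFiltration hξ n i] A) (z y : ℕ) :
    μ (A ∩ branch ξ a n i ⁻¹' {z} ∩ branch ξ a n (i + 1) ⁻¹' {y}) =
      ENNReal.ofReal (negBin r 0 (z + a i) y) * μ (A ∩ branch ξ a n i ⁻¹' {z}) := by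
  have e : A ∩ branch ξ a n i ⁻¹' {z} ∩ branch ξ a n (i + 1) ⁻¹' {y} =
      A ∩ branch ξ a n i ⁻¹' {z} ∩
        {ω | fails (fun j => ξ ((n : ℤ) - (i + 1), j) ω) (z + a i) = y} := by
    ext ω
    simp only [branch, mem_inter_iff, mem_preimage, mem_singleton_iff, mem_ofPred_eq, and_assoc,
      and_congr_right_iff]
    intro _ h2
    rw [h2]
  rw [e, hξ.measure_inter (S := {q | (n : ℤ) - i ≤ q.1}) (T := siteFrom ((n : ℤ) - (i + 1)) 0) ?_
    (hA.inter (measurable_branch hξ a n i (measurableSet_singleton z))) (measurableSet_fails _ _ _),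
    hξ.measure_fails h, mul_comm]
  rw [Set.disjoint_left]
  rintro q hq ⟨h1, _⟩
  simp only [mem_ofPred_eq] at hq
  omega

lemma isChain_branch (hξ : IsCoinField r μ ξ) (h : IsCoins M r) (n : ℕ) :
    IsChain r μ (siteFiltration hξ n) (branch ξ (fun _ => 1) n) where
  init _ := rfl
  adapted := measurable_branch hξ _ n
  markov i _ hA z y := measure_branch hξ h _ n i hA z y

lemma branch_congr {a a' : ℕ → ℕ} {n m : ℕ} (haa : ∀ i < m, a i = a' i) (ω : Ω) {i : ℕ}
    (hi : i ≤ m) : branch ξ a n i ω = branch ξ a' n i ω := by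
  induction i with
  | zero => rfl
  | succ i ih => simp only [branch]; rw [ih (by omega), haa i (by omega)]

lemma lintegral_branch_succ_le (hξ : IsCoinField r μ ξ) (h : IsCoins M r) {a : ℕ → ℕ} {n i : ℕ}
    (hai : a i = 0) :
    ∫⁻ ω, (branch ξ a n (i + 1) ω : ℝ≥0∞) ∂μ ≤ ∫⁻ ω, (branch ξ a n i ω : ℝ≥0∞) ∂μ := by
  have m1 : Measurable (branch ξ a n i) :=
    (measurable_branch hξ a n i).mono ((siteFiltration hξ n).le i) le_rfl
  have m2 : Measurable (branch ξ a n (i + 1)) :=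
    (measurable_branch hξ a n (i + 1)).mono ((siteFiltration hξ n).le _) le_rfl
  have e1 : ∫⁻ ω, (branch ξ a n (i + 1) ω : ℝ≥0∞) ∂μ =
      ∫⁻ q : ℕ × ℕ, (q.2 : ℝ≥0∞) ∂μ.map fun ω => (branch ξ a n i ω, branch ξ a n (i + 1) ω) := by
    rw [lintegral_map (measurable_of_countable _) (m1.prodMk m2)]
  have e2 : ∫⁻ ω, (branch ξ a n i ω : ℝ≥0∞) ∂μ = ∫⁻ z : ℕ, (z : ℝ≥0∞) ∂μ.map (branch ξ a n i) := by
    rw [lintegral_map (measurable_of_countable _) m1]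
  rw [e1, e2, lintegral_countable', lintegral_countable', ENNReal.tsum_prod']
  refine ENNReal.tsum_le_tsum fun z => ?_
  have e3 : ∀ y, (μ.map fun ω => (branch ξ a n i ω, branch ξ a n (i + 1) ω)) {(z, y)} =
      ENNReal.ofReal (negBin r 0 z y) * μ.map (branch ξ a n i) {z} := fun y => by
    rw [Measure.map_apply (m1.prodMk m2) (measurableSet_singleton _),
      Measure.map_apply m1 (measurableSet_singleton _)]
    have := measure_branch hξ h a n i MeasurableSet.univ z y
    rw [hai, add_zero] at this
    simp only [univ_inter] at this
    rw [← this]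
    congr 1
    ext ω; simp [Prod.ext_iff]
  simp only [e3]
  have hid : ExpBdd fun d : ℕ => (d : ℝ) := by
    simpa using (polyBdd_pow (k := 1) (by norm_num)).expBdd
  have e4 : ∑' y : ℕ, (y : ℝ≥0∞) * ENNReal.ofReal (negBin r 0 z y) ≤ z := by
    have e5 : ∀ y : ℕ, (y : ℝ≥0∞) * ENNReal.ofReal (negBin r 0 z y) =
        ENNReal.ofReal (negBin r 0 z y * y) := fun y => by
      rw [ENNReal.ofReal_mul (negBin_nonneg h _ _ _), ENNReal.ofReal_natCast, mul_comm]
    simp only [e5]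
    rw [← ENNReal.ofReal_tsum_of_nonneg
      (fun y => mul_nonneg (negBin_nonneg h _ _ _) (Nat.cast_nonneg _)) (hid.summable h 0 z)]
    refine (ENNReal.ofReal_le_ofReal (stepOp_mean_le h z)).trans_eq ?_
    rw [ENNReal.ofReal_natCast]
  simp only [← mul_assoc]
  rw [ENNReal.tsum_mul_right]
  exact mul_le_mul_left e4 _

end CoinField

section Walk

/-- Position of the walker driven by the coins `s`, and the number of earlier visits to each
site. -/
def state (s : ℤ × ℕ → Bool) : ℕ → ℤ × (ℤ → ℕ)
  | 0 => (0, fun _ => 0)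
  | n + 1 => ((state s n).1 + if s ((state s n).1, (state s n).2 (state s n).1) then 1 else -1,
      Function.update (state s n).2 (state s n).1 ((state s n).2 (state s n).1 + 1))

/-- Position of the walker at time `n`. -/
def pos (s : ℤ × ℕ → Bool) (n : ℕ) : ℤ := (state s n).1

/-- Number of visits to `k` before time `n`. -/
def cnt (s : ℤ × ℕ → Bool) (n : ℕ) (k : ℤ) : ℕ := (state s n).2 k

/-- Number of steps to the right from `k` before time `n`. -/
def ups (s : ℤ × ℕ → Bool) (n : ℕ) (k : ℤ) : ℕ := ones (fun j => s (k, j)) 0 (cnt s n k)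

/-- Number of steps to the left from `k` before time `n`. -/
def downs (s : ℤ × ℕ → Bool) (n : ℕ) (k : ℤ) : ℕ := zeros (fun j => s (k, j)) 0 (cnt s n k)

variable (s : ℤ × ℕ → Bool)

lemma pos_zero : pos s 0 = 0 := rfl

lemma pos_succ (n : ℕ) :
    pos s (n + 1) = pos s n + if s (pos s n, cnt s n (pos s n)) then 1 else -1 := rfl

lemma cnt_succ (n : ℕ) (k : ℤ) :
    cnt s (n + 1) k = cnt s n k + if pos s n = k then 1 else 0 := by
  simp only [cnt, state, pos, Function.update_apply]
  by_cases hk : (state s n).1 = k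
  · simp [hk]
  · simp [hk, Ne.symm hk]

lemma cnt_eq_card (n : ℕ) (k : ℤ) :
    cnt s n k = ((Finset.range n).filter fun i => pos s i = k).card := by
  induction n with
  | zero => simp [cnt, state]
  | succ n ih =>
    rw [cnt_succ, ih, Finset.range_add_one, Finset.filter_insert]
    split_ifs with hk
    · rw [Finset.card_insert_of_notMem (by simp)]
    · simp

lemma ups_add_downs (n : ℕ) (k : ℤ) : ups s n k + downs s n k = cnt s n k := by
  rw [ups, downs, ones, zeros, ← Finset.sum_add_distrib]
  simp only [zero_add]
  refine (Finset.sum_congr rfl fun j _ => ?_).trans (Finset.card_eq_sum_ones _).symm |>.trans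
    (Finset.card_range _)
  split_ifs <;> rfl

lemma ups_succ (n : ℕ) (k : ℤ) :
    ups s (n + 1) k = ups s n k + if pos s n = k ∧ s (k, cnt s n k) then 1 else 0 := by
  rw [ups, cnt_succ, ups]
  by_cases hk : pos s n = k
  · simp only [hk, if_true, ones, Finset.sum_range_succ, zero_add, true_and]
  · simp [hk]

lemma downs_succ (n : ℕ) (k : ℤ) :
    downs s (n + 1) k = downs s n k + if pos s n = k ∧ ¬ s (k, cnt s n k) then 1 else 0 := by
  rw [downs, cnt_succ, downs]
  by_cases hk : pos s n = k
  · simp only [hk, if_true, zeros, Finset.sum_range_succ, zero_add, true_and]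
    congr 1
    by_cases hs : s (k, cnt s n k) <;> simp [hs]
  · simp [hk]

/-- Balance of the crossings of the edge between `k` and `k + 1`. -/
lemma ups_sub_downs (n : ℕ) (k : ℤ) :
    (ups s n k : ℤ) + (if k < 0 then 1 else 0) =
      downs s n (k + 1) + if k < pos s n then 1 else 0 := by
  induction n with
  | zero => simp [ups, downs, cnt, state, ones, zeros, pos_zero]; rfl
  | succ n ih =>
    rw [ups_succ, downs_succ, pos_succ]
    push_cast
    have e1 : (pos s n = k ∧ s (k, cnt s n k) = true) ↔
        (pos s n = k ∧ s (pos s n, cnt s n (pos s n)) = true) :=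
      and_congr_right fun h => by rw [h]
    have e2 : (pos s n = k + 1 ∧ ¬ s (k + 1, cnt s n (k + 1)) = true) ↔
        (pos s n = k + 1 ∧ ¬ s (pos s n, cnt s n (pos s n)) = true) :=
      and_congr_right fun h => by rw [h]
    simp only [e1, e2]
    generalize s (pos s n, cnt s n (pos s n)) = b
    cases b <;> simp only [Bool.false_eq_true, and_false, not_true, not_false_eq_true, and_true,
      if_true, if_false] <;> split_ifs at ih ⊢ <;> omega

lemma sum_cnt_le (i : ℕ) (S : Finset ℤ) : ∑ k ∈ S, cnt s i k ≤ i := by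
  induction i with
  | zero => simp [cnt, state]
  | succ i ih =>
    simp only [cnt_succ, Finset.sum_add_distrib, Finset.sum_ite_eq]
    split_ifs <;> omega

lemma sum_cnt_eq {i : ℕ} {S : Finset ℤ} (hS : ∀ j < i, pos s j ∈ S) :
    ∑ k ∈ S, cnt s i k = i := by
  induction i with
  | zero => simp [cnt, state]
  | succ i ih =>
    simp only [cnt_succ, Finset.sum_add_distrib, Finset.sum_ite_eq]
    rw [ih fun j hj => hS j (by omega), if_pos (hS i (by omega))]

/-- The sites `n - 1, …, n - m`. -/
def sitesBelow (n m : ℕ) : Finset ℤ := (Finset.range m).image fun j : ℕ => (n : ℤ) - (j + 1)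

lemma sum_sitesBelow (n m : ℕ) (f : ℤ → ℕ) :
    ∑ k ∈ sitesBelow n m, f k = ∑ j ∈ Finset.range m, f ((n : ℤ) - (j + 1)) := by
  rw [sitesBelow, Finset.sum_image]
  intro a _ b _ hab
  simp only at hab
  omega

end Walk

section Paths

variable {Ω : Type*} {mΩ : MeasurableSpace Ω} {μ : Measure Ω} {ξ : ℤ × ℕ → Ω → Bool}

/-- The walk driven by the coins `ξ`. -/
def walk (ξ : ℤ × ℕ → Ω → Bool) (n : ℕ) (ω : Ω) : ℤ := pos (fun q => ξ q ω) n

lemma branch_le_downs {n i : ℕ} {ω : Ω} (hi : walk ξ i ω = n) {j : ℕ} (hj : j ≤ n) :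
    branch ξ (fun _ => 1) n j ω ≤ downs (fun q => ξ q ω) i ((n : ℤ) - j) := by
  induction j with
  | zero => simp [branch]
  | succ j ih =>
    have h1 := ih (by omega)
    have h2 := ups_sub_downs (fun q => ξ q ω) i ((n : ℤ) - (j + 1))
    have hi' : pos (fun q => ξ q ω) i = n := hi
    rw [hi', if_neg (by omega), if_pos (by omega), show (n : ℤ) - (j + 1) + 1 = n - j by ring] at h2
    rw [branch]
    push_cast
    exact fails_le_zeros (by
      change _ ≤ ups (fun q => ξ q ω) i ((n : ℤ) - (j + 1))
      omega)

/-- A walk cannot reach `n` before the time prescribed by the generation sizes. -/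
lemma le_of_walk_eq {n i : ℕ} {ω : Ω} (hi : walk ξ i ω = n) :
    n + 2 * ∑ j ∈ Finset.range n, branch ξ (fun _ => 1) n j ω ≤ i := by
  refine le_trans ?_ (sum_cnt_le (fun q => ξ q ω) i (sitesBelow n n))
  rw [sum_sitesBelow]
  have h1 : ∀ j ∈ Finset.range n, 1 + (branch ξ (fun _ => 1) n j ω +
      branch ξ (fun _ => 1) n (j + 1) ω) ≤ cnt (fun q => ξ q ω) i ((n : ℤ) - (j + 1)) := by
    intro j hj
    have hj' := Finset.mem_range.1 hj
    have h1 := branch_le_downs hi (j := j) hj'.le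
    have h2 := branch_le_downs hi (j := j + 1) hj'
    have h3 := ups_add_downs (fun q => ξ q ω) i ((n : ℤ) - (j + 1))
    have h4 := ups_sub_downs (fun q => ξ q ω) i ((n : ℤ) - (j + 1))
    have hi' : pos (fun q => ξ q ω) i = n := hi
    rw [hi', if_neg (by omega), if_pos (by omega), show (n : ℤ) - (j + 1) + 1 = n - j by ring] at h4
    push_cast at h2
    omega
  refine le_trans ?_ (Finset.sum_le_sum h1)
  rw [Finset.sum_add_distrib, Finset.sum_add_distrib]
  have h2 := Finset.sum_range_succ' (fun j => branch ξ (fun _ => 1) n j ω) n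
  rw [Finset.sum_range_succ] at h2
  simp only [branch, add_zero] at h2
  simp only [Finset.sum_const, Finset.card_range, smul_eq_mul, mul_one, branch]
  omega

lemma downs_le_branch {n i : ℕ} {ω : Ω} (hgood : ∀ k u, ∃ d, hit (fun j => ξ (k, j) ω) 0 u d)
    (hi : ∀ j < i, walk ξ j ω < n) (j : ℕ) :
    downs (fun q => ξ q ω) i ((n : ℤ) - j) ≤ branch ξ (fun l => if l < n then 1 else 0) n j ω := by
  induction i generalizing j with
  | zero => simp [downs, cnt, state, zeros]
  | succ i ih =>
    have ih' := ih fun j hj => hi j (by omega)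
    have hlt : pos (fun q => ξ q ω) i < n := hi i (by omega)
    by_cases hk : pos (fun q => ξ q ω) i = (n : ℤ) - j ∧
        ¬ (ξ ((n : ℤ) - j, cnt (fun q => ξ q ω) i ((n : ℤ) - j)) ω = true)
    · obtain ⟨hk, hs⟩ := hk
      cases j with
      | zero => simp at hk; omega
      | succ j =>
        have h1 := ih' j
        have h2 := ups_sub_downs (fun q => ξ q ω) i ((n : ℤ) - (j + 1))
        push_cast at hk hs
        rw [hk, if_neg (lt_irrefl _), show (n : ℤ) - (j + 1) + 1 = n - j by ring] at h2
        have hN : cnt (fun q => ξ q ω) (i + 1) ((n : ℤ) - (j + 1)) =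
            cnt (fun q => ξ q ω) i ((n : ℤ) - (j + 1)) + 1 := by rw [cnt_succ, if_pos hk]
        have hups : ups (fun q => ξ q ω) (i + 1) ((n : ℤ) - (j + 1)) =
            ups (fun q => ξ q ω) i ((n : ℤ) - (j + 1)) := by
          rw [ups_succ, if_neg (fun hh => hs hh.2), add_zero]
        rw [branch]
        push_cast
        refine zeros_le_fails (hgood _ _) ?_
        change ups (fun q => ξ q ω) (i + 1) ((n : ℤ) - (j + 1)) < _
        rw [hups]
        split_ifs at h2 ⊢ <;> omega
    · rw [downs_succ, if_neg hk]
      exact ih' j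

/-- Before reaching `n` and leaving `[-ℓ, n)`, the elapsed time is bounded by the generation
sizes. -/
lemma le_of_walk_lt {n i ℓ : ℕ} {ω : Ω} (hgood : ∀ k u, ∃ d, hit (fun j => ξ (k, j) ω) 0 u d)
    (hi : ∀ j < i, walk ξ j ω < n) (hℓ : ∀ j < i, -(ℓ : ℤ) ≤ walk ξ j ω) :
    i ≤ n + 2 * ∑ j ∈ Finset.range (n + ℓ + 1),
      branch ξ (fun l => if l < n then 1 else 0) n j ω := by
  have hmem : ∀ j < i, pos (fun q => ξ q ω) j ∈ sitesBelow n (n + ℓ) := fun j hj => by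
    have h1 : pos (fun q => ξ q ω) j < n := hi j hj
    have h2 : -(ℓ : ℤ) ≤ pos (fun q => ξ q ω) j := hℓ j hj
    refine Finset.mem_image.2 ⟨((n : ℤ) - 1 - pos (fun q => ξ q ω) j).toNat, ?_, ?_⟩
    · rw [Finset.mem_range]; omega
    · omega
  have hsum := sum_cnt_eq (fun q => ξ q ω) hmem
  rw [sum_sitesBelow] at hsum
  set b := fun j => branch ξ (fun l => if l < n then 1 else 0) n j ω with hb
  have h1 : ∀ j ∈ Finset.range (n + ℓ), cnt (fun q => ξ q ω) i ((n : ℤ) - (j + 1)) ≤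
      (if j < n then 1 else 0) + (b j + b (j + 1)) := by
    intro j _
    have h1 := downs_le_branch hgood hi j
    have h2 := downs_le_branch hgood hi (j + 1)
    have h3 := ups_add_downs (fun q => ξ q ω) i ((n : ℤ) - (j + 1))
    have h4 := ups_sub_downs (fun q => ξ q ω) i ((n : ℤ) - (j + 1))
    rw [show (n : ℤ) - (j + 1) + 1 = n - j by ring] at h4
    push_cast at h2
    simp only [hb]
    split_ifs at h4 ⊢ <;> omega
  have h2 := Finset.sum_le_sum h1
  rw [hsum, Finset.sum_add_distrib, Finset.sum_add_distrib] at h2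
  have h3 : ∑ j ∈ Finset.range (n + ℓ), (if j < n then 1 else 0) = n := by
    rw [← Finset.card_filter]
    have : (Finset.range (n + ℓ)).filter (fun j => j < n) = Finset.range n := by
      ext j; simp only [Finset.mem_filter, Finset.mem_range]; omega
    rw [this, Finset.card_range]
  have h4 := Finset.sum_range_succ' b (n + ℓ)
  have h5 := Finset.sum_range_succ b (n + ℓ)
  simp only [h3] at h2
  change i ≤ n + 2 * ∑ j ∈ Finset.range (n + ℓ + 1), b j
  omega

end Paths

section WalkLaw

variable {Ω : Type*} {mΩ : MeasurableSpace Ω} {μ : Measure Ω} {ξ : ℤ × ℕ → Ω → Bool}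

lemma isCoins_cookieP {p : ℕ → ℝ} (hp : ∀ i, 1 ≤ i → i ≤ M → (1 / 2 : ℝ) ≤ p i ∧ p i < 1)
    (hα : cookieAlpha M p = 1) : IsCoins M fun j => cookieP M p (j + 1) where
  half_le i := by
    rw [cookieP]; split_ifs with hi
    · exact (hp _ (by omega) hi).1
    · exact le_rfl
  lt_one i := by
    rw [cookieP]; split_ifs with hi
    · exact (hp _ (by omega) hi).2
    · norm_num
  fair i hi := if_neg (by omega)
  drift := by
    have h1 : ∑ i ∈ Finset.Icc 1 M, (2 * p i - 1) = 2 := by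
      rw [cookieAlpha] at hα; linarith
    refine Eq.trans ?_ h1
    rw [Finset.range_eq_Ico, Finset.sum_Ico_add' (fun j => 2 * cookieP M p j - 1) 0 M 1]
    refine Finset.sum_congr (by ext; simp) fun i hi => ?_
    rw [cookieP, if_pos (Finset.mem_Icc.1 hi).2]

lemma walk_succ (n : ℕ) (ω : Ω) : walk ξ (n + 1) ω = walk ξ n ω +
    if ξ (walk ξ n ω, cnt (fun q => ξ q ω) n (walk ξ n ω)) ω then 1 else -1 := rfl

lemma measurable_walk_cnt (hm : ∀ q, Measurable (ξ q)) (n : ℕ) :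
    Measurable (walk ξ n) ∧ ∀ k, Measurable fun ω => cnt (fun q => ξ q ω) n k := by
  induction n with
  | zero => exact ⟨measurable_const, fun k => measurable_const⟩
  | succ n ih =>
    have h1 : Measurable fun z : ℤ × Ω => cnt (fun q => ξ q z.2) n z.1 :=
      measurable_from_prod_countable_right ih.2
    have h2 : Measurable fun z : (ℤ × ℕ) × Ω => ξ z.1 z.2 := measurable_from_prod_countable_right hm
    have h3 : Measurable fun ω => cnt (fun q => ξ q ω) n (walk ξ n ω) :=
      h1.comp (ih.1.prodMk measurable_id)
    have h4 : Measurable fun ω => ξ (walk ξ n ω, cnt (fun q => ξ q ω) n (walk ξ n ω)) ω :=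
      h2.comp ((ih.1.prodMk h3).prodMk measurable_id)
    refine ⟨?_, fun k => ?_⟩
    · exact ih.1.add ((measurable_of_countable fun b : Bool => if b then (1 : ℤ) else -1).comp h4)
    · have : (fun ω => cnt (fun q => ξ q ω) (n + 1) k) = fun ω => cnt (fun q => ξ q ω) n k +
          if walk ξ n ω = k then 1 else 0 := funext fun ω => cnt_succ _ n k
      rw [this]
      exact (ih.2 k).add ((measurable_of_countable fun z : ℤ => if z = k then 1 else 0).comp ih.1)

/-- Number of visits to `k` of the path `x` before time `n`. -/
def visits (x : ℕ → ℤ) (n : ℕ) (k : ℤ) : ℕ := ((Finset.range n).filter fun i => x i = k).card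

lemma visits_succ (x : ℕ → ℤ) (n : ℕ) (k : ℤ) :
    visits x (n + 1) k = visits x n k + if x n = k then 1 else 0 := by
  rw [visits, visits, Finset.range_add_one, Finset.filter_insert]
  split_ifs with hk
  · rw [Finset.card_insert_of_notMem (by simp)]
  · simp

lemma cnt_eq_visits {x : ℕ → ℤ} {n : ℕ} {ω : Ω} (hω : ∀ i ≤ n, walk ξ i ω = x i) (k : ℤ) :
    cnt (fun q => ξ q ω) n k = visits x n k := by
  rw [cnt_eq_card, visits]
  congr 1
  refine Finset.filter_congr fun i hi => ?_
  have : pos (fun q => ξ q ω) i = x i := hω i (Finset.mem_range.1 hi).le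
  rw [this]

lemma measurableSet_walk_path (x : ℕ → ℤ) (n : ℕ) :
    MeasurableSet[sig ξ {q | q.2 < visits x n q.1}] {ω | ∀ i ≤ n, walk ξ i ω = x i} := by
  induction n with
  | zero =>
    have : {ω | ∀ i ≤ 0, walk ξ i ω = x i} = {_ω : Ω | 0 = x 0} := by
      ext ω
      simp [walk, pos_zero]
    rw [this]
    exact MeasurableSet.const _
  | succ n ih =>
    have e : {ω | ∀ i ≤ n + 1, walk ξ i ω = x i} = {ω | ∀ i ≤ n, walk ξ i ω = x i} ∩
        ξ (x n, visits x n (x n)) ⁻¹' {b | (x n + if b then 1 else -1) = x (n + 1)} := by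
      ext ω
      simp only [mem_ofPred_eq, mem_inter_iff, mem_preimage, Nat.le_succ_iff, or_imp, forall_and,
        forall_eq]
      refine and_congr_right fun hω => ?_
      rw [walk_succ, hω n le_rfl, cnt_eq_visits hω]
    rw [e]
    refine MeasurableSet.inter (sig_mono ?_ _ ih) (measurable_coin ?_ trivial)
    · intro q (hq : q.2 < visits x n q.1)
      change q.2 < visits x (n + 1) q.1
      rw [visits_succ]; omega
    · change visits x n (x n) < visits x (n + 1) (x n)
      rw [visits_succ, if_pos rfl]; omega

lemma isCookieRW_walk {p : ℕ → ℝ} (hξ : IsCoinField (fun j => cookieP M p (j + 1)) μ ξ) :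
    IsCookieRW M p μ (walk ξ) where
  isProb := hξ.isProb
  meas n := (measurable_walk_cnt hξ.meas n).1
  init := by
    have := hξ.isProb
    have e : {ω | walk ξ 0 ω = 0} = univ := by ext; simp [walk, pos_zero]
    rw [e, measure_univ]
  steps n := by
    have := hξ.isProb
    have e : {ω | |walk ξ (n + 1) ω - walk ξ n ω| = 1} = univ := by
      ext ω
      simp only [mem_ofPred_eq, walk_succ, mem_univ, iff_true, add_sub_cancel_left]
      split_ifs <;> simp
    rw [e, measure_univ]
  cond n x hx _ := by
    have e : {ω | walk ξ (n + 1) ω = x n + 1} ∩ {ω | ∀ i ≤ n, walk ξ i ω = x i} =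
        {ω | ξ (x n, visits x n (x n)) ω = true} ∩ {ω | ∀ i ≤ n, walk ξ i ω = x i} := by
      ext ω
      simp only [mem_ofPred_eq, mem_inter_iff]
      refine and_congr_left fun hω => ?_
      rw [walk_succ, hω n le_rfl, cnt_eq_visits hω]
      split_ifs with hs <;> simp [hs]
    have e2 : ((Finset.range (n + 1)).filter (fun i => x i = x n)).card = visits x n (x n) + 1 := by
      change visits x (n + 1) (x n) = _
      rw [visits_succ, if_pos rfl]
    rw [e, e2, hξ.measure_inter (S := {(x n, visits x n (x n))})
      (T := {q | q.2 < visits x n q.1}) ?_ (measurableSet_coin true rfl)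
      (measurableSet_walk_path x n)]
    · congr 1
      exact hξ.law (x n, visits x n (x n))
    · rw [Set.disjoint_singleton_left]
      exact fun hq : visits x n (x n) < visits x n (x n) => lt_irrefl _ hq

end WalkLaw

section Law

variable {Ω : Type*} {mΩ : MeasurableSpace Ω} {P : Measure Ω} {X : ℕ → Ω → ℤ} {p : ℕ → ℝ}

/-- The path of `X` up to time `n`. -/
def history (X : ℕ → Ω → ℤ) (n : ℕ) (ω : Ω) (j : Fin (n + 1)) : ℤ := X j ω

lemma history_preimage (X : ℕ → Ω → ℤ) (n : ℕ) (z : Fin (n + 1) → ℤ) :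
    history X n ⁻¹' {z} = {ω | ∀ i ≤ n, X i ω = z (Fin.ofNat (n + 1) i)} := by
  ext ω
  simp only [mem_preimage, mem_singleton_iff, mem_ofPred_eq, history, funext_iff]
  refine ⟨fun h i hi => ?_, fun h j => ?_⟩
  · have := h (Fin.ofNat (n + 1) i)
    rwa [Fin.val_ofNat, Nat.mod_eq_of_lt (by omega)] at this
  · rw [h j (by omega)]
    congr 1
    ext
    simp

lemma measurable_history (hX : ∀ n, Measurable (X n)) (n : ℕ) : Measurable (history X n) :=
  measurable_pi_lambda _ fun j => hX j

/-- The filtration generated by `X`. -/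
def historyFiltration (hX : ∀ n, Measurable (X n)) : Filtration ℕ mΩ where
  seq n := MeasurableSpace.comap (history X n) inferInstance
  mono' i j hij := by
    have e : history X i = (fun z : Fin (j + 1) → ℤ => fun l : Fin (i + 1) =>
        z ⟨l, by omega⟩) ∘ history X j := rfl
    change MeasurableSpace.comap (history X i) _ ≤ MeasurableSpace.comap (history X j) _
    rw [e, ← MeasurableSpace.comap_comp]
    exact MeasurableSpace.comap_mono (measurable_of_countable _).comap_le
  le' n := (measurable_history hX n).comap_le

lemma measurable_historyFiltration (hX : ∀ n, Measurable (X n)) {i n : ℕ} (hi : i ≤ n) :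
    Measurable[historyFiltration hX n] (X i) := by
  have e : X i = (fun z : Fin (n + 1) → ℤ => z ⟨i, by omega⟩) ∘ history X n := rfl
  rw [e]
  exact (measurable_of_countable _).comp (comap_measurable _)

/-- Twice the probability of the next step to the right, minus one. -/
def localDrift (M : ℕ) (p : ℕ → ℝ) (X : ℕ → Ω → ℤ) (n : ℕ) (ω : Ω) : ℝ :=
  2 * cookieP M p (((Finset.range (n + 1)).filter (fun i => X i ω = X n ω)).card) - 1

lemma measurable_localDrift (hX : ∀ n, Measurable (X n)) (n : ℕ) :
    Measurable[historyFiltration hX n] (localDrift M p X n) := by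
  have e : localDrift M p X n = (fun z : Fin (n + 1) → ℤ => 2 * cookieP M p
      (((Finset.range (n + 1)).filter
        (fun i => z (Fin.ofNat (n + 1) i) = z (Fin.ofNat (n + 1) n))).card) - 1) ∘
        history X n := by
    ext ω
    simp only [localDrift, Function.comp_apply]
    congr 4
    refine Finset.filter_congr fun i hi => ?_
    have hi := Finset.mem_range.1 hi
    simp only [history, Fin.val_ofNat]
    rw [Nat.mod_eq_of_lt hi, Nat.mod_eq_of_lt (by omega)]
  rw [e]
  exact (measurable_of_countable _).comp (comap_measurable _)

lemma cookieP_mem (h : IsCoins M fun j => cookieP M p (j + 1)) {j : ℕ} (hj : 1 ≤ j) :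
    1 / 2 ≤ cookieP M p j ∧ cookieP M p j < 1 := by
  obtain ⟨i, rfl⟩ := Nat.exists_eq_add_of_le' hj
  exact ⟨h.half_le i, h.lt_one i⟩

lemma one_le_card_filter (x : ℕ → ℤ) (n : ℕ) :
    1 ≤ ((Finset.range (n + 1)).filter (fun i => x i = x n)).card :=
  Finset.card_pos.2 ⟨n, by simp⟩

lemma localDrift_mem (h : IsCoins M fun j => cookieP M p (j + 1)) (n : ℕ) (ω : Ω) :
    0 ≤ localDrift M p X n ω ∧ localDrift M p X n ω ≤ 1 := by
  have := cookieP_mem h (one_le_card_filter (fun i => X i ω) n)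
  rw [localDrift]
  constructor <;> linarith [this.1, this.2]

lemma measurableSet_path (hX : ∀ n, Measurable (X n)) (n : ℕ) (x : ℕ → ℤ) :
    MeasurableSet {ω | ∀ i ≤ n, X i ω = x i} := by
  have e : {ω | ∀ i ≤ n, X i ω = x i} = ⋂ i ≤ n, X i ⁻¹' {x i} := by ext; simp
  rw [e]
  exact MeasurableSet.iInter fun i => MeasurableSet.iInter fun _ => hX i (measurableSet_singleton _)

lemma _root_.IsCookieRW.ae_steps (hX : IsCookieRW M p P X) : ∀ᵐ ω ∂P, ∀ n, |X (n + 1) ω - X n ω| = 1 := by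
  have := hX.isProb
  refine ae_all_iff.2 fun n => ?_
  have hm : MeasurableSet {ω | |X (n + 1) ω - X n ω| = 1} :=
    (measurable_of_countable (fun z : ℤ × ℤ => |z.1 - z.2|)).comp
      ((hX.meas (n + 1)).prodMk (hX.meas n)) (measurableSet_singleton 1)
  exact (prob_compl_eq_zero_iff hm).2 (hX.steps n)

lemma _root_.IsCookieRW.ae_init (hX : IsCookieRW M p P X) : ∀ᵐ ω ∂P, X 0 ω = 0 := by
  have := hX.isProb
  exact (prob_compl_eq_zero_iff (hX.meas 0 (measurableSet_singleton 0))).2 hX.init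

lemma _root_.IsCookieRW.path_eq_zero (hX : IsCookieRW M p P X) {x : ℕ → ℤ} (hx : x 0 ≠ 0) (n : ℕ) :
    P {ω | ∀ i ≤ n, X i ω = x i} = 0 := by
  refine measure_mono_null ?_ hX.ae_init
  intro ω hω h0
  exact hx (by rw [← hω 0 (Nat.zero_le _)]; exact h0)

lemma _root_.IsCookieRW.measure_up (hX : IsCookieRW M p P X) (x : ℕ → ℤ) (n : ℕ) :
    P ({ω | X (n + 1) ω = x n + 1} ∩ {ω | ∀ i ≤ n, X i ω = x i}) =
      ENNReal.ofReal (cookieP M p (((Finset.range (n + 1)).filter (fun i => x i = x n)).card))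
        * P {ω | ∀ i ≤ n, X i ω = x i} := by
  rcases eq_or_ne (P {ω | ∀ i ≤ n, X i ω = x i}) 0 with h0 | h0
  · rw [h0, mul_zero]
    exact measure_mono_null inter_subset_right h0
  · refine hX.cond n x ?_ (pos_iff_ne_zero.2 h0)
    by_contra hx
    exact h0 (hX.path_eq_zero hx n)

lemma _root_.IsCookieRW.measure_path_succ (hX : IsCookieRW M p P X) (x : ℕ → ℤ) (n : ℕ) :
    P {ω | ∀ i ≤ n + 1, X i ω = x i} =
      (if x (n + 1) = x n + 1 then ENNReal.ofReal
          (cookieP M p (((Finset.range (n + 1)).filter (fun i => x i = x n)).card))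
        else if x (n + 1) = x n - 1 then 1 - ENNReal.ofReal
          (cookieP M p (((Finset.range (n + 1)).filter (fun i => x i = x n)).card))
        else 0) * P {ω | ∀ i ≤ n, X i ω = x i} := by
  have := hX.isProb
  have e : {ω | ∀ i ≤ n + 1, X i ω = x i} =
      {ω | X (n + 1) ω = x (n + 1)} ∩ {ω | ∀ i ≤ n, X i ω = x i} := by
    ext ω
    simp only [mem_ofPred_eq, mem_inter_iff, Nat.le_succ_iff, or_imp, forall_and, forall_eq]
    exact and_comm
  rw [e]
  split_ifs with h1 h2
  · rw [h1, hX.measure_up]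
  · have hae : ({ω | X (n + 1) ω = x (n + 1)} ∩ {ω | ∀ i ≤ n, X i ω = x i} : Set Ω) =ᵐ[P]
        ({ω | ∀ i ≤ n, X i ω = x i} \
          ({ω | X (n + 1) ω = x n + 1} ∩ {ω | ∀ i ≤ n, X i ω = x i}) : Set Ω) := by
      filter_upwards [hX.ae_steps] with ω hω
      refine propext ?_
      have h3 := hω n
      change (X (n + 1) ω = x (n + 1) ∧ ∀ i ≤ n, X i ω = x i) ↔ ((∀ i ≤ n, X i ω = x i) ∧
        ¬ (X (n + 1) ω = x n + 1 ∧ ∀ i ≤ n, X i ω = x i))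
      constructor
      · rintro ⟨h4, h5⟩
        exact ⟨h5, fun h6 => by omega⟩
      · rintro ⟨h4, h5⟩
        refine ⟨?_, h4⟩
        have h6 := h4 n le_rfl
        have h7 : ¬ X (n + 1) ω = x n + 1 := fun h8 => h5 ⟨h8, h4⟩
        rcases abs_eq (zero_le_one (α := ℤ)) |>.1 h3 with h8 | h8 <;> omega
    rw [measure_congr hae, measure_sdiff inter_subset_right
      (MeasurableSet.inter (s₁ := {ω | X (n + 1) ω = x n + 1})
        (hX.meas _ (measurableSet_singleton _)) (measurableSet_path hX.meas n x)).nullMeasurableSet (measure_ne_top _ _), hX.measure_up,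
      ENNReal.sub_mul fun _ _ => measure_ne_top _ _, one_mul]
  · rw [zero_mul]
    refine measure_mono_null (t := {ω | ¬ ∀ n, |X (n + 1) ω - X n ω| = 1}) ?_ hX.ae_steps
    rintro ω ⟨h3, h4⟩ h5
    have h3 : X (n + 1) ω = x (n + 1) := h3
    have h6 := h4 n le_rfl
    rcases abs_eq (zero_le_one (α := ℤ)) |>.1 (h5 n) with h8 | h8 <;> omega

lemma _root_.IsCookieRW.measure_path_eq {Ω' : Type*} {mΩ' : MeasurableSpace Ω'} {Q : Measure Ω'} {W : ℕ → Ω' → ℤ}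
    (hX : IsCookieRW M p P X) (hW : IsCookieRW M p Q W) (x : ℕ → ℤ) (n : ℕ) :
    P {ω | ∀ i ≤ n, X i ω = x i} = Q {ω | ∀ i ≤ n, W i ω = x i} := by
  induction n with
  | zero =>
    by_cases hx : x 0 = 0
    · simp only [nonpos_iff_eq_zero, forall_eq, hx]
      rw [hX.init, hW.init]
    · rw [hX.path_eq_zero hx, hW.path_eq_zero hx]
  | succ n ih => rw [hX.measure_path_succ, hW.measure_path_succ, ih]

lemma _root_.IsCookieRW.map_eq {Ω' : Type*} {mΩ' : MeasurableSpace Ω'} {Q : Measure Ω'} {W : ℕ → Ω' → ℤ}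
    (hX : IsCookieRW M p P X) (hW : IsCookieRW M p Q W) (n : ℕ) : P.map (X n) = Q.map (W n) := by
  have h1 : P.map (history X n) = Q.map (history W n) := by
    refine Measure.ext_of_singleton fun z => ?_
    rw [Measure.map_apply (measurable_history hX.meas n) (measurableSet_singleton _),
      Measure.map_apply (measurable_history hW.meas n) (measurableSet_singleton _),
      history_preimage, history_preimage]
    exact hX.measure_path_eq hW (fun i => z (Fin.ofNat (n + 1) i)) n
  have h2 := congrArg (Measure.map fun z : Fin (n + 1) → ℤ => z (Fin.last n)) h1
  rwa [Measure.map_map (measurable_pi_apply _) (measurable_history hX.meas n),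
    Measure.map_map (measurable_pi_apply _) (measurable_history hW.meas n)] at h2

lemma _root_.IsCookieRW.setIntegral_path (hX : IsCookieRW M p P X) (h : IsCoins M fun j => cookieP M p (j + 1))
    (x : ℕ → ℤ) (n : ℕ) :
    ∫ ω in {ω | ∀ i ≤ n, X i ω = x i},
      (((X (n + 1) ω - X n ω : ℤ) : ℝ) - localDrift M p X n ω) ∂P = 0 := by
  have := hX.isProb
  set E := {ω | ∀ i ≤ n, X i ω = x i} with hE
  set c := cookieP M p (((Finset.range (n + 1)).filter (fun i => x i = x n)).card) with hc
  have hEm : MeasurableSet E := measurableSet_path hX.meas n x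
  have hUm : MeasurableSet {ω | X (n + 1) ω = x n + 1} :=
    hX.meas _ (measurableSet_singleton _)
  have e : ∫ ω in E, (((X (n + 1) ω - X n ω : ℤ) : ℝ) - localDrift M p X n ω) ∂P =
      ∫ ω in E, (2 * ({ω | X (n + 1) ω = x n + 1} : Set Ω).indicator (fun _ => (1 : ℝ)) ω - 2 * c)
        ∂P := by
    refine setIntegral_congr_ae hEm ?_
    filter_upwards [hX.ae_steps] with ω hω hωE
    have h1 : localDrift M p X n ω = 2 * c - 1 := by
      rw [localDrift, hc]
      congr 4
      refine Finset.filter_congr fun i hi => ?_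
      rw [hωE i (by have := Finset.mem_range.1 hi; omega), hωE n le_rfl]
    rw [h1]
    have h2 := hωE n le_rfl
    by_cases h3 : X (n + 1) ω = x n + 1
    · rw [indicator_of_mem (by exact h3), h3, h2]
      push_cast; ring
    · rw [indicator_of_notMem (by exact h3)]
      have h4 : X (n + 1) ω - X n ω = -1 := by
        rcases abs_eq (zero_le_one (α := ℤ)) |>.1 (hω n) with h8 | h8
        · omega
        · exact h8
      rw [h4]; push_cast; ring
  have hcm := cookieP_mem h (one_le_card_filter x n)
  have hup : P.real ({ω | X (n + 1) ω = x n + 1} ∩ E) = c * P.real E := by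
    rw [measureReal_def, hX.measure_up, ENNReal.toReal_mul,
      ENNReal.toReal_ofReal (by linarith [hcm.1]), measureReal_def]
  rw [e, integral_sub, integral_const_mul, integral_indicator_const _ hUm]
  · rw [measureReal_restrict_apply hUm, hup]
    simp only [integral_const, smul_eq_mul, measureReal_restrict_apply_univ, mul_one]
    ring
  · exact ((integrable_const (1 : ℝ)).indicator hUm).const_mul 2
  · exact integrable_const _

end Law

section Drift

variable {Ω : Type*} {mΩ : MeasurableSpace Ω} {P : Measure Ω} {X : ℕ → Ω → ℤ} {p : ℕ → ℝ}

lemma _root_.IsCookieRW.ae_abs_step_le (hX : IsCookieRW M p P X)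
    (h : IsCoins M fun j => cookieP M p (j + 1)) (n : ℕ) :
    ∀ᵐ ω ∂P, |((X (n + 1) ω - X n ω : ℤ) : ℝ) - localDrift M p X n ω| ≤ 2 := by
  filter_upwards [hX.ae_steps] with ω hω
  have h1 : |((X (n + 1) ω - X n ω : ℤ) : ℝ)| = 1 := by exact_mod_cast hω n
  have h2 := localDrift_mem (X := X) h n ω
  rw [abs_le]
  constructor <;> linarith [abs_le.1 h1.le]

lemma _root_.IsCookieRW.measurable_step (hX : IsCookieRW M p P X) (n : ℕ) :
    Measurable[historyFiltration hX.meas (n + 1)]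
      fun ω => ((X (n + 1) ω - X n ω : ℤ) : ℝ) - localDrift M p X n ω := by
  have h1 := measurable_historyFiltration hX.meas (le_refl (n + 1))
  have h2 := measurable_historyFiltration hX.meas (Nat.le_succ n)
  have h3 : Measurable[historyFiltration hX.meas (n + 1)] (localDrift M p X n) :=
    (measurable_localDrift hX.meas n).mono ((historyFiltration hX.meas).mono (Nat.le_succ n)) le_rfl
  exact ((measurable_of_countable (fun z : ℤ × ℤ => ((z.1 - z.2 : ℤ) : ℝ))).comp
    (h1.prodMk h2)).sub h3

lemma _root_.IsCookieRW.integrable_step (hX : IsCookieRW M p P X)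
    (h : IsCoins M fun j => cookieP M p (j + 1)) (n : ℕ) :
    Integrable (fun ω => ((X (n + 1) ω - X n ω : ℤ) : ℝ) - localDrift M p X n ω) P := by
  have := hX.isProb
  refine Integrable.mono' (integrable_const 2) ?_ (hX.ae_abs_step_le h n)
  exact ((hX.measurable_step n).mono ((historyFiltration hX.meas).le _) le_rfl).aestronglyMeasurable

lemma _root_.IsCookieRW.setIntegral_step (hX : IsCookieRW M p P X)
    (h : IsCoins M fun j => cookieP M p (j + 1)) (n : ℕ) {A : Set Ω}
    (hA : MeasurableSet[historyFiltration hX.meas n] A) :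
    ∫ ω in A, (((X (n + 1) ω - X n ω : ℤ) : ℝ) - localDrift M p X n ω) ∂P = 0 := by
  obtain ⟨B, _, rfl⟩ := hA
  have e : history X n ⁻¹' B = ⋃ z : B, history X n ⁻¹' {z.1} := by ext; simp
  rw [e]
  have h1 := hasSum_integral_iUnion (μ := P) (s := fun z : B => history X n ⁻¹' {z.1})
    (f := fun ω => ((X (n + 1) ω - X n ω : ℤ) : ℝ) - localDrift M p X n ω)
    (fun z => measurable_history hX.meas n (measurableSet_singleton _))
    (fun z w hzw => Disjoint.preimage _ (by
      rw [Set.disjoint_singleton]; exact fun hh => hzw (Subtype.ext hh)))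
    (hX.integrable_step h n).integrableOn
  refine h1.unique ?_
  simp only [history_preimage]
  simp only [hX.setIntegral_path h]
  exact hasSum_zero

/-- Steps taken on predictable events have nonnegative drift, so a large negative total is
unlikely. -/
lemma _root_.IsCookieRW.measureReal_sum_step_le (hX : IsCookieRW M p P X)
    (h : IsCoins M fun j => cookieP M p (j + 1)) {A : ℕ → Set Ω}
    (hA : ∀ n, MeasurableSet[historyFiltration hX.meas n] (A n)) (n : ℕ) {l : ℝ} (hl : 0 < l) :
    P.real {ω | ∑ i ∈ Finset.range n,
      (A i).indicator (fun ω => ((X (i + 1) ω - X i ω : ℤ) : ℝ)) ω ≤ -l} ≤ 4 * n / l ^ 2 := by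
  have := hX.isProb
  set D : ℕ → Ω → ℝ := fun i => (A i).indicator
    fun ω => ((X (i + 1) ω - X i ω : ℤ) : ℝ) - localDrift M p X i ω with hD
  have hmle : ∀ i, historyFiltration hX.meas i ≤ mΩ := (historyFiltration hX.meas).le
  have hDm : ∀ i, StronglyMeasurable[historyFiltration hX.meas (i + 1)] (D i) := fun i =>
    Measurable.stronglyMeasurable ((hX.measurable_step i).indicator
      ((historyFiltration hX.meas).mono (Nat.le_succ i) _ (hA i)))
  have hDb : ∀ i, ∀ᵐ ω ∂P, |D i ω| ≤ 2 := fun i => by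
    filter_upwards [hX.ae_abs_step_le h i] with ω hω
    simp only [hD, indicator]
    split_ifs
    · exact hω
    · simp
  have hDL : ∀ i, MemLp (D i) 2 P := fun i =>
    MemLp.of_bound ((hDm i).mono (hmle _)).aestronglyMeasurable 2 (hDb i)
  have hD0 : ∀ i B, MeasurableSet[historyFiltration hX.meas i] B → ∫ ω in B, D i ω ∂P = 0 := by
    intro i B hB
    simp only [hD]
    rw [setIntegral_indicator (hmle i _ (hA i))]
    exact hX.setIntegral_step h i (hB.inter (hA i))
  have hsq := integral_sq_sum_eq (historyFiltration hX.meas) hDm hDL hD0 n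
  have hle : ∑ i ∈ Finset.range n, ∫ ω, D i ω ^ 2 ∂P ≤ 4 * n := by
    refine (Finset.sum_le_card_nsmul _ _ 4 fun i _ => ?_).trans_eq (by simp [mul_comm])
    refine (integral_mono_ae (hDL i).integrable_sq (integrable_const 4) ?_).trans_eq (by simp)
    filter_upwards [hDb i] with ω hω
    have := abs_le.1 hω
    change D i ω ^ 2 ≤ 4
    nlinarith
  have hSL : MemLp (fun ω => ∑ i ∈ Finset.range n, D i ω) 2 P := memLp_finsetSum _ fun i _ => hDL i
  have hmark := mul_meas_ge_le_integral_of_nonneg (μ := P)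
    (f := fun ω => (∑ i ∈ Finset.range n, D i ω) ^ 2)
    (ae_of_all _ fun ω => sq_nonneg _) hSL.integrable_sq (l ^ 2)
  rw [le_div_iff₀ (by positivity)]
  refine le_trans ?_ (hmark.trans (hsq.trans_le hle))
  rw [mul_comm]
  refine mul_le_mul_of_nonneg_left (measureReal_mono fun ω hω => ?_) (by positivity)
  have hω : ∑ i ∈ Finset.range n,
      (A i).indicator (fun ω => ((X (i + 1) ω - X i ω : ℤ) : ℝ)) ω ≤ -l := hω
  have h1 : ∑ i ∈ Finset.range n, D i ω ≤ -l := by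
    refine le_trans (Finset.sum_le_sum fun i _ => ?_) hω
    simp only [hD, indicator]
    split_ifs
    · linarith [(localDrift_mem (X := X) h i ω).1]
    · exact le_rfl
  change l ^ 2 ≤ (∑ i ∈ Finset.range n, D i ω) ^ 2
  nlinarith

lemma sum_ite_step_of_hit (x : ℕ → ℤ) (k : ℤ) (n : ℕ) [∀ i, Decidable (∃ j ≤ i, x j = k)] :
    ∑ i ∈ Finset.range n, (if ∃ j ≤ i, x j = k then x (i + 1) - x i else 0) =
      if ∃ j ≤ n, x j = k then x n - k else 0 := by
  induction n with
  | zero =>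
    split_ifs with h0
    · obtain ⟨j, hj, h1⟩ := h0
      rw [Nat.le_zero.1 hj] at h1
      simp [h1]
    · simp
  | succ n ih =>
    rw [Finset.sum_range_succ, ih]
    by_cases h1 : ∃ j ≤ n, x j = k
    · have h2 : ∃ j ≤ n + 1, x j = k := by
        obtain ⟨j, hj, h3⟩ := h1
        exact ⟨j, by omega, h3⟩
      rw [if_pos h1, if_pos h1, if_pos h2]
      ring
    · rw [if_neg h1, if_neg h1]
      split_ifs with h2
      · obtain ⟨j, hj, h3⟩ := h2
        rcases Nat.le_succ_iff.1 hj with h4 | h4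
        · exact absurd ⟨j, h4, h3⟩ h1
        · rw [show n + 1 = j from h4.symm, h3]; ring
      · ring

lemma sum_ite_step_of_exit (x : ℕ → ℤ) (h0 : x 0 = 0) (l : ℤ) (n : ℕ)
    [∀ i, Decidable (∀ j ≤ i, -l < x j)] :
    (∃ j ≤ n, x j ≤ -l) →
      ∑ i ∈ Finset.range n, (if ∀ j ≤ i, -l < x j then x (i + 1) - x i else 0) ≤ -l := by
  have h1 : ∀ m, (∀ i < m, ∀ j ≤ i, -l < x j) →
      ∑ i ∈ Finset.range m, (if ∀ j ≤ i, -l < x j then x (i + 1) - x i else 0) = x m := by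
    intro m hm
    rw [Finset.sum_congr rfl fun i hi => if_pos (hm i (Finset.mem_range.1 hi)),
      Finset.sum_range_sub, h0, sub_zero]
  intro hex
  classical
  have hj := Nat.find_spec hex
  have hmin : ∀ j < Nat.find hex, -l < x j := fun j hj' => by
    by_contra hc
    exact Nat.find_min hex hj' ⟨by omega, by omega⟩
  set m := Nat.find hex with hm
  obtain ⟨d, hd⟩ := Nat.exists_eq_add_of_le hj.1
  rw [hd, Finset.sum_range_add, h1 m fun i hi j hji => hmin j (by omega),
    Finset.sum_eq_zero fun i _ => if_neg fun hc => absurd (hc m (by omega)) (by omega), add_zero]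
  exact hj.2

/-- The walk is unlikely to go far below a level it has reached. -/
lemma _root_.IsCookieRW.measureReal_drop_le (hX : IsCookieRW M p P X)
    (h : IsCoins M fun j => cookieP M p (j + 1)) (k : ℤ) (n : ℕ) {l : ℝ} (hl : 0 < l) :
    P.real {ω | (∃ j ≤ n, X j ω = k) ∧ (X n ω : ℝ) ≤ k - l} ≤ 4 * n / l ^ 2 := by
  classical
  have := hX.isProb
  refine (measureReal_mono fun ω hω => ?_).trans
    (hX.measureReal_sum_step_le h (A := fun i => {ω | ∃ j ≤ i, X j ω = k}) ?_ n hl)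
  · change ∑ i ∈ Finset.range n, (_ : ℝ) ≤ _
    have h1 := sum_ite_step_of_hit (fun j => X j ω) k n
    rw [if_pos hω.1] at h1
    have h2 : ∑ i ∈ Finset.range n, ({ω | ∃ j ≤ i, X j ω = k} : Set Ω).indicator
        (fun ω => ((X (i + 1) ω - X i ω : ℤ) : ℝ)) ω = ((X n ω - k : ℤ) : ℝ) := by
      rw [← h1, Int.cast_sum]
      refine Finset.sum_congr rfl fun i _ => ?_
      simp only [indicator, mem_ofPred_eq]
      split_ifs <;> simp
    rw [h2]
    push_cast
    linarith [hω.2]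
  · intro i
    have e : {ω | ∃ j ≤ i, X j ω = k} = ⋃ j, ⋃ (_ : j ≤ i), X j ⁻¹' {k} := by ext; simp
    rw [e]
    exact MeasurableSet.iUnion fun j => MeasurableSet.iUnion fun hj =>
      measurable_historyFiltration hX.meas hj (measurableSet_singleton k)

/-- The walk is unlikely to go far below the origin. -/
lemma _root_.IsCookieRW.measureReal_exit_le (hX : IsCookieRW M p P X)
    (h : IsCoins M fun j => cookieP M p (j + 1)) (n : ℕ) {l : ℕ} (hl : 0 < l) :
    P.real {ω | ∃ j ≤ n, X j ω ≤ -(l : ℤ)} ≤ 4 * n / (l : ℝ) ^ 2 := by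
  classical
  have := hX.isProb
  have hl' : (0 : ℝ) < l := by exact_mod_cast hl
  refine le_trans ?_
    (hX.measureReal_sum_step_le h (A := fun i => {ω | ∀ j ≤ i, -(l : ℤ) < X j ω}) ?_ n hl')
  · refine ENNReal.toReal_mono (measure_ne_top _ _) (measure_mono_ae ?_)
    filter_upwards [hX.ae_init] with ω h0 hω
    change ∑ i ∈ Finset.range n, (_ : ℝ) ≤ _
    have h1 := sum_ite_step_of_exit (fun j => X j ω) h0 l n hω
    have h2 : ∑ i ∈ Finset.range n, ({ω | ∀ j ≤ i, -(l : ℤ) < X j ω} : Set Ω).indicator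
        (fun ω => ((X (i + 1) ω - X i ω : ℤ) : ℝ)) ω = ((∑ i ∈ Finset.range n,
          (if ∀ j ≤ i, -(l : ℤ) < X j ω then X (i + 1) ω - X i ω else 0) : ℤ) : ℝ) := by
      rw [Int.cast_sum]
      refine Finset.sum_congr rfl fun i _ => ?_
      simp only [indicator, mem_ofPred_eq]
      split_ifs <;> simp
    rw [h2]
    exact_mod_cast h1
  · intro i
    have e : {ω | ∀ j ≤ i, -(l : ℤ) < X j ω} = ⋂ j, ⋂ (_ : j ≤ i), X j ⁻¹' Ioi (-(l : ℤ)) := by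
      ext; simp
    rw [e]
    exact MeasurableSet.iInter fun j => MeasurableSet.iInter fun hj =>
      measurable_historyFiltration hX.meas hj measurableSet_Ioi

end Drift

section Scale

/-- The level `a n / log n`, rounded down. -/
def level (a : ℝ) (n : ℕ) : ℕ := ⌊a * ((n : ℝ) / Real.log n)⌋₊

lemma tendsto_log_natCast : Tendsto (fun n : ℕ => Real.log n) atTop atTop :=
  Real.tendsto_log_atTop.comp tendsto_natCast_atTop_atTop

lemma tendsto_div_log : Tendsto (fun n : ℕ => (n : ℝ) / Real.log n) atTop atTop := by
  have h1 : Tendsto (fun x : ℝ => Real.log x / x) atTop (𝓝[>] 0) := by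
    refine tendsto_nhdsWithin_iff.2 ⟨tendsto_log_div_self, ?_⟩
    filter_upwards [eventually_gt_atTop 1] with x hx
    exact div_pos (Real.log_pos hx) (by linarith)
  refine (h1.inv_tendsto_nhdsGT_zero.comp tendsto_natCast_atTop_atTop).congr fun n => ?_
  simp

lemma tendsto_sq_log_div : Tendsto (fun n : ℕ => Real.log n ^ 2 / n) atTop (𝓝 0) :=
  (Real.isLittleO_pow_log_id_atTop (n := 2)).tendsto_div_nhds_zero.comp tendsto_natCast_atTop_atTop

variable {a : ℝ}

lemma tendsto_level_div (ha : 0 < a) :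
    Tendsto (fun n => (level a n : ℝ) / ((n : ℝ) / Real.log n)) atTop (𝓝 a) :=
  (tendsto_nat_floor_mul_div_atTop ha.le).comp tendsto_div_log

lemma tendsto_level (ha : 0 < a) : Tendsto (level a) atTop atTop :=
  tendsto_nat_floor_atTop.comp (tendsto_div_log.const_mul_atTop ha)

lemma tendsto_level_div_self (ha : 0 < a) :
    Tendsto (fun n => (level a n : ℝ) / n) atTop (𝓝 0) := by
  have h1 := (tendsto_level_div ha).mul (tendsto_inv_atTop_zero.comp tendsto_log_natCast)
  rw [mul_zero] at h1
  refine h1.congr' ?_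
  filter_upwards [tendsto_log_natCast.eventually_gt_atTop 0, eventually_gt_atTop 0] with n hn hn'
  have : (0 : ℝ) < n := by exact_mod_cast hn'
  simp only [Function.comp_apply]
  field_simp

lemma tendsto_level_mul_log_div (ha : 0 < a) :
    Tendsto (fun n => (level a n : ℝ) * Real.log (level a n) / n) atTop (𝓝 a) := by
  have h1 := tendsto_level_div ha
  have h2 : Tendsto (fun n : ℕ => Real.log ((level a n : ℝ) / ((n : ℝ) / Real.log n)) *
      (Real.log n)⁻¹ + 1 - Real.log (Real.log n) / Real.log n) atTop (𝓝 (Real.log a * 0 + 1 - 0)) :=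
    (((h1.log ha.ne').mul (tendsto_inv_atTop_zero.comp tendsto_log_natCast)).add_const 1).sub
      (tendsto_log_div_self.comp tendsto_log_natCast)
  have h3 := h1.mul h2
  simp only [mul_zero, zero_add, sub_zero, mul_one] at h3
  refine h3.congr' ?_
  filter_upwards [tendsto_log_natCast.eventually_gt_atTop 0, eventually_gt_atTop 0,
    (tendsto_level ha).eventually_gt_atTop 0] with n hn hn' hk
  have hn0 : (0 : ℝ) < n := by exact_mod_cast hn'
  have hk0 : (0 : ℝ) < level a n := by exact_mod_cast hk
  rw [Real.log_div hk0.ne' (by positivity), Real.log_div hn0.ne' hn.ne']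
  field_simp
  ring

/-- A distance between the diffusive scale and `n`. -/
def depth (n : ℕ) : ℕ := ⌈√(n * √(Real.log n))⌉₊

lemma tendsto_sqrt_mul_sqrt_log :
    Tendsto (fun n : ℕ => √(n * √(Real.log n))) atTop atTop :=
  Real.tendsto_sqrt_atTop.comp
    (tendsto_natCast_atTop_atTop.atTop_mul_atTop₀ (Real.tendsto_sqrt_atTop.comp tendsto_log_natCast))

lemma tendsto_div_depth_sq : Tendsto (fun n : ℕ => 4 * n / (depth n : ℝ) ^ 2) atTop (𝓝 0) := by
  have h1 : Tendsto (fun n : ℕ => 4 * (√(Real.log n))⁻¹) atTop (𝓝 (4 * 0)) :=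
    (tendsto_inv_atTop_zero.comp (Real.tendsto_sqrt_atTop.comp tendsto_log_natCast)).const_mul 4
  rw [mul_zero] at h1
  refine squeeze_zero' (Eventually.of_forall fun n => by positivity) ?_ h1
  filter_upwards [tendsto_log_natCast.eventually_gt_atTop 0, eventually_gt_atTop 0] with n hn hn'
  have hn0 : (0 : ℝ) < n := by exact_mod_cast hn'
  have hs : 0 < √(Real.log n) := Real.sqrt_pos.2 hn
  have h2 : n * √(Real.log n) ≤ (depth n : ℝ) ^ 2 := by
    rw [← Real.sq_sqrt (by positivity : 0 ≤ n * √(Real.log n))]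
    exact pow_le_pow_left₀ (Real.sqrt_nonneg _) (Nat.le_ceil _) 2
  rw [← div_eq_mul_inv, div_le_div_iff₀ (by nlinarith) hs]
  nlinarith

lemma tendsto_depth_mul_sqrt_level (ha : 0 < a) (C : ℝ) :
    Tendsto (fun n : ℕ => ((depth n : ℝ) + 1) * √(C * level a n) / n) atTop (𝓝 0) := by
  have h1 : Tendsto (fun n : ℕ => (depth n : ℝ) / √(n * √(Real.log n)) +
      (√(n * √(Real.log n)))⁻¹) atTop (𝓝 (1 + 0)) :=
    ((tendsto_nat_ceil_div_atTop).comp tendsto_sqrt_mul_sqrt_log).add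
      (tendsto_inv_atTop_zero.comp tendsto_sqrt_mul_sqrt_log)
  have h2 : Tendsto (fun n : ℕ => √(C * ((level a n : ℝ) / ((n : ℝ) / Real.log n)) *
      (√(Real.log n))⁻¹)) atTop (𝓝 √(C * a * 0)) :=
    (((tendsto_level_div ha).const_mul C).mul
      (tendsto_inv_atTop_zero.comp (Real.tendsto_sqrt_atTop.comp tendsto_log_natCast))).sqrt
  have h3 := h1.mul h2
  simp only [mul_zero, Real.sqrt_zero] at h3
  refine h3.congr' ?_
  filter_upwards [tendsto_log_natCast.eventually_gt_atTop 0, eventually_gt_atTop 0] with n hn hn'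
  have hn0 : (0 : ℝ) < n := by exact_mod_cast hn'
  have hs : 0 < √(Real.log n) := Real.sqrt_pos.2 hn
  have hss := Real.sq_sqrt hn.le
  have hx : 0 < √(n * √(Real.log n)) := Real.sqrt_pos.2 (by positivity)
  have e : √(C * ((level a n : ℝ) / ((n : ℝ) / Real.log n)) * (√(Real.log n))⁻¹) =
      √(n * √(Real.log n)) * √(C * level a n) / n := by
    rw [← Real.sqrt_mul (by positivity), eq_div_iff hn0.ne']
    refine Eq.trans (b := √(C * ((level a n : ℝ) / ((n : ℝ) / Real.log n)) * (√(Real.log n))⁻¹) *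
      √((n : ℝ) ^ 2)) (by rw [Real.sqrt_sq hn0.le]) ?_
    rw [← Real.sqrt_mul' _ (by positivity)]
    congr 1
    generalize √(Real.log n) = s at hs hss
    rw [← hss]
    field_simp
  rw [e]
  field_simp

end Scale

section Speed

variable {Ω : Type*} {mΩ : MeasurableSpace Ω} {μ : Measure Ω} {ξ : ℤ × ℕ → Ω → Bool}

lemma exists_walk_eq {k n : ℕ} {ω : Ω} (hn : (k : ℤ) ≤ walk ξ n ω) :
    ∃ j ≤ n, walk ξ j ω = k := by
  induction n with
  | zero =>
    have h0 : walk ξ 0 ω = 0 := rfl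
    exact ⟨0, le_rfl, by omega⟩
  | succ n ih =>
    by_cases hk : (k : ℤ) ≤ walk ξ n ω
    · obtain ⟨j, hj, h⟩ := ih hk
      exact ⟨j, by omega, h⟩
    · refine ⟨n + 1, le_rfl, ?_⟩
      rw [walk_succ] at hn ⊢
      split_ifs at hn ⊢ <;> omega

lemma lintegral_branch_le (hξ : IsCoinField r μ ξ) (h : IsCoins M r) :
    ∃ C : ℝ, ∀ k j : ℕ, ∫⁻ ω, (branch ξ (fun l => if l < k then 1 else 0) k (k + j) ω : ℝ≥0∞) ∂μ ≤
      ENNReal.ofReal √(C * k) := by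
  have := hξ.isProb
  obtain ⟨C, _, hC⟩ := integral_sq_le h μ
  refine ⟨C, fun k j => ?_⟩
  induction j with
  | zero =>
    have hY := isChain_branch hξ h k
    have hsq : Integrable (fun ω => (branch ξ (fun _ => 1) k k ω : ℝ) ^ 2) μ :=
      hY.integrable h (φ := fun d : ℕ => (d : ℝ) ^ 2) (polyBdd_pow (by norm_num)) k
    have hm : Measurable (branch ξ (fun _ => 1) k k) :=
      (measurable_branch hξ _ k k).mono ((siteFiltration hξ k).le k) le_rfl
    have hL : MemLp (fun ω => (branch ξ (fun _ => 1) k k ω : ℝ)) 2 μ :=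
      (memLp_two_iff_integrable_sq ((measurable_of_countable _).comp hm).aestronglyMeasurable).2 hsq
    have h1 := (integral_abs_le_sqrt hL).trans (Real.sqrt_le_sqrt (hC _ _ hY k))
    simp only [Nat.abs_cast] at h1
    refine le_trans (le_of_eq ?_) (ENNReal.ofReal_le_ofReal h1)
    rw [ofReal_integral_eq_lintegral_ofReal (hL.integrable (by norm_num))
      (ae_of_all _ fun ω => Nat.cast_nonneg _)]
    refine lintegral_congr fun ω => ?_
    rw [ENNReal.ofReal_natCast, add_zero, branch_congr (fun i hi => if_pos hi) ω le_rfl]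
  | succ j ih =>
    have hz : (fun l => if l < k then 1 else 0) (k + j) = 0 := if_neg (by omega)
    exact (lintegral_branch_succ_le hξ h (n := k)
      (a := fun l => if l < k then 1 else 0) (i := k + j) hz).trans ih

lemma measureReal_sum_branch_ge_le (hξ : IsCoinField r μ ξ) (h : IsCoins M r) :
    ∃ C : ℝ, ∀ (k l : ℕ) (t : ℝ), 0 < t → μ.real {ω | t ≤
      ((∑ j ∈ Finset.range (l + 1),
        branch ξ (fun l => if l < k then 1 else 0) k (k + j) ω : ℕ) : ℝ)} ≤
      (l + 1) * √(C * k) / t := by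
  have := hξ.isProb
  obtain ⟨C, hC⟩ := lintegral_branch_le hξ h
  refine ⟨C, fun k l t ht => ?_⟩
  have hm : ∀ j, Measurable (branch ξ (fun l => if l < k then 1 else 0) k (k + j)) := fun j =>
    (measurable_branch hξ _ k (k + j)).mono ((siteFiltration hξ k).le _) le_rfl
  have hm' : ∀ j, Measurable fun ω =>
      (branch ξ (fun l => if l < k then 1 else 0) k (k + j) ω : ℝ≥0∞) := fun j =>
    (measurable_of_countable (fun z : ℕ => (z : ℝ≥0∞))).comp (hm j)
  have h1 : ∫⁻ ω, ((∑ j ∈ Finset.range (l + 1),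
      branch ξ (fun l => if l < k then 1 else 0) k (k + j) ω : ℕ) : ℝ≥0∞) ∂μ ≤
      ENNReal.ofReal ((l + 1) * √(C * k)) := by
    simp only [Nat.cast_sum]
    rw [lintegral_finsetSum _ fun j _ => hm' j]
    refine (Finset.sum_le_card_nsmul _ _ _ fun j _ => hC k j).trans_eq ?_
    rw [Finset.card_range, nsmul_eq_mul, ENNReal.ofReal_mul (by positivity)]
    congr 1
    rw [← Nat.cast_succ, ENNReal.ofReal_natCast]
  have h2 := meas_ge_le_lintegral_div (μ := μ) (f := fun ω => ((∑ j ∈ Finset.range (l + 1),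
      branch ξ (fun l => if l < k then 1 else 0) k (k + j) ω : ℕ) : ℝ≥0∞))
    (by simp only [Nat.cast_sum]
        exact (Finset.measurable_fun_sum _ fun j _ => hm' j).aemeasurable)
    (ENNReal.ofReal_pos.2 ht).ne' ENNReal.ofReal_ne_top
  refine ENNReal.toReal_le_of_le_ofReal (by positivity) ?_
  rw [ENNReal.ofReal_div_of_pos ht]
  refine (measure_mono fun ω hω => ?_).trans (h2.trans (ENNReal.div_le_div_right h1 _))
  have hω := ENNReal.ofReal_le_ofReal (mem_ofPred_eq.mp hω)
  rwa [ENNReal.ofReal_natCast] at hω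

/-- The walk does not get ahead of its speed. -/
lemma tendsto_measureReal_hit_level (hξ : IsCoinField r μ ξ) {β : ℝ}
    (hlaw : ∀ ε > 0, ∀ δ > 0, ∀ᶠ k : ℕ in atTop, μ.real {ω | ε * (k * Real.log k) <
      |∑ i ∈ Finset.range k, (branch ξ (fun _ => 1) k i ω : ℝ) - β / 4 * (k * Real.log k)|} ≤ δ)
    {a : ℝ} (ha : 0 < a) (haβ : 2 < β * a) :
    Tendsto (fun n => μ.real {ω | ∃ j ≤ n, walk ξ j ω = level a n}) atTop (𝓝 0) := by
  have := hξ.isProb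
  set ε := (β / 4 - 1 / (2 * a)) / 2 with hε
  have hε0 : 0 < ε := by
    have : 1 / (2 * a) < β / 4 := by
      rw [div_lt_div_iff₀ (by positivity) (by norm_num)]; linarith
    rw [hε]; linarith
  have hεa : 1 / 2 < (β / 4 - ε) * a := by
    have : (β / 4 - ε) * a = β * a / 8 + 1 / 4 := by rw [hε]; field_simp; ring
    linarith
  rw [Metric.tendsto_nhds]
  intro δ hδ
  filter_upwards [(tendsto_level ha).eventually (hlaw ε hε0 (δ / 2) (by linarith)),
    ((tendsto_level_mul_log_div ha).const_mul (β / 4 - ε)).eventually_const_lt hεa,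
    eventually_gt_atTop 0] with n h1 h2 hn
  have hn0 : (0 : ℝ) < n := by exact_mod_cast hn
  rw [Real.dist_eq, sub_zero, abs_of_nonneg measureReal_nonneg]
  refine lt_of_le_of_lt ((measureReal_mono fun ω hω => ?_).trans h1) (by linarith)
  obtain ⟨j, hj, hjk⟩ := hω
  have h3 := le_of_walk_eq hjk
  have h4 : (2 : ℝ) * ∑ i ∈ Finset.range (level a n),
      (branch ξ (fun _ => 1) (level a n) i ω : ℝ) ≤ n := by
    exact_mod_cast (by omega : 2 * ∑ i ∈ Finset.range (level a n),
      branch ξ (fun _ => 1) (level a n) i ω ≤ n)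
  rw [← mul_div_assoc, lt_div_iff₀ hn0] at h2
  change _ < |(_ : ℝ)|
  rw [abs_sub_comm]
  refine lt_of_lt_of_le ?_ (le_abs_self _)
  linarith

/-- The walk does not fall behind its speed. -/
lemma tendsto_measureReal_lt_level (hξ : IsCoinField r μ ξ) (h : IsCoins M r) {β : ℝ}
    (hlaw : ∀ ε > 0, ∀ δ > 0, ∀ᶠ k : ℕ in atTop, μ.real {ω | ε * (k * Real.log k) <
      |∑ i ∈ Finset.range k, (branch ξ (fun _ => 1) k i ω : ℝ) - β / 4 * (k * Real.log k)|} ≤ δ)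
    (hexit : ∀ n l : ℕ, 0 < l →
      μ.real {ω | ∃ j ≤ n, walk ξ j ω ≤ -(l : ℤ)} ≤ 4 * n / (l : ℝ) ^ 2)
    {a : ℝ} (ha : 0 < a) (haβ : β * a < 2) :
    Tendsto (fun n => μ.real {ω | ∀ j ≤ n, walk ξ j ω < level a n}) atTop (𝓝 0) := by
  have := hξ.isProb
  obtain ⟨C, hC⟩ := measureReal_sum_branch_ge_le hξ h
  set η := (2 - β * a) / 16 with hη
  have hη0 : 0 < η := by rw [hη]; linarith
  set ε := η / a with hε
  have hε0 : 0 < ε := by positivity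
  have hεa : 0 + 2 * ((β / 4 + ε) * a) + 2 * η < 1 := by
    have : (β / 4 + ε) * a = β * a / 4 + η := by rw [hε]; field_simp
    rw [this, hη]
    linarith
  have hlim : Tendsto (fun n => (level a n : ℝ) / n +
      2 * ((β / 4 + ε) * (level a n * Real.log (level a n) / n)) + 2 * η) atTop
      (𝓝 (0 + 2 * ((β / 4 + ε) * a) + 2 * η)) :=
    ((tendsto_level_div_self ha).add
      (((tendsto_level_mul_log_div ha).const_mul (β / 4 + ε)).const_mul 2)).add_const _
  have htail := (tendsto_depth_mul_sqrt_level ha C).div_const η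
  rw [zero_div] at htail
  have hgood : ∀ᵐ ω ∂μ, ∀ k u, ∃ d, hit (fun j => ξ (k, j) ω) 0 u d :=
    ae_all_iff.2 fun k => ae_all_iff.2 fun u => hξ.ae_exists_hit h k u
  rw [Metric.tendsto_nhds]
  intro δ hδ
  filter_upwards [(tendsto_level ha).eventually (hlaw ε hε0 (δ / 4) (by linarith)),
    hlim.eventually_lt_const hεa, eventually_gt_atTop 0,
    htail.eventually_lt_const (by linarith : (0 : ℝ) < δ / 4),
    tendsto_div_depth_sq.eventually_lt_const (by linarith : (0 : ℝ) < δ / 4),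
    tendsto_sqrt_mul_sqrt_log.eventually_gt_atTop 0] with n h1 h2 hn h3 h4 h5
  have hn0 : (0 : ℝ) < n := by exact_mod_cast hn
  rw [Real.dist_eq, sub_zero, abs_of_nonneg measureReal_nonneg]
  have h6 := hexit n (depth n) (Nat.ceil_pos.2 h5)
  have h7 := hC (level a n) (depth n) (η * n) (by positivity)
  have h8 : ((depth n : ℝ) + 1) * √(C * level a n) / (η * n) =
      (depth n + 1) * √(C * level a n) / n / η := by field_simp
  rw [h8] at h7
  have hsub : μ.real {ω | ∀ j ≤ n, walk ξ j ω < level a n} ≤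
      μ.real (({ω | ∃ j ≤ n, walk ξ j ω ≤ -(depth n : ℤ)} ∪ {ω | η * n ≤
      ((∑ j ∈ Finset.range (depth n + 1), branch ξ (fun l => if l < level a n then 1 else 0)
        (level a n) (level a n + j) ω : ℕ) : ℝ)}) ∪
      {ω | ε * (level a n * Real.log (level a n)) <
        |∑ i ∈ Finset.range (level a n), (branch ξ (fun _ => 1) (level a n) i ω : ℝ) -
          β / 4 * (level a n * Real.log (level a n))|}) := by
    refine ENNReal.toReal_mono (measure_ne_top _ _) (measure_mono_ae ?_)
    filter_upwards [hgood] with ω hω hlt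
    by_contra hc
    have hc1 : ¬ ∃ j ≤ n, walk ξ j ω ≤ -(depth n : ℤ) := fun hh => hc (Or.inl (Or.inl hh))
    have hc2 : ((∑ j ∈ Finset.range (depth n + 1),
        branch ξ (fun l => if l < level a n then 1 else 0) (level a n) (level a n + j) ω : ℕ) : ℝ) <
        η * n := not_le.1 fun hh => hc (Or.inl (Or.inr hh))
    have hc3 : |∑ i ∈ Finset.range (level a n), (branch ξ (fun _ => 1) (level a n) i ω : ℝ) -
        β / 4 * (level a n * Real.log (level a n))| ≤
        ε * (level a n * Real.log (level a n)) := not_lt.1 fun hh => hc (Or.inr hh)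
    have hlt : ∀ j ≤ n, walk ξ j ω < level a n := hlt
    have h9 := le_of_walk_lt (i := n + 1) (ℓ := depth n) hω (fun j hj => hlt j (by omega))
      (fun j hj => by
        by_contra h10
        exact hc1 ⟨j, by omega, by omega⟩)
    rw [add_assoc, Finset.sum_range_add] at h9
    have h10 : ∑ j ∈ Finset.range (level a n), branch ξ (fun l => if l < level a n then 1 else 0)
        (level a n) j ω = ∑ j ∈ Finset.range (level a n), branch ξ (fun _ => 1) (level a n) j ω :=
      Finset.sum_congr rfl fun j hj =>
        branch_congr (fun i hi => if_pos hi) ω (Finset.mem_range.1 hj).le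
    rw [h10] at h9
    have h11 := (abs_le.1 hc3).2
    rw [← Nat.cast_sum] at h11
    have h12 : ((n + 1 : ℕ) : ℝ) ≤ _ := Nat.cast_le.2 h9
    push_cast at h12 h11 hc2
    have h13 : (level a n : ℝ) / n + 2 * ((β / 4 + ε) *
        (level a n * Real.log (level a n) / n)) + 2 * η = ((level a n : ℝ) + 2 * ((β / 4 + ε) *
          (level a n * Real.log (level a n))) + 2 * (η * n)) / n := by
      field_simp
    rw [h13, div_lt_one hn0] at h2
    linarith
  have h14 := measureReal_union_le (μ := μ) ({ω | ∃ j ≤ n, walk ξ j ω ≤ -(depth n : ℤ)} ∪ {ω | η * n ≤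
      ((∑ j ∈ Finset.range (depth n + 1), branch ξ (fun l => if l < level a n then 1 else 0)
        (level a n) (level a n + j) ω : ℕ) : ℝ)})
      {ω | ε * (level a n * Real.log (level a n)) <
        |∑ i ∈ Finset.range (level a n), (branch ξ (fun _ => 1) (level a n) i ω : ℝ) -
          β / 4 * (level a n * Real.log (level a n))|}
  have h15 := measureReal_union_le (μ := μ) {ω | ∃ j ≤ n, walk ξ j ω ≤ -(depth n : ℤ)} {ω | η * n ≤
      ((∑ j ∈ Finset.range (depth n + 1), branch ξ (fun l => if l < level a n then 1 else 0)
        (level a n) (level a n + j) ω : ℕ) : ℝ)}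
  linarith

end Speed

section Conclusion

variable {Ω : Type*} {mΩ : MeasurableSpace Ω} {μ : Measure Ω} {ξ : ℤ × ℕ → Ω → Bool}

lemma exists_log_speed_walk {p : ℕ → ℝ} (h : IsCoins M fun j => cookieP M p (j + 1))
    (hξ : IsCoinField (fun j => cookieP M p (j + 1)) μ ξ) :
    ∃ c : ℝ, 0 < c ∧ ∀ ε : ℝ, 0 < ε →
      Tendsto (fun n : ℕ => μ.real {ω | ε < |Real.log n / n * (walk ξ n ω : ℝ) - c|})
        atTop (𝓝 0) := by
  have := hξ.isProb
  have hW := isCookieRW_walk hξ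
  obtain ⟨β, hβ, hlaw'⟩ := exists_weak_law h μ
  have hβ0 : 0 < β := hβ _ _ (isChain_branch hξ h 0)
  have hlaw : ∀ ε > 0, ∀ δ > 0, ∀ᶠ k : ℕ in atTop, μ.real {ω | ε * (k * Real.log k) <
      |∑ i ∈ Finset.range k, (branch ξ (fun _ => 1) k i ω : ℝ) - β / 4 * (k * Real.log k)|} ≤ δ :=
    fun ε hε δ hδ => by
      filter_upwards [hlaw' ε hε δ hδ] with k hk
      exact hk _ _ (isChain_branch hξ h k)
  set c := 2 / β with hc
  have hc0 : 0 < c := by positivity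
  have hβc : β * c = 2 := by rw [hc]; field_simp
  refine ⟨c, hc0, fun ε hε => ?_⟩
  set ε₀ := min ε (c / 2) with hε₀
  have hε₀0 : 0 < ε₀ := lt_min hε (by linarith)
  have hε₀ε : ε₀ ≤ ε := min_le_left _ _
  have hε₀c : ε₀ ≤ c / 2 := min_le_right _ _
  set a := c - ε₀ / 2 with ha
  have ha0 : 0 < a := by linarith
  have hup := tendsto_measureReal_hit_level hξ hlaw (a := c + ε) (by linarith) (by nlinarith)
  have hlo := tendsto_measureReal_lt_level hξ h hlaw
    (fun n l hl => hW.measureReal_exit_le h n hl) ha0 (by nlinarith)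
  have hdrop : Tendsto (fun n : ℕ => μ.real {ω | (∃ j ≤ n, walk ξ j ω = level a n) ∧
      (walk ξ n ω : ℝ) ≤ (level a n : ℤ) - ε₀ / 4 * (n / Real.log n)}) atTop (𝓝 0) := by
    have h1 := tendsto_sq_log_div.const_mul (64 / ε₀ ^ 2)
    rw [mul_zero] at h1
    refine squeeze_zero' (Eventually.of_forall fun n => measureReal_nonneg) ?_ h1
    filter_upwards [tendsto_log_natCast.eventually_gt_atTop 0, eventually_gt_atTop 0] with n hn hn'
    have hn0 : (0 : ℝ) < n := by exact_mod_cast hn'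
    refine (hW.measureReal_drop_le h (level a n) n (by positivity)).trans_eq ?_
    field_simp
    ring
  have hsum := (hup.add hlo).add hdrop
  simp only [add_zero] at hsum
  refine squeeze_zero' (Eventually.of_forall fun n => measureReal_nonneg) ?_ hsum
  filter_upwards [tendsto_log_natCast.eventually_gt_atTop 0, eventually_gt_atTop 0,
    tendsto_div_log.eventually_ge_atTop (4 / ε₀)] with n hn hn' hbig
  have hn0 : (0 : ℝ) < n := by exact_mod_cast hn'
  have hx0 : 0 < (n : ℝ) / Real.log n := by positivity
  rw [div_le_iff₀ hε₀0] at hbig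
  refine le_trans (measureReal_mono ?_) ((measureReal_union_le _ _).trans
    (add_le_add_left (measureReal_union_le _ _) _))
  intro ω hω
  have hω : ε < |Real.log n / n * (walk ξ n ω : ℝ) - c| := hω
  have hdiv : ∀ y : ℝ, Real.log n / n * y = y / (n / Real.log n) := fun y => by field_simp
  rw [hdiv] at hω
  rcases lt_abs.1 hω with h1 | h1
  · refine Or.inl (Or.inl ?_)
    have h2 : (c + ε) * (n / Real.log n) < walk ξ n ω := by
      rw [← lt_div_iff₀ hx0]; linarith
    have h3 := Nat.floor_le (by positivity : 0 ≤ (c + ε) * ((n : ℝ) / Real.log n))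
    refine exists_walk_eq ?_
    have h4 : ((level (c + ε) n : ℤ) : ℝ) < walk ξ n ω := by
      rw [Int.cast_natCast]; exact h3.trans_lt h2
    exact_mod_cast h4.le
  · by_cases hlt : ∀ j ≤ n, walk ξ j ω < level a n
    · exact Or.inl (Or.inr hlt)
    · refine Or.inr ?_
      push Not at hlt
      obtain ⟨j, hj, hjk⟩ := hlt
      obtain ⟨i, hi, hik⟩ := exists_walk_eq hjk
      refine ⟨⟨i, hi.trans hj, hik⟩, ?_⟩
      have h2 : walk ξ n ω < (c - ε) * (n / Real.log n) := by
        rw [← div_lt_iff₀ hx0]; linarith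
      have h3 := Nat.lt_floor_add_one (a * ((n : ℝ) / Real.log n))
      have h4 : (level a n : ℝ) = ⌊a * ((n : ℝ) / Real.log n)⌋₊ := rfl
      have h5 : (c - ε) * (n / Real.log n) ≤ (c - ε₀) * (n / Real.log n) :=
        mul_le_mul_of_nonneg_right (by linarith) hx0.le
      rw [Int.cast_natCast, h4]
      rw [ha] at h3 ⊢
      nlinarith

end Conclusion

end CookieWalk

/-- For an `(M,p̄)`-cookie random walk with `α = 1`, there is a
constant `c > 0` such that `(log n / n) · X_n → c` in probability. -/
theorem cookie_walk_alpha_one_log_speed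
    (M : ℕ) (hM : 1 ≤ M) (p : ℕ → ℝ)
    (hp : ∀ i, 1 ≤ i → i ≤ M → (1 / 2 : ℝ) ≤ p i ∧ p i < 1)
    {Ω : Type*} [MeasurableSpace Ω] (P : Measure Ω) (X : ℕ → Ω → ℤ)
    (hX : IsCookieRW M p P X) (hα : cookieAlpha M p = 1) :
    ∃ c : ℝ, 0 < c ∧ ∀ ε : ℝ, 0 < ε →
      Tendsto
        (fun n : ℕ => P {ω | ε < |Real.log n / n * (X n ω : ℝ) - c|})
        atTop (𝓝 0) := by
  have h := CookieWalk.isCoins_cookieP hp hα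
  obtain ⟨μ, ξ, hξ⟩ := CookieWalk.exists_isCoinField h
  have := hX.isProb
  have := hξ.isProb
  have hW := CookieWalk.isCookieRW_walk hξ
  obtain ⟨c, hc, hlim⟩ := CookieWalk.exists_log_speed_walk h hξ
  refine ⟨c, hc, fun ε hε => ?_⟩
  have h1 := (ENNReal.tendsto_ofReal (hlim ε hε))
  rw [ENNReal.ofReal_zero] at h1
  refine h1.congr fun n => ?_
  rw [ofReal_measureReal]
  set S : Set ℤ := {z | ε < |Real.log n / n * (z : ℝ) - c|} with hS
  have h2 := congrArg (fun ν => ν S) (hX.map_eq hW n)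
  simp only [Measure.map_apply (hX.meas n) (MeasurableSet.of_discrete (s := S)),
    Measure.map_apply (hW.meas n) (MeasurableSet.of_discrete (s := S))] at h2
  exact h2.symm
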